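/- arXiv:1906.01448 — 2 statements merged into one kernel-verified Lean document; each statement's English description precedes it below -/
import Mathlib

section
/- Let (Ω, μ) be a probability space, 1 ≤ p ≤ 2, m ≥ 1, and let f ∈ V^p_m(Ω^n) have the representation f(x) = ∑_{1 ≤ i_1 < ⋯ < i_m ≤ n} f_{i_1,…,i_m}(x_{i_1},…,x_{i_m}). Then ‖f‖_{L^p(Ω^n)} is equivalent, with constants depending only on m, to the infimum of ∑_{J ⊆ {1,…,m}} ‖ ⨿_i a^{(J)}_i ‖_{L^p(Ω̄^{J'}, L^2(Ω̄^{J}))} over all decompositions f = ∑_{J ⊆ {1,…,m}} a^{(J)} with a^{(J)} ∈ V^p_m(Ω^n) and a^{(J)}(x) = ∑_{1 ≤ i_1 < ⋯ < i_m ≤ n} a^{(J)}_i(x_{i_1},…,x_{i_m}). -/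
open MeasureTheory
open scoped ENNReal

universe u

variable {Ω : Type u} [MeasurableSpace Ω]

/-- The mixed norm `‖⨿_i a_i‖_{L^p(Ω̄^{J'}, L²(Ω̄^{J}))}` on the `m`-fold product of the
disjoint union `Ω̄ = ⨿_{i=1}^n Ω`, where the coordinates indexed by `J' = Jᶜ` form the
outer `L^p` variable and those indexed by `J` form the inner `L²` variable. -/
noncomputable def mixedNormPL2 (μ : Measure Ω) (p : ℝ) {n m : ℕ} (J : Finset (Fin m))
    (a : (Fin m → Fin n) → (Fin m → Ω) → ℝ) : ℝ≥0∞ :=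
  (∑ i' : {k // k ∉ J} → Fin n,
    ∫⁻ ξ' : {k // k ∉ J} → Ω,
      (∑ i'' : {k // k ∈ J} → Fin n,
        ∫⁻ ξ'' : {k // k ∈ J} → Ω,
          ENNReal.ofReal
            ((a (fun k => if h : k ∈ J then i'' ⟨k, h⟩ else i' ⟨k, h⟩)
                (fun k => if h : k ∈ J then ξ'' ⟨k, h⟩ else ξ' ⟨k, h⟩)) ^ 2)
          ∂Measure.pi fun _ => μ) ^ (p/2)
      ∂Measure.pi fun _ => μ) ^ (1/p)

/-- The set of values `∑_{J ⊆ [1,m]} ‖⨿_i a^{(J)}_i‖_{L^p(Ω̄^{J'}, L²(Ω̄^J))}` over all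
decompositions `f = ∑_J a^{(J)}` with all `a^{(J)} ∈ V^p_m(Ω^n)` (componentwise, with
components supported on increasing tuples and of mean zero in each variable). -/
noncomputable def hoeffdingDecompVals (μ : Measure Ω) (p : ℝ) {n m : ℕ}
    (f : (Fin m → Fin n) → (Fin m → Ω) → ℝ) : Set ℝ≥0∞ :=
  {s | ∃ a : Finset (Fin m) → (Fin m → Fin n) → (Fin m → Ω) → ℝ,
    (∀ J i, Measurable (a J i)) ∧
    (∀ J i, ¬ StrictMono i → a J i = 0) ∧
    (∀ J (i : Fin m → Fin n) (k : Fin m),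
      ∀ᵐ y ∂(Measure.pi fun _ : Fin m => μ),
        ∫ z, a J i (Function.update y k z) ∂μ = 0) ∧
    (∀ i ξ, f i ξ = ∑ J : Finset (Fin m), a J i ξ) ∧
    s = ∑ J : Finset (Fin m), mixedNormPL2 μ p J (a J)}

theorem mp_extend {Ω : Type u} [MeasurableSpace Ω] (μ : Measure Ω) [IsProbabilityMeasure μ]
    {ι κ : Type} [Fintype ι] [Fintype κ] (e : ι → κ) (he : Function.Injective e) :
    MeasurePreserving (fun q : (ι → Ω) × (κ → Ω) => Function.extend e q.1 q.2)
      ((Measure.pi fun _ => μ).prod (Measure.pi fun _ => μ)) (Measure.pi fun _ => μ) := by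
  classical
  have hm : Measurable (fun q : (ι → Ω) × (κ → Ω) => Function.extend e q.1 q.2) := by
    refine measurable_pi_lambda _ fun j => ?_
    by_cases hj : ∃ a, e a = j
    · obtain ⟨a, rfl⟩ := hj
      simp only [he.extend_apply]
      exact (measurable_pi_apply a).comp measurable_fst
    · simp only [Function.extend_apply' _ _ _ hj]
      exact (measurable_pi_apply j).comp measurable_snd
  refine ⟨hm, (Measure.pi_eq fun s hs => ?_).symm⟩
  rw [Measure.map_apply hm (MeasurableSet.univ_pi hs)]
  have : (fun q : (ι → Ω) × (κ → Ω) => Function.extend e q.1 q.2) ⁻¹' (Set.univ.pi s)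
      = (Set.univ.pi fun a => s (e a)) ×ˢ
        (Set.univ.pi fun j => if j ∈ Finset.univ.image e then Set.univ else s j) := by
    ext ⟨ξ, y⟩
    simp only [Set.mem_preimage, Set.mem_pi, Set.mem_univ, true_imp_iff, Set.mem_prod]
    constructor
    · intro h
      refine ⟨fun a => by simpa [he.extend_apply] using h (e a), fun j => ?_⟩
      split_ifs with hj
      · trivial
      · have := h j
        rwa [Function.extend_apply'] at this
        simpa using hj
    · rintro ⟨h1, h2⟩ j
      by_cases hj : ∃ a, e a = j
      · obtain ⟨a, rfl⟩ := hj
        simpa [he.extend_apply] using h1 a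
      · rw [Function.extend_apply' _ _ _ hj]
        have := h2 j
        rwa [if_neg (by simpa using hj)] at this
  rw [this, Measure.prod_prod, Measure.pi_pi, Measure.pi_pi,
    ← Finset.prod_image (s := Finset.univ) (g := e) (f := fun j => μ (s j))
      (fun a _ b _ h => he h)]
  rw [← Finset.prod_mul_prod_compl (Finset.univ.image e) (fun j => μ (s j))]
  congr 1
  rw [← Finset.prod_mul_prod_compl (Finset.univ.image e)]
  rw [Finset.prod_eq_one (s := Finset.univ.image e), one_mul]
  · refine Finset.prod_congr rfl fun j hj => ?_
    rw [if_neg (Finset.mem_compl.1 hj)]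
  · intro j hj
    rw [if_pos hj, measure_univ]

theorem mp_update {Ω : Type u} [MeasurableSpace Ω] (μ : Measure Ω) [IsProbabilityMeasure μ]
    {κ : Type} [Fintype κ] [DecidableEq κ] (j : κ) :
    MeasurePreserving (fun q : (κ → Ω) × Ω => Function.update q.1 j q.2)
      ((Measure.pi fun _ => μ).prod μ) (Measure.pi fun _ => μ) := by
  have h1 := mp_extend μ (fun _ : Unit => j) (fun _ _ _ => rfl)
  have h2 : MeasurePreserving (fun z : Ω => (fun _ : Unit => z)) μ (Measure.pi fun _ => μ) :=
    (measurePreserving_funUnique μ Unit).symm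
  have h3 := h1.comp ((h2.prod (MeasurePreserving.id (Measure.pi fun _ : κ => μ))).comp
    (Measure.measurePreserving_swap (μ := (Measure.pi fun _ : κ => μ)) (ν := μ)))
  convert h3 using 1
  funext q
  funext l
  by_cases hl : l = j
  · subst hl
    have : Function.Injective (fun _ : Unit => l) := fun _ _ _ => rfl
    simp only [Function.comp, Function.update_self, Prod.map, Prod.swap]
    exact (this.extend_apply (fun _ : Unit => q.2) _ ()).symm
  · simp only [Function.comp, Function.update_of_ne hl, Prod.map, Prod.swap]
    rw [Function.extend_apply']
    · rfl
    · rintro ⟨_, h⟩; exact hl h.symm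

theorem mp_comp {Ω : Type u} [MeasurableSpace Ω] (μ : Measure Ω) [IsProbabilityMeasure μ]
    {ι κ : Type} [Fintype ι] [Fintype κ] (e : ι → κ) (he : Function.Injective e) :
    MeasurePreserving (fun (x : κ → Ω) => fun a => x (e a))
      (Measure.pi fun _ => μ) (Measure.pi fun _ => μ) := by
  have h1 := mp_extend μ e he
  have hm : Measurable (fun (x : κ → Ω) => fun a => x (e a)) := by fun_prop
  refine ⟨hm, ?_⟩
  rw [← h1.map_eq, Measure.map_map hm h1.measurable]
  have : (fun (x : κ → Ω) => fun a => x (e a)) ∘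
      (fun q : (ι → Ω) × (κ → Ω) => Function.extend e q.1 q.2) = Prod.fst := by
    funext q a
    simp [he.extend_apply]
  rw [this]
  exact measurePreserving_fst.map_eq

theorem jensen_convex {α : Type*} [MeasurableSpace α] (ν : Measure α) [IsProbabilityMeasure ν]
    {p : ℝ} (hp : 1 ≤ p) {h : α → ℝ≥0∞} (hh : AEMeasurable h ν) :
    (∫⁻ a, h a ∂ν) ^ p ≤ ∫⁻ a, h a ^ p ∂ν := by
  rcases eq_or_lt_of_le hp with rfl | hp
  · simp
  have hq : p.HolderConjugate (Real.conjExponent p) := Real.HolderConjugate.conjExponent hp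
  have := ENNReal.lintegral_mul_le_Lp_mul_Lq ν hq hh (g := fun _ => 1) aemeasurable_const
  simp only [Pi.mul_apply, mul_one, ENNReal.one_rpow, lintegral_const, measure_univ] at this
  calc (∫⁻ a, h a ∂ν) ^ p ≤ ((∫⁻ a, h a ^ p ∂ν) ^ (1/p)) ^ p :=
        ENNReal.rpow_le_rpow this (by linarith)
    _ = _ := by
        rw [← ENNReal.rpow_mul, one_div, inv_mul_cancel₀ (by linarith), ENNReal.rpow_one]

theorem jensen_concave {α : Type*} [MeasurableSpace α] (ν : Measure α) [IsProbabilityMeasure ν]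
    {r : ℝ} (hr : 0 < r) (hr1 : r ≤ 1) {h : α → ℝ≥0∞} (hh : AEMeasurable h ν) :
    ∫⁻ a, h a ^ r ∂ν ≤ (∫⁻ a, h a ∂ν) ^ r := by
  have := jensen_convex ν (p := 1/r) (by rw [le_div_iff₀ hr]; linarith) (hh.pow_const r)
  simp only [← ENNReal.rpow_mul, mul_one_div_cancel hr.ne', ENNReal.rpow_one] at this
  calc ∫⁻ a, h a ^ r ∂ν = ((∫⁻ a, h a ^ r ∂ν) ^ (1/r)) ^ r := by
        rw [← ENNReal.rpow_mul, one_div_mul_cancel hr.ne', ENNReal.rpow_one]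
    _ ≤ _ := ENNReal.rpow_le_rpow this hr.le

theorem rpow_anti {x y : ℝ≥0∞} (h : x ≤ y) {s : ℝ} (hs : s ≤ 0) : y ^ s ≤ x ^ s := by
  have hs' : 0 ≤ -s := by linarith
  have h1 := ENNReal.inv_le_inv.2 (ENNReal.rpow_le_rpow h hs')
  rwa [← ENNReal.rpow_neg, ← ENNReal.rpow_neg, neg_neg] at h1

theorem mul_rpow_sub_one {x : ℝ≥0∞} (hx : x ≠ ⊤) {r : ℝ} (hr : 0 < r) :
    x * x ^ (r - 1) = x ^ r := by
  rcases eq_or_ne x 0 with rfl | h0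
  · simp [hr]
  · nth_rewrite 1 [← ENNReal.rpow_one x]
    rw [← ENNReal.rpow_add _ _ h0 hx]
    congr 1; ring

theorem rpow_split (H z : ℝ≥0∞) {r : ℝ} (hr : 0 < r) (hr1 : r ≤ 1) :
    H ^ r ≤ z ^ r + H * z ^ (r - 1) := by
  rcases le_total H z with h | h
  · exact (ENNReal.rpow_le_rpow h hr.le).trans le_self_add
  · rcases eq_or_ne H ⊤ with rfl | hH
    · rcases eq_or_ne z ⊤ with rfl | hz
      · simp [hr]
      · have : z ^ (r-1) ≠ 0 := by
          intro h0
          rw [ENNReal.rpow_eq_zero_iff] at h0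
          rcases h0 with ⟨_, h0⟩ | ⟨h0, _⟩
          · linarith
          · exact hz h0
        rw [ENNReal.top_mul this]; simp
    · rw [← mul_rpow_sub_one hH hr]
      refine le_trans ?_ le_add_self
      exact mul_le_mul_right (rpow_anti h (s := r - 1) (by linarith)) H

theorem minkowski_two {α β : Type*} [MeasurableSpace α] [MeasurableSpace β] (ν : Measure α)
    (ρ : Measure β) [SFinite ν] [SFinite ρ] {F : α → β → ℝ≥0∞}
    (hF : Measurable (Function.uncurry F)) :
    ∫⁻ a, (∫⁻ b, F a b ∂ρ) ^ (2:ℝ) ∂ν ≤ (∫⁻ b, (∫⁻ a, F a b ^ (2:ℝ) ∂ν) ^ (1/2:ℝ) ∂ρ) ^ (2:ℝ) := by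
  have hFb : ∀ b, Measurable (fun a => F a b) := fun b => hF.comp measurable_prodMk_right
  have hFa : ∀ a, Measurable (F a) := fun a => hF.comp measurable_prodMk_left
  have hFs : Measurable (fun q : β × α => F q.2 q.1) := hF.comp measurable_swap
  have hN : Measurable (fun b => (∫⁻ a, F a b ^ (2:ℝ) ∂ν) ^ (1/2:ℝ)) := by
    apply Measurable.pow_const
    apply Measurable.lintegral_prod_right'
      (f := fun q : β × α => F q.2 q.1 ^ (2:ℝ))
    exact hFs.pow_const _
  have e1 : ∀ a, (∫⁻ b, F a b ∂ρ) ^ (2:ℝ) = ∫⁻ b, ∫⁻ b', F a b * F a b' ∂ρ ∂ρ := by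
    intro a
    have : ∀ b, ∫⁻ b', F a b * F a b' ∂ρ = F a b * ∫⁻ b', F a b' ∂ρ :=
      fun b => lintegral_const_mul _ (hFa a)
    simp only [this]
    rw [lintegral_mul_const _ (hFa a), ENNReal.rpow_two, sq]
  have m3 : Measurable (fun q : (α × β) × β => F q.1.1 q.1.2 * F q.1.1 q.2) := by
    apply Measurable.mul
    · exact hF.comp measurable_fst
    · exact hF.comp ((measurable_fst.comp measurable_fst).prodMk measurable_snd)
  simp only [e1]
  rw [lintegral_lintegral_swap]
  swap
  · apply Measurable.aemeasurable
    exact m3.lintegral_prod_right'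
  have e2 : ∀ b, ∫⁻ a, ∫⁻ b', F a b * F a b' ∂ρ ∂ν = ∫⁻ b', ∫⁻ a, F a b * F a b' ∂ν ∂ρ := by
    intro b
    rw [lintegral_lintegral_swap]
    apply Measurable.aemeasurable
    exact ((hFb b).comp measurable_fst).mul hF
  simp only [e2]
  calc _ ≤ ∫⁻ b, ∫⁻ b', (∫⁻ a, F a b ^ (2:ℝ) ∂ν) ^ (1/2:ℝ) * (∫⁻ a, F a b' ^ (2:ℝ) ∂ν) ^ (1/2:ℝ)
          ∂ρ ∂ρ := by
        refine lintegral_mono fun b => lintegral_mono fun b' => ?_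
        exact ENNReal.lintegral_mul_le_Lp_mul_Lq ν Real.HolderConjugate.two_two
          (hFb b).aemeasurable (hFb b').aemeasurable
    _ = _ := by
        have : ∀ b, ∫⁻ b', (∫⁻ a, F a b ^ (2:ℝ) ∂ν) ^ (1/2:ℝ) * (∫⁻ a, F a b' ^ (2:ℝ) ∂ν) ^ (1/2:ℝ)
          ∂ρ = (∫⁻ a, F a b ^ (2:ℝ) ∂ν) ^ (1/2:ℝ) * ∫⁻ b', (∫⁻ a, F a b' ^ (2:ℝ) ∂ν) ^ (1/2:ℝ) ∂ρ :=
          fun b => lintegral_const_mul _ hN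
        simp only [this]
        rw [lintegral_mul_const _ hN, ENNReal.rpow_two, sq]

/-- The sign character. -/
def sgnChar {κ : Type} [DecidableEq κ] (σ t : Finset κ) : ℝ :=
  ∏ j ∈ t, if j ∈ σ then (-1 : ℝ) else 1

theorem sgnChar_split {κ : Type} [DecidableEq κ] (a : κ) (s : Finset κ) (ha : a ∉ s)
    (c : Finset κ → ℝ) (σ : Finset κ) (hσ : σ ∈ s.powerset) :
    (∑ t ∈ (insert a s).powerset, c t * sgnChar σ t
      = ∑ t ∈ s.powerset, c t * sgnChar σ t + ∑ t ∈ s.powerset, c (insert a t) * sgnChar σ t) ∧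
    (∑ t ∈ (insert a s).powerset, c t * sgnChar (insert a σ) t
      = ∑ t ∈ s.powerset, c t * sgnChar σ t - ∑ t ∈ s.powerset, c (insert a t) * sgnChar σ t) := by
  have hσ' : a ∉ σ := fun h => ha (Finset.mem_powerset.1 hσ h)
  have key : ∀ t ∈ s.powerset, sgnChar (insert a σ) t = sgnChar σ t := by
    intro t ht
    refine Finset.prod_congr rfl fun j hj => ?_
    have : j ≠ a := by rintro rfl; exact ha (Finset.mem_powerset.1 ht hj)
    simp [this]
  have key2 : ∀ t ∈ s.powerset, sgnChar σ (insert a t) = sgnChar σ t := by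
    intro t ht
    unfold sgnChar
    rw [Finset.prod_insert (fun h => ha (Finset.mem_powerset.1 ht h))]
    simp [hσ']
  have key3 : ∀ t ∈ s.powerset, sgnChar (insert a σ) (insert a t) = - sgnChar σ t := by
    intro t ht
    rw [← key t ht]
    unfold sgnChar
    rw [Finset.prod_insert (fun h => ha (Finset.mem_powerset.1 ht h))]
    simp
  rw [Finset.sum_powerset_insert ha, Finset.sum_powerset_insert ha]
  constructor
  · congr 1
    exact Finset.sum_congr rfl fun t ht => by rw [key2 t ht]
  · rw [sub_eq_add_neg, ← Finset.sum_neg_distrib]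
    congr 1
    · exact Finset.sum_congr rfl fun t ht => by rw [key t ht]
    · exact Finset.sum_congr rfl fun t ht => by rw [key3 t ht]; ring

theorem second_moment {κ : Type} [DecidableEq κ] (s : Finset κ) : ∀ (c : Finset κ → ℝ),
    ∑ σ ∈ s.powerset, (∑ t ∈ s.powerset, c t * sgnChar σ t) ^ 2
      = 2 ^ s.card * ∑ t ∈ s.powerset, c t ^ 2 := by
  induction s using Finset.induction_on with
  | empty => intro c; simp [sgnChar]
  | insert a s ha ih =>
    intro c
    rw [Finset.sum_powerset_insert ha, Finset.sum_powerset_insert ha, Finset.card_insert_of_notMem ha,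
      ← Finset.sum_add_distrib]
    have : ∀ σ ∈ s.powerset,
      (∑ t ∈ (insert a s).powerset, c t * sgnChar σ t) ^ 2 +
        (∑ t ∈ (insert a s).powerset, c t * sgnChar (insert a σ) t) ^ 2
      = 2 * (∑ t ∈ s.powerset, c t * sgnChar σ t) ^ 2 +
        2 * (∑ t ∈ s.powerset, c (insert a t) * sgnChar σ t) ^ 2 := by
      intro σ hσ
      obtain ⟨h1, h2⟩ := sgnChar_split a s ha c σ hσ
      rw [h1, h2]; ring
    rw [Finset.sum_congr rfl this, Finset.sum_add_distrib, ← Finset.mul_sum, ← Finset.mul_sum,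
      ih c, ih (fun t => c (insert a t))]
    ring

theorem fourth_moment {κ : Type} [DecidableEq κ] (s : Finset κ) : ∀ (m : ℕ) (c : Finset κ → ℝ),
    (∀ t ∈ s.powerset, m < t.card → c t = 0) →
    ∑ σ ∈ s.powerset, (∑ t ∈ s.powerset, c t * sgnChar σ t) ^ 4
      ≤ 2 ^ s.card * (9 ^ m * (∑ t ∈ s.powerset, c t ^ 2) ^ 2) := by
  induction s using Finset.induction_on with
  | empty =>
    intro m c _
    simp only [Finset.powerset_empty, Finset.sum_singleton, sgnChar, Finset.prod_empty, mul_one,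
      Finset.card_empty, pow_zero, one_mul]
    have : (1:ℝ) ≤ 9 ^ m := one_le_pow₀ (by norm_num)
    nlinarith [sq_nonneg (c ∅ ^ 2)]
  | insert a s ha ih =>
    intro m c hc
    rw [Finset.sum_powerset_insert ha, Finset.sum_powerset_insert ha, Finset.card_insert_of_notMem ha,
      ← Finset.sum_add_distrib]
    set A : Finset κ → ℝ := fun σ => ∑ t ∈ s.powerset, c t * sgnChar σ t with hA
    set B : Finset κ → ℝ := fun σ => ∑ t ∈ s.powerset, c (insert a t) * sgnChar σ t with hB
    have h1 : ∀ σ ∈ s.powerset,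
      (∑ t ∈ (insert a s).powerset, c t * sgnChar σ t) ^ 4 +
        (∑ t ∈ (insert a s).powerset, c t * sgnChar (insert a σ) t) ^ 4
      = 2 * A σ ^ 4 + 12 * (A σ ^ 2 * B σ ^ 2) + 2 * B σ ^ 4 := by
      intro σ hσ
      obtain ⟨h1, h2⟩ := sgnChar_split a s ha c σ hσ
      rw [h1, h2]; simp only [hA, hB]; ring
    rw [Finset.sum_congr rfl h1, Finset.sum_add_distrib, Finset.sum_add_distrib, ← Finset.mul_sum,
      ← Finset.mul_sum, ← Finset.mul_sum]
    set α := ∑ t ∈ s.powerset, c t ^ 2 with hα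
    set β := ∑ t ∈ s.powerset, c (insert a t) ^ 2 with hβ
    have hα0 : 0 ≤ α := Finset.sum_nonneg fun _ _ => sq_nonneg _
    have hβ0 : 0 ≤ β := Finset.sum_nonneg fun _ _ => sq_nonneg _
    have hAA : ∑ σ ∈ s.powerset, A σ ^ 4 ≤ 2 ^ s.card * (9 ^ m * α ^ 2) :=
      ih m c fun t ht => hc t (Finset.mem_powerset.2
        ((Finset.mem_powerset.1 ht).trans (Finset.subset_insert a s)))
    have hBB : ∑ σ ∈ s.powerset, B σ ^ 4 ≤ 2 ^ s.card * (9 ^ m / 9 * β ^ 2) := by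
      cases m with
      | zero =>
        have : ∀ t ∈ s.powerset, c (insert a t) = 0 := fun t ht =>
          hc _ (Finset.mem_powerset.2 (Finset.insert_subset_insert a (Finset.mem_powerset.1 ht)))
            (Finset.card_pos.2 ⟨a, Finset.mem_insert_self a t⟩)
        have hB0 : ∀ σ, B σ = 0 := fun σ =>
          Finset.sum_eq_zero fun t ht => by rw [this t ht, zero_mul]
        simp only [hB0]
        simp
        positivity
      | succ m =>
        have := ih m (fun t => c (insert a t)) fun t ht htc =>
          hc _ (Finset.mem_powerset.2 (Finset.insert_subset_insert a (Finset.mem_powerset.1 ht)))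
            (by rw [Finset.card_insert_of_notMem
                  (fun h => ha (Finset.mem_powerset.1 ht h))]; omega)
        refine this.trans (le_of_eq ?_)
        rw [pow_succ]; ring
    have hAB : ∑ σ ∈ s.powerset, A σ ^ 2 * B σ ^ 2 ≤ 2 ^ s.card * (9 ^ m / 3 * (α * β)) := by
      have cs := Finset.sum_mul_sq_le_sq_mul_sq s.powerset (fun σ => A σ ^ 2) (fun σ => B σ ^ 2)
      simp only [← pow_mul] at cs
      norm_num at cs
      refine abs_le_of_sq_le_sq' ?_ (by positivity) |>.2
      refine cs.trans ?_
      calc _ ≤ (2 ^ s.card * (9 ^ m * α ^ 2)) * (2 ^ s.card * (9 ^ m / 9 * β ^ 2)) := by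
            gcongr
        _ = _ := by ring
    have hfin : (2:ℝ) ^ (s.card + 1) * (9 ^ m * (α + β) ^ 2) =
      2 * (2 ^ s.card * (9 ^ m * α ^ 2)) + 12 * (2 ^ s.card * (9 ^ m / 3 * (α * β)))
      + 2 * (2 ^ s.card * (9 ^ m / 9 * β ^ 2)) + 2 ^ s.card * 9 ^ m * ((16/9) * β ^ 2 ) := by
      ring_nf
    have : 0 ≤ (2:ℝ) ^ s.card * 9 ^ m * ((16/9) * β ^ 2) := by positivity
    rw [hfin]
    linarith

theorem rpow_two_sided (u p : ℝ) (hp1 : 1 ≤ p) (hp2 : p ≤ 2) :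
    u ^ 2 - u ^ 4 / 4 ≤ |u| ^ p ∧ |u| ^ p ≤ 1 + u ^ 2 := by
  have h0 : 0 ≤ |u| := abs_nonneg u
  have e2 : u ^ 2 = |u| ^ (2:ℝ) := by rw [Real.rpow_two, sq_abs]
  have hu4 : 0 ≤ u ^ 4 := by positivity
  rcases le_total |u| 1 with h | h
  · constructor
    · have : |u| ^ (2:ℝ) ≤ |u| ^ p := by
        rcases eq_or_lt_of_le h0 with h00 | h00
        · rw [← h00, Real.zero_rpow (by norm_num), Real.zero_rpow (by linarith)]
        · exact Real.rpow_le_rpow_of_exponent_ge h00 h hp2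
      rw [← e2] at this
      linarith
    · have := Real.rpow_le_one h0 h (by linarith : 0 ≤ p)
      nlinarith [sq_nonneg u]
  · constructor
    · have := Real.one_le_rpow h (by linarith : 0 ≤ p)
      nlinarith [sq_nonneg (u ^ 2 - 2)]
    · have := Real.rpow_le_rpow_of_exponent_le h hp2
      rw [← e2] at this
      linarith

theorem khinchine {κ : Type} [DecidableEq κ] (s : Finset κ) (m : ℕ) (c : Finset κ → ℝ)
    (hc : ∀ t ∈ s.powerset, m < t.card → c t = 0) (p : ℝ) (hp1 : 1 ≤ p) (hp2 : p ≤ 2) :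
    2 ^ s.card * (∑ t ∈ s.powerset, c t ^ 2) ^ (p/2)
      ≤ 2 * 9 ^ m * ∑ σ ∈ s.powerset, |∑ t ∈ s.powerset, c t * sgnChar σ t| ^ p ∧
    ∑ σ ∈ s.powerset, |∑ t ∈ s.powerset, c t * sgnChar σ t| ^ p
      ≤ 2 * (2 ^ s.card * (∑ t ∈ s.powerset, c t ^ 2) ^ (p/2)) := by
  have h2 := second_moment s c
  have h4 := fourth_moment s m c hc
  set V := ∑ t ∈ s.powerset, c t ^ 2 with hV
  set X : Finset κ → ℝ := fun σ => ∑ t ∈ s.powerset, c t * sgnChar σ t with hX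
  have hV0 : 0 ≤ V := Finset.sum_nonneg fun _ _ => sq_nonneg _
  have h9 : (1:ℝ) ≤ 9 ^ m := one_le_pow₀ (by norm_num)
  have hcard : (s.powerset.card : ℝ) = 2 ^ s.card := by rw [Finset.card_powerset]; push_cast; rfl
  rcases eq_or_lt_of_le hV0 with h0 | hVpos
  · have hX0 : ∀ σ ∈ s.powerset, X σ = 0 := by
      intro σ hσ
      rw [← h0, mul_zero] at h2
      have := (Finset.sum_eq_zero_iff_of_nonneg (fun _ _ => sq_nonneg _)).1 h2 σ hσ
      exact pow_eq_zero_iff (two_ne_zero) |>.1 this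
    have : ∑ σ ∈ s.powerset, |X σ| ^ p = 0 := Finset.sum_eq_zero fun σ hσ => by
      rw [hX0 σ hσ, abs_zero, Real.zero_rpow (by linarith)]
    change _ ≤ _ * ∑ σ ∈ s.powerset, |X σ| ^ p ∧ ∑ σ ∈ s.powerset, |X σ| ^ p ≤ _
    rw [this, ← h0, Real.zero_rpow (by linarith)]
    simp
  have scale : ∀ l : ℝ, 0 < l → ∀ x : ℝ, |x| ^ p = l ^ p * |x / l| ^ p := by
    intro l hl x
    rw [← Real.mul_rpow hl.le (abs_nonneg _), abs_div, abs_of_pos hl, mul_div_cancel₀ _ hl.ne']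
  change _ ≤ _ * ∑ σ ∈ s.powerset, |X σ| ^ p ∧ ∑ σ ∈ s.powerset, |X σ| ^ p ≤ _
  change ∑ σ ∈ s.powerset, X σ ^ 2 = _ at h2
  change ∑ σ ∈ s.powerset, X σ ^ 4 ≤ _ at h4
  constructor
  · set l := Real.sqrt (9 ^ m * V) with hl
    have hlpos : 0 < l := Real.sqrt_pos.2 (by positivity)
    have hl2 : l ^ 2 = 9 ^ m * V := Real.sq_sqrt (by positivity)
    have hl4 : l ^ 4 = (9 ^ m * V) ^ 2 := by rw [← hl2]; ring
    have hlp : V ^ (p/2) ≤ l ^ p := by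
      rw [hl, Real.sqrt_eq_rpow, ← Real.rpow_mul (by positivity), show 1/2*p = p/2 by ring]
      exact Real.rpow_le_rpow hV0 (by nlinarith) (by linarith)
    have hlp0 : 0 < l ^ p := Real.rpow_pos_of_pos hlpos p
    have : ∑ σ ∈ s.powerset, |X σ| ^ p ≥ l ^ p * (2 ^ s.card * ((3/4) / 9 ^ m)) := by
      rw [Finset.sum_congr rfl (fun σ _ => scale l hlpos (X σ))]
      rw [← Finset.mul_sum]
      refine mul_le_mul_of_nonneg_left ?_ hlp0.le
      calc 2 ^ s.card * ((3/4) / 9 ^ m)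
          = (2 ^ s.card * V) / l ^ 2 - (2 ^ s.card * (9 ^ m * V ^ 2)) / (4 * l ^ 4) := by
            rw [hl2, hl4]; field_simp; ring
        _ ≤ (∑ σ ∈ s.powerset, X σ ^ 2) / l ^ 2 - (∑ σ ∈ s.powerset, X σ ^ 4) / (4 * l ^ 4) := by
            rw [h2]; gcongr
        _ = ∑ σ ∈ s.powerset, ((X σ / l) ^ 2 - (X σ / l) ^ 4 / 4) := by
            rw [Finset.sum_div, Finset.sum_div, ← Finset.sum_sub_distrib]
            refine Finset.sum_congr rfl fun σ _ => ?_
            field_simp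
        _ ≤ _ := Finset.sum_le_sum fun σ _ => (rpow_two_sided _ p hp1 hp2).1
    calc 2 ^ s.card * V ^ (p/2) ≤ 2 ^ s.card * l ^ p := by gcongr
      _ ≤ 2 * 9 ^ m * (l ^ p * (2 ^ s.card * ((3/4) / 9 ^ m))) := by
          have : 2 * 9 ^ m * (l ^ p * (2 ^ s.card * ((3/4) / 9 ^ m))) = 3/2 * (2 ^ s.card * l ^ p) := by
            field_simp; ring
          rw [this]
          have : 0 ≤ 2 ^ s.card * l ^ p := by positivity
          linarith
      _ ≤ _ := by gcongr
  · set l := Real.sqrt V with hl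
    have hlpos : 0 < l := Real.sqrt_pos.2 hVpos
    have hl2 : l ^ 2 = V := Real.sq_sqrt hV0
    have hlp : V ^ (p/2) = l ^ p := by
      rw [hl, Real.sqrt_eq_rpow, ← Real.rpow_mul (by positivity), show 1/2*p = p/2 by ring]
    have hlp0 : 0 < l ^ p := Real.rpow_pos_of_pos hlpos p
    rw [Finset.sum_congr rfl (fun σ _ => scale l hlpos (X σ))]
    rw [← Finset.mul_sum, hlp]
    calc _ ≤ l ^ p * ∑ σ ∈ s.powerset, (1 + (X σ / l) ^ 2) := by
          gcongr; exact (rpow_two_sided _ p hp1 hp2).2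
      _ = l ^ p * (2 ^ s.card + (∑ σ ∈ s.powerset, X σ ^ 2) / l ^ 2) := by
          rw [Finset.sum_add_distrib, Finset.sum_div, Finset.sum_const, nsmul_eq_mul, hcard, mul_one]
          simp_rw [div_pow]
      _ = _ := by rw [h2, hl2]; field_simp; ring

theorem image_strictMono_inj {m n : ℕ} {i j : Fin m → Fin n} (hi : StrictMono i) (hj : StrictMono j)
    (h : Finset.univ.image i = Finset.univ.image j) : i = j := by
  refine (StrictMono.range_inj hi hj).1 ?_
  have := congrArg (fun s : Finset (Fin n) => (s : Set (Fin n))) h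
  simpa using this

/-- Khinchine for tuples. -/
theorem khinchine_tuple {m n : ℕ} (f : (Fin m → Fin n) → ℝ) (hf : ∀ i, ¬ StrictMono i → f i = 0)
    (p : ℝ) (hp1 : 1 ≤ p) (hp2 : p ≤ 2) :
    2 ^ n * (∑ i, f i ^ 2) ^ (p/2)
      ≤ 2 * 9 ^ m * ∑ σ : Finset (Fin n), |∑ i, f i * ∏ k, (if i k ∈ σ then (-1:ℝ) else 1)| ^ p ∧
    ∑ σ : Finset (Fin n), |∑ i, f i * ∏ k, (if i k ∈ σ then (-1:ℝ) else 1)| ^ p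
      ≤ 2 * (2 ^ n * (∑ i, f i ^ 2) ^ (p/2)) := by
  classical
  set c : Finset (Fin n) → ℝ := fun t => ∑ i, if Finset.univ.image i = t then f i else 0 with hc
  have hcimg : ∀ i, StrictMono i → c (Finset.univ.image i) = f i := by
    intro i hi
    simp only [hc]
    rw [Finset.sum_eq_single i]
    · simp
    · intro j _ hj
      split_ifs with h
      · refine hf j fun hjm => hj (image_strictMono_inj hjm hi h)
      · rfl
    · simp
  have h1 : ∀ t ∈ (Finset.univ : Finset (Fin n)).powerset, m < t.card → c t = 0 := by
    intro t _ ht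
    refine Finset.sum_eq_zero fun i _ => ?_
    rw [if_neg]
    rintro rfl
    have := Finset.card_image_le (s := Finset.univ) (f := i)
    simp at this
    omega
  have h2 : ∑ t ∈ (Finset.univ : Finset (Fin n)).powerset, c t ^ 2 = ∑ i, f i ^ 2 := by
    have e : ∀ t, c t ^ 2 = ∑ i, if Finset.univ.image i = t then f i ^ 2 else 0 := by
      intro t
      by_cases h : ∃ i : Fin m → Fin n, StrictMono i ∧ Finset.univ.image i = t
      · obtain ⟨i, hi, rfl⟩ := h
        rw [hcimg i hi, Finset.sum_eq_single i]
        · simp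
        · intro j _ hj
          split_ifs with h
          · rw [hf j fun hjm => hj (image_strictMono_inj hjm hi h)]; simp
          · rfl
        · simp
      · have hz : ∀ i, Finset.univ.image i = t → f i = 0 := fun i hi =>
          hf i fun hm => h ⟨i, hm, hi⟩
        have : c t = 0 := Finset.sum_eq_zero fun i _ => by
          split_ifs with hi
          · exact hz i hi
          · rfl
        rw [this, Finset.sum_eq_zero fun i _ => ?_]
        · simp
        · split_ifs with hi
          · rw [hz i hi]; simp
          · rfl
    simp_rw [e]
    rw [Finset.sum_comm]
    refine Finset.sum_congr rfl fun i _ => ?_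
    simp
  have h3 : ∀ σ, ∑ t ∈ (Finset.univ : Finset (Fin n)).powerset, c t * sgnChar σ t
      = ∑ i, f i * ∏ k, (if i k ∈ σ then (-1:ℝ) else 1) := by
    intro σ
    simp only [hc, Finset.sum_mul, ite_mul, zero_mul]
    rw [Finset.sum_comm]
    refine Finset.sum_congr rfl fun i _ => ?_
    rw [Finset.sum_ite_eq]
    simp only [Finset.mem_powerset, Finset.subset_univ, if_true]
    by_cases hi : StrictMono i
    · unfold sgnChar
      rw [Finset.prod_image fun a _ b _ h => hi.injective h]
    · rw [hf i hi]; simp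
  have := khinchine Finset.univ m c h1 p hp1 hp2
  rw [h2] at this
  simp only [h3, Finset.card_univ, Fintype.card_fin] at this
  simpa using this

/-- The chaos associated with a family of kernels. -/
noncomputable def chaos {n m : ℕ} (f : (Fin m → Fin n) → (Fin m → Ω) → ℝ) (x : Fin n → Ω) : ℝ :=
  ∑ i, f i fun k => x (i k)

/-- Admissible families of kernels. -/
structure HC (μ : Measure Ω) {n m : ℕ} (f : (Fin m → Fin n) → (Fin m → Ω) → ℝ) : Prop where
  meas : ∀ i, Measurable (f i)
  supp : ∀ i, ¬ StrictMono i → f i = 0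
  int : ∀ i, Integrable (f i) (Measure.pi fun _ => μ)
  mz : ∀ (i : Fin m → Fin n) (k : Fin m), ∀ᵐ y ∂(Measure.pi fun _ : Fin m => μ),
    ∫ z, f i (Function.update y k z) ∂μ = 0

theorem HC.ite {μ : Measure Ω} {n m : ℕ} {f : (Fin m → Fin n) → (Fin m → Ω) → ℝ} (hf : HC μ f)
    (w : (Fin m → Fin n) → ℝ) : HC μ (fun i ξ => w i * f i ξ) where
  meas i := (hf.meas i).const_mul _
  supp i hi := by funext ξ; simp [hf.supp i hi]
  int i := (hf.int i).const_mul _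
  mz i k := by
    filter_upwards [hf.mz i k] with y hy
    rw [integral_const_mul, hy, mul_zero]

theorem chaos_measurable {n m : ℕ} {f : (Fin m → Fin n) → (Fin m → Ω) → ℝ}
    (hf : ∀ i, Measurable (f i)) : Measurable (chaos f) := by
  unfold chaos
  refine Finset.measurable_sum _ fun i _ => (hf i).comp ?_
  fun_prop

theorem slice_integrable {μ : Measure Ω} [IsProbabilityMeasure μ] {κ : Type} [Fintype κ]
    [DecidableEq κ] {g : (κ → Ω) → ℝ} (hg : Integrable g (Measure.pi fun _ => μ)) (j : κ) :
    ∀ᵐ y ∂(Measure.pi fun _ : κ => μ), Integrable (fun z => g (Function.update y j z)) μ := by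
  have := (mp_update μ j).integrable_comp_of_integrable hg
  exact this.prod_right_ae

theorem chaos_slice {μ : Measure Ω} [IsProbabilityMeasure μ] {n m : ℕ}
    {f : (Fin m → Fin n) → (Fin m → Ω) → ℝ} (hf : HC μ f) (j : Fin n) :
    ∀ᵐ x ∂(Measure.pi fun _ : Fin n => μ),
      ∫ z, chaos f (Function.update x j z) ∂μ
        = chaos (fun i ξ => (if ∃ k, i k = j then 0 else 1) * f i ξ) x := by
  classical
  have key : ∀ i : Fin m → Fin n, ∀ᵐ x ∂(Measure.pi fun _ : Fin n => μ),
      Integrable (fun z => f i fun k => Function.update x j z (i k)) μ ∧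
      ∫ z, f i (fun k => Function.update x j z (i k)) ∂μ
        = (if ∃ k, i k = j then 0 else 1) * f i fun k => x (i k) := by
    intro i
    by_cases hi : StrictMono i
    · have mp := mp_comp μ i hi.injective
      by_cases hj : ∃ k, i k = j
      · obtain ⟨k, rfl⟩ := hj
        have hu : ∀ (x : Fin n → Ω) z, (fun l => Function.update x (i k) z (i l))
            = Function.update (fun l => x (i l)) k z := fun x z =>
          Function.update_comp_eq_of_injective x hi.injective k z
        filter_upwards [mp.quasiMeasurePreserving.ae (hf.mz i k),
          mp.quasiMeasurePreserving.ae (slice_integrable (hf.int i) k)] with x h1 h2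
        simp only [hu]
        refine ⟨h2, ?_⟩
        rw [h1, if_pos ⟨k, rfl⟩, zero_mul]
      · refine Filter.Eventually.of_forall fun x => ?_
        have hu : ∀ z, (fun l => Function.update x j z (i l)) = fun l => x (i l) := fun z => by
          funext l
          exact Function.update_of_ne (fun h => hj ⟨l, h⟩) _ _
        simp only [hu, if_neg hj]
        simp
    · simp [hf.supp i hi]
  filter_upwards [ae_all_iff.2 key] with x hx
  unfold chaos
  rw [integral_finsetSum _ fun i _ => (hx i).1]
  exact Finset.sum_congr rfl fun i _ => (hx i).2

theorem chaos_remove {μ : Measure Ω} [IsProbabilityMeasure μ] {n m : ℕ}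
    {f : (Fin m → Fin n) → (Fin m → Ω) → ℝ} (hf : HC μ f) (j : Fin n) {p : ℝ} (hp : 1 ≤ p) :
    ∫⁻ x, ‖chaos (fun i ξ => (if ∃ k, i k = j then 0 else 1) * f i ξ) x‖ₑ ^ p
        ∂(Measure.pi fun _ : Fin n => μ)
      ≤ ∫⁻ x, ‖chaos f x‖ₑ ^ p ∂(Measure.pi fun _ : Fin n => μ) := by
  have hm := chaos_measurable hf.meas
  have hm' : Measurable (fun x => ‖chaos f x‖ₑ ^ p) := (hm.enorm).pow_const _
  rw [← (mp_update μ j).lintegral_comp hm']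
  rw [lintegral_prod (fun a : (Fin n → Ω) × Ω => ‖chaos f (Function.update a.1 j a.2)‖ₑ ^ p)
    (hm'.comp (mp_update μ j).measurable).aemeasurable]
  refine lintegral_mono_ae ?_
  filter_upwards [chaos_slice hf j] with x hx
  rw [← hx]
  refine le_trans (ENNReal.rpow_le_rpow (enorm_integral_le_lintegral_enorm _) (by linarith)) ?_
  refine jensen_convex μ hp ?_
  apply Measurable.aemeasurable
  exact (hm.comp (measurable_update x)).enorm

theorem chaos_restrict {μ : Measure Ω} [IsProbabilityMeasure μ] {n m : ℕ}
    {f : (Fin m → Fin n) → (Fin m → Ω) → ℝ} (hf : HC μ f) (R : Finset (Fin n)) {p : ℝ}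
    (hp : 1 ≤ p) :
    ∫⁻ x, ‖chaos (fun i ξ => (if ∃ k, i k ∈ R then 0 else 1) * f i ξ) x‖ₑ ^ p
        ∂(Measure.pi fun _ : Fin n => μ)
      ≤ ∫⁻ x, ‖chaos f x‖ₑ ^ p ∂(Measure.pi fun _ : Fin n => μ) := by
  classical
  induction R using Finset.induction_on with
  | empty => simp
  | insert j R hj ih =>
    refine le_trans (le_of_eq ?_)
      ((chaos_remove (hf.ite (fun i => if ∃ k, i k ∈ R then 0 else 1)) j hp).trans ih)
    refine lintegral_congr fun x => ?_
    congr 3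
    funext i ξ
    rw [← mul_assoc]
    congr 1
    by_cases h1 : ∃ k, i k = j
    · obtain ⟨k, hk⟩ := h1
      rw [if_pos ⟨k, by simp [hk]⟩, if_pos ⟨k, hk⟩, zero_mul]
    · rw [if_neg h1, one_mul]
      congr 1
      have : ∀ k, i k ≠ j := fun k h => h1 ⟨k, h⟩
      simp [this]

theorem exists_interp (m : ℕ) : ∃ l : Fin (m+1) → ℝ, ∀ d : ℕ, d ≤ m →
    ∑ q : Fin (m+1), l q * ((q : ℕ) / (m+1 : ℝ)) ^ d = (-1) ^ d := by
  set v : Fin (m+1) → ℝ := fun q => (q : ℕ) / (m+1 : ℝ) with hv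
  have hinj : Function.Injective v := by
    intro a b h
    simp only [hv] at h
    have : (m+1 : ℝ) ≠ 0 := by positivity
    rw [div_left_inj' this] at h
    exact Fin.ext (by exact_mod_cast h)
  have hu : IsUnit (Matrix.vandermonde v) := by
    rw [Matrix.isUnit_iff_isUnit_det]
    exact (Matrix.det_vandermonde_ne_zero_iff.2 hinj).isUnit
  obtain ⟨l, hl⟩ := Matrix.vecMul_surjective_iff_isUnit.2 hu (fun d => (-1) ^ (d : ℕ))
  refine ⟨l, fun d hd => ?_⟩
  have := congrFun hl ⟨d, by omega⟩
  simpa [Matrix.vecMul, dotProduct, Matrix.vandermonde_apply] using this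

/-- Signs as bounded combinations of indicators of restrictions. -/
theorem exists_weights (m : ℕ) : ∃ Λ : ℝ, 0 < Λ ∧ ∀ (n : ℕ) (σ : Finset (Fin n)),
    ∃ w : Finset (Fin n) → ℝ, ∑ R, |w R| ≤ Λ ∧ ∀ i : Fin m → Fin n, Function.Injective i →
      ∑ R, w R * (if ∃ k, i k ∈ R then 0 else 1) = ∏ k, (if i k ∈ σ then (-1:ℝ) else 1) := by
  classical
  obtain ⟨l, hl⟩ := exists_interp m
  refine ⟨∑ q, |l q| + 1, by positivity, fun n σ => ?_⟩
  set ρ : Fin (m+1) → Fin n → ℝ := fun q j => if j ∈ σ then ((q : ℕ) / (m+1 : ℝ)) else 1 with hρ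
  have hρ0 : ∀ q j, 0 ≤ ρ q j := by
    intro q j; simp only [hρ]; split_ifs <;> positivity
  have hρ1 : ∀ q j, 0 ≤ 1 - ρ q j := by
    intro q j; simp only [hρ]; split_ifs
    · rw [sub_nonneg, div_le_one (by positivity)]
      have := q.2
      exact_mod_cast this.le
    · simp
  set W : Fin (m+1) → Finset (Fin n) → ℝ :=
    fun q R => (∏ j ∈ R, (1 - ρ q j)) * ∏ j ∈ Finset.univ \ R, ρ q j with hW
  have hW0 : ∀ q R, 0 ≤ W q R := fun q R => mul_nonneg
    (Finset.prod_nonneg fun j _ => hρ1 q j) (Finset.prod_nonneg fun j _ => hρ0 q j)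
  have hW1 : ∀ q, ∑ R, W q R = 1 := by
    intro q
    have := Finset.prod_add (fun j => 1 - ρ q j) (fun j => ρ q j) (Finset.univ : Finset (Fin n))
    simp only [sub_add_cancel, Finset.prod_const_one, Finset.powerset_univ] at this
    exact this.symm
  refine ⟨fun R => ∑ q, l q * W q R, ?_, fun i hi => ?_⟩
  · calc _ ≤ ∑ R, ∑ q, |l q| * W q R := by
          refine Finset.sum_le_sum fun R _ => (Finset.abs_sum_le_sum_abs _ _).trans ?_
          refine Finset.sum_le_sum fun q _ => ?_
          rw [abs_mul, abs_of_nonneg (hW0 q R)]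
      _ = ∑ q, |l q| := by
          rw [Finset.sum_comm]
          simp only [← Finset.mul_sum, hW1, mul_one]
      _ ≤ _ := by linarith
  · have h1 : ∀ q, ∑ R, W q R * (if ∃ k, i k ∈ R then 0 else 1) = ∏ k, ρ q (i k) := by
      intro q
      have := Finset.prod_add (fun j => if j ∈ Finset.univ.image i then 0 else 1 - ρ q j)
        (fun j => ρ q j) (Finset.univ : Finset (Fin n))
      rw [Finset.powerset_univ] at this
      have e1 : ∏ k, ρ q (i k)
          = ∏ j, ((if j ∈ Finset.univ.image i then 0 else 1 - ρ q j) + ρ q j) := by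
        rw [← Finset.prod_image (s := Finset.univ) (g := i) (f := ρ q) (fun a _ b _ h => hi h)]
        rw [← Finset.prod_subset (Finset.subset_univ (Finset.univ.image i))]
        · exact Finset.prod_congr rfl fun j hj => by rw [if_pos hj, zero_add]
        · intro j _ hj
          rw [if_neg hj]; ring
      rw [e1, this]
      refine Finset.sum_congr rfl fun R _ => ?_
      simp only [hW]
      by_cases h : ∃ k, i k ∈ R
      · obtain ⟨k, hk⟩ := h
        rw [if_pos ⟨k, hk⟩, mul_zero, Finset.prod_eq_zero hk, zero_mul]
        simp
      · rw [if_neg h, mul_one]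
        congr 1
        refine Finset.prod_congr rfl fun j hj => ?_
        rw [if_neg]
        intro hj'
        obtain ⟨k, _, rfl⟩ := Finset.mem_image.1 hj'
        exact h ⟨k, hj⟩
    have h2 : ∀ q, ∏ k, ρ q (i k)
        = ((q : ℕ) / (m+1 : ℝ)) ^ (Finset.univ.filter fun k => i k ∈ σ).card := by
      intro q
      simp only [hρ]
      rw [Finset.prod_ite, Finset.prod_const, Finset.prod_const_one, mul_one]
    have h3 : ∏ k, (if i k ∈ σ then (-1:ℝ) else 1)
        = (-1) ^ (Finset.univ.filter fun k => i k ∈ σ).card := by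
      rw [Finset.prod_ite]; simp
    simp only [Finset.sum_mul, mul_assoc]
    rw [Finset.sum_comm]
    simp only [← Finset.mul_sum, h1, h2, h3]
    apply hl
    exact (Finset.card_le_univ _).trans (by simp)

theorem chaos_sign (m : ℕ) : ∃ Λ : ℝ, 0 < Λ ∧ ∀ (Ω : Type u) [MeasurableSpace Ω] (μ : Measure Ω)
    [IsProbabilityMeasure μ] (n : ℕ) (σ : Finset (Fin n)) (p : ℝ), 1 ≤ p → p ≤ 2 →
    ∀ f : (Fin m → Fin n) → (Fin m → Ω) → ℝ, HC μ f →
    ∫⁻ x, ‖chaos (fun i ξ => (∏ k, (if i k ∈ σ then (-1:ℝ) else 1)) * f i ξ) x‖ₑ ^ p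
        ∂(Measure.pi fun _ : Fin n => μ)
      ≤ ENNReal.ofReal Λ * ∫⁻ x, ‖chaos f x‖ₑ ^ p ∂(Measure.pi fun _ : Fin n => μ) := by
  obtain ⟨Λ, hΛ, hw⟩ := exists_weights m
  refine ⟨(Λ + 1) ^ 2, by positivity, fun Ω _ μ _ n σ p hp1 hp2 f hf => ?_⟩
  obtain ⟨w, hw1, hw2⟩ := hw n σ
  set π := Measure.pi fun _ : Fin n => μ
  set g : Finset (Fin n) → (Fin n → Ω) → ℝ := fun R => chaos
    (fun i ξ => (if ∃ k, i k ∈ R then 0 else 1) * f i ξ) with hg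
  have e : chaos (fun i ξ => (∏ k, (if i k ∈ σ then (-1:ℝ) else 1)) * f i ξ) = ∑ R, w R • g R := by
    funext x
    rw [Finset.sum_apply]
    simp only [hg, chaos, Pi.smul_apply, smul_eq_mul, Finset.mul_sum]
    rw [Finset.sum_comm]
    refine Finset.sum_congr rfl fun i _ => ?_
    by_cases hi : StrictMono i
    · rw [← hw2 i hi.injective, Finset.sum_mul]
      exact Finset.sum_congr rfl fun R _ => by ring
    · simp [hf.supp i hi]
  have hp0 : ENNReal.ofReal p ≠ 0 := by simp; linarith
  have hpt : ENNReal.ofReal p ≠ ⊤ := ENNReal.ofReal_ne_top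
  have hpr : (ENNReal.ofReal p).toReal = p := ENNReal.toReal_ofReal (by linarith)
  have conv : ∀ h : (Fin n → Ω) → ℝ, eLpNorm h (ENNReal.ofReal p) π ^ p = ∫⁻ x, ‖h x‖ₑ ^ p ∂π := by
    intro h
    rw [eLpNorm_eq_lintegral_rpow_enorm_toReal hp0 hpt, hpr, ← ENNReal.rpow_mul,
      one_div_mul_cancel (by linarith), ENNReal.rpow_one]
  rw [← conv, ← conv, e]
  have hgm : ∀ R, Measurable (g R) := fun R => chaos_measurable (hf.ite _).meas
  have hg' : ∀ R, eLpNorm (g R) (ENNReal.ofReal p) π ≤ eLpNorm (chaos f) (ENNReal.ofReal p) π := by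
    intro R
    have := chaos_restrict hf R hp1
    rw [← conv, ← conv] at this
    exact (ENNReal.rpow_le_rpow_iff (by linarith)).1 this
  have : eLpNorm (∑ R, w R • g R) (ENNReal.ofReal p) π
      ≤ ENNReal.ofReal (Λ+1) * eLpNorm (chaos f) (ENNReal.ofReal p) π := by
    refine (eLpNorm_sum_le (fun R _ => ((hgm R).const_smul (w R)).aestronglyMeasurable)
      (by simpa using hp1)).trans ?_
    calc _ ≤ ∑ R, ENNReal.ofReal |w R| * eLpNorm (chaos f) (ENNReal.ofReal p) π := by
          refine Finset.sum_le_sum fun R _ => ?_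
          rw [eLpNorm_const_smul, Real.enorm_eq_ofReal_abs]
          gcongr
          exact hg' R
      _ = ENNReal.ofReal (∑ R, |w R|) * eLpNorm (chaos f) (ENNReal.ofReal p) π := by
          rw [← Finset.sum_mul, ENNReal.ofReal_sum_of_nonneg fun R _ => abs_nonneg _]
      _ ≤ _ := by gcongr; linarith
  refine (ENNReal.rpow_le_rpow this (by linarith)).trans ?_
  rw [ENNReal.mul_rpow_of_nonneg _ _ (by linarith), ENNReal.ofReal_rpow_of_pos (by linarith)]
  gcongr
  rw [← Real.rpow_two]
  exact Real.rpow_le_rpow_of_exponent_le (by linarith) hp2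

/-- The square function of a family. -/
noncomputable def sqf {n m : ℕ} (f : (Fin m → Fin n) → (Fin m → Ω) → ℝ) (x : Fin n → Ω) : ℝ≥0∞ :=
  ∑ i, ENNReal.ofReal ((f i fun k => x (i k)) ^ 2)

theorem sqf_measurable {n m : ℕ} {f : (Fin m → Fin n) → (Fin m → Ω) → ℝ}
    (hf : ∀ i, Measurable (f i)) : Measurable (sqf f) := by
  unfold sqf
  refine Finset.measurable_sum _ fun i _ => ?_
  apply Measurable.ennreal_ofReal
  apply Measurable.pow_const
  exact (hf i).comp (by fun_prop)

theorem enorm_rpow (y : ℝ) {p : ℝ} (hp : 0 ≤ p) : ‖y‖ₑ ^ p = ENNReal.ofReal (|y| ^ p) := by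
  rw [Real.enorm_eq_ofReal_abs, ENNReal.ofReal_rpow_of_nonneg (abs_nonneg _) hp]

theorem khinchine_enn {n m : ℕ} {f : (Fin m → Fin n) → (Fin m → Ω) → ℝ}
    (hf : ∀ i, ¬ StrictMono i → f i = 0) {p : ℝ} (hp1 : 1 ≤ p) (hp2 : p ≤ 2) (x : Fin n → Ω) :
    2 ^ n * sqf f x ^ (p/2) ≤ ENNReal.ofReal (2 * 9 ^ m) * ∑ σ : Finset (Fin n),
      ‖chaos (fun i ξ => (∏ k, (if i k ∈ σ then (-1:ℝ) else 1)) * f i ξ) x‖ₑ ^ p ∧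
    ∑ σ : Finset (Fin n),
      ‖chaos (fun i ξ => (∏ k, (if i k ∈ σ then (-1:ℝ) else 1)) * f i ξ) x‖ₑ ^ p
      ≤ 2 * (2 ^ n * sqf f x ^ (p/2)) := by
  have key := khinchine_tuple (fun i => f i fun k => x (i k))
    (fun i hi => by simp [hf i hi]) p hp1 hp2
  have hV : sqf f x ^ (p/2)
      = ENNReal.ofReal ((∑ i, (f i fun k => x (i k)) ^ 2) ^ (p/2)) := by
    unfold sqf
    rw [← ENNReal.ofReal_sum_of_nonneg fun i _ => sq_nonneg _,
      ENNReal.ofReal_rpow_of_nonneg (Finset.sum_nonneg fun i _ => sq_nonneg _) (by linarith)]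
  have h2 : (2 : ℝ≥0∞) ^ n = ENNReal.ofReal (2 ^ n) := by
    rw [ENNReal.ofReal_pow (by norm_num)]; simp
  have h2' : (2 : ℝ≥0∞) = ENNReal.ofReal 2 := by simp
  have hS : ∑ σ : Finset (Fin n),
      ‖chaos (fun i ξ => (∏ k, (if i k ∈ σ then (-1:ℝ) else 1)) * f i ξ) x‖ₑ ^ p
      = ENNReal.ofReal (∑ σ : Finset (Fin n),
        |∑ i, (f i fun k => x (i k)) * ∏ k, (if i k ∈ σ then (-1:ℝ) else 1)| ^ p) := by
    rw [ENNReal.ofReal_sum_of_nonneg fun i _ => Real.rpow_nonneg (abs_nonneg _) _]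
    refine Finset.sum_congr rfl fun σ _ => ?_
    rw [enorm_rpow _ (by linarith)]
    unfold chaos
    simp only [mul_comm]
  rw [hS, hV, h2]
  constructor
  · rw [← ENNReal.ofReal_mul (by positivity), ← ENNReal.ofReal_mul (by positivity)]
    exact ENNReal.ofReal_le_ofReal key.1
  · rw [h2', ← ENNReal.ofReal_mul (by positivity), ← ENNReal.ofReal_mul (by positivity)]
    exact ENNReal.ofReal_le_ofReal key.2

theorem square_function (m : ℕ) : ∃ K : ℝ, 1 ≤ K ∧ ∀ (Ω : Type u) [MeasurableSpace Ω]
    (μ : Measure Ω) [IsProbabilityMeasure μ] (n : ℕ) (p : ℝ), 1 ≤ p → p ≤ 2 →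
    ∀ f : (Fin m → Fin n) → (Fin m → Ω) → ℝ, HC μ f →
    (∫⁻ x, sqf f x ^ (p/2) ∂(Measure.pi fun _ : Fin n => μ)
      ≤ ENNReal.ofReal K * ∫⁻ x, ‖chaos f x‖ₑ ^ p ∂(Measure.pi fun _ : Fin n => μ)) ∧
    (∫⁻ x, ‖chaos f x‖ₑ ^ p ∂(Measure.pi fun _ : Fin n => μ)
      ≤ ENNReal.ofReal K * ∫⁻ x, sqf f x ^ (p/2) ∂(Measure.pi fun _ : Fin n => μ)) := by
  obtain ⟨Λ, hΛ, hs⟩ := chaos_sign.{u} m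
  refine ⟨2 * 9 ^ m * Λ + 2 * Λ + 1, by
    have : 0 ≤ 2 * 9 ^ m * Λ := by positivity
    linarith, fun Ω _ μ _ n p hp1 hp2 f hf => ?_⟩
  set π := Measure.pi fun _ : Fin n => μ
  set g : Finset (Fin n) → (Fin m → Fin n) → (Fin m → Ω) → ℝ :=
    fun σ i ξ => (∏ k, (if i k ∈ σ then (-1:ℝ) else 1)) * f i ξ with hg
  have hgHC : ∀ σ, HC μ (g σ) := fun σ => hf.ite _
  have hgg : ∀ σ, (fun i ξ => (∏ k, (if i k ∈ σ then (-1:ℝ) else 1)) * g σ i ξ) = f := by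
    intro σ
    funext i ξ
    simp only [hg]
    rw [← mul_assoc, ← Finset.prod_mul_distrib, Finset.prod_eq_one, one_mul]
    intro k _
    split_ifs <;> norm_num
  have hcm : ∀ σ, Measurable fun x => ‖chaos (g σ) x‖ₑ ^ p := fun σ =>
    (chaos_measurable (hgHC σ).meas).enorm.pow_const _
  have hUm : Measurable fun x => sqf f x ^ (p/2) := (sqf_measurable hf.meas).pow_const _
  have hsum : ∫⁻ x, ∑ σ : Finset (Fin n), ‖chaos (g σ) x‖ₑ ^ p ∂π
      = ∑ σ : Finset (Fin n), ∫⁻ x, ‖chaos (g σ) x‖ₑ ^ p ∂π :=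
    lintegral_finsetSum _ fun σ _ => hcm σ
  have h2n : (2 : ℝ≥0∞) ^ n ≠ 0 := by positivity
  have h2t : (2 : ℝ≥0∞) ^ n ≠ ⊤ := by finiteness
  have hcard : ∀ c : ℝ≥0∞, ∑ _σ : Finset (Fin n), c = 2 ^ n * c := by
    intro c; simp
  set E := ∫⁻ x, ‖chaos f x‖ₑ ^ p ∂π with hE
  set V := ∫⁻ x, sqf f x ^ (p/2) ∂π with hV
  constructor
  · have : 2 ^ n * V ≤ 2 ^ n * (ENNReal.ofReal (2 * 9 ^ m * Λ) * E) := by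
      calc 2 ^ n * V = ∫⁻ x, 2 ^ n * sqf f x ^ (p/2) ∂π := (lintegral_const_mul _ hUm).symm
        _ ≤ ∫⁻ x, ENNReal.ofReal (2 * 9 ^ m) * ∑ σ : Finset (Fin n), ‖chaos (g σ) x‖ₑ ^ p ∂π :=
            lintegral_mono fun x => (khinchine_enn hf.supp hp1 hp2 x).1
        _ = ENNReal.ofReal (2 * 9 ^ m) * ∑ σ : Finset (Fin n), ∫⁻ x, ‖chaos (g σ) x‖ₑ ^ p ∂π := by
            rw [lintegral_const_mul _ (Finset.measurable_sum _ fun σ _ => hcm σ), hsum]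
        _ ≤ ENNReal.ofReal (2 * 9 ^ m) * ∑ _σ : Finset (Fin n), ENNReal.ofReal Λ * E := by
            gcongr with σ
            exact hs Ω μ n σ p hp1 hp2 f hf
        _ = _ := by
            rw [hcard, ENNReal.ofReal_mul (by positivity : (0:ℝ) ≤ 2 * 9 ^ m)]; ring
    refine ((ENNReal.mul_le_mul_iff_right h2n h2t).1 this).trans ?_
    gcongr
    linarith
  · have : 2 ^ n * E ≤ 2 ^ n * (ENNReal.ofReal (2 * Λ) * V) := by
      calc 2 ^ n * E = ∑ _σ : Finset (Fin n), E := (hcard E).symm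
        _ ≤ ∑ σ : Finset (Fin n), ENNReal.ofReal Λ * ∫⁻ x, ‖chaos (g σ) x‖ₑ ^ p ∂π := by
            gcongr with σ
            have := hs Ω μ n σ p hp1 hp2 (g σ) (hgHC σ)
            rwa [hgg σ] at this
        _ = ENNReal.ofReal Λ * ∫⁻ x, ∑ σ : Finset (Fin n), ‖chaos (g σ) x‖ₑ ^ p ∂π := by
            rw [hsum, Finset.mul_sum]
        _ ≤ ENNReal.ofReal Λ * ∫⁻ x, 2 * (2 ^ n * sqf f x ^ (p/2)) ∂π := by
            gcongr with x
            exact (khinchine_enn hf.supp hp1 hp2 x).2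
        _ = _ := by
            rw [lintegral_const_mul _ (hUm.const_mul _), lintegral_const_mul _ hUm,
              ENNReal.ofReal_mul (by norm_num : (0:ℝ) ≤ 2)]
            simp only [ENNReal.ofReal_ofNat]
            ring
    refine ((ENNReal.mul_le_mul_iff_right h2n h2t).1 this).trans ?_
    gcongr
    have : 0 ≤ 2 * 9 ^ m * Λ := by positivity
    linarith

/-- Gluing of two partial tuples. -/
def comb {m : ℕ} {α : Type*} (J : Finset (Fin m)) (x'' : {k // k ∈ J} → α) (x' : {k // k ∉ J} → α) :
    Fin m → α := fun k => if h : k ∈ J then x'' ⟨k, h⟩ else x' ⟨k, h⟩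

theorem comb_mem {m : ℕ} {α : Type*} {J : Finset (Fin m)} (x'' : {k // k ∈ J} → α)
    (x' : {k // k ∉ J} → α) (k : {k // k ∈ J}) : comb J x'' x' k = x'' k := by
  simp [comb, k.2]

theorem comb_notMem {m : ℕ} {α : Type*} {J : Finset (Fin m)} (x'' : {k // k ∈ J} → α)
    (x' : {k // k ∉ J} → α) (k : {k // k ∉ J}) : comb J x'' x' k = x' k := by
  simp [comb, k.2]

/-- The `p`-th power of the mixed norm. -/
noncomputable def MN (μ : Measure Ω) (r : ℝ) {n m : ℕ} (J : Finset (Fin m))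
    (F : (Fin m → Fin n) → (Fin m → Ω) → ℝ≥0∞) : ℝ≥0∞ :=
  ∑ i' : {k // k ∉ J} → Fin n, ∫⁻ ξ' : {k // k ∉ J} → Ω,
    (∑ i'' : {k // k ∈ J} → Fin n, ∫⁻ ξ'' : {k // k ∈ J} → Ω,
      F (comb J i'' i') (comb J ξ'' ξ') ∂Measure.pi fun _ => μ) ^ r ∂Measure.pi fun _ => μ

theorem mixedNormPL2_eq (μ : Measure Ω) (p : ℝ) {n m : ℕ} (J : Finset (Fin m))
    (a : (Fin m → Fin n) → (Fin m → Ω) → ℝ) :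
    mixedNormPL2 μ p J a = (MN μ (p/2) J fun i ξ => ENNReal.ofReal ((a i ξ) ^ 2)) ^ (1/p) := rfl

theorem comb_measurable {m : ℕ} (J : Finset (Fin m)) :
    Measurable (fun q : ({k // k ∉ J} → Ω) × ({k // k ∈ J} → Ω) => comb J q.2 q.1) := by
  refine measurable_pi_lambda _ fun k => ?_
  by_cases h : k ∈ J
  · simp only [comb, h, dif_pos]; fun_prop
  · simp only [comb, h, dif_neg, not_false_eq_true]; fun_prop

theorem comb_mp {m : ℕ} (μ : Measure Ω) [IsProbabilityMeasure μ] (J : Finset (Fin m)) :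
    MeasurePreserving (fun q : ({k // k ∉ J} → Ω) × ({k // k ∈ J} → Ω) => comb J q.2 q.1)
      ((Measure.pi fun _ => μ).prod (Measure.pi fun _ => μ)) (Measure.pi fun _ => μ) := by
  have h2 : MeasurePreserving (fun q : ({k // k ∉ J} → Ω) × (Fin m → Ω) =>
      ((q.1, fun k : {k // k ∈ J} => q.2 k) : ({k // k ∉ J} → Ω) × ({k // k ∈ J} → Ω)))
      ((Measure.pi fun _ => μ).prod (Measure.pi fun _ => μ))
      ((Measure.pi fun _ => μ).prod (Measure.pi fun _ => μ)) :=
    (MeasurePreserving.id (Measure.pi fun _ : {k // k ∉ J} => μ)).prod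
      (mp_comp μ (fun k : {k // k ∈ J} => (k : Fin m)) Subtype.val_injective)
  have h1 := mp_extend μ (fun k : {k // k ∉ J} => (k : Fin m)) Subtype.val_injective
  refine ⟨comb_measurable J, ?_⟩
  rw [← h2.map_eq, Measure.map_map (comb_measurable J) h2.measurable]
  refine Eq.trans ?_ h1.map_eq
  congr 1
  funext q k
  by_cases hk : k ∈ J
  · have e : ¬ ∃ a : {k // k ∉ J}, (a : Fin m) = k := fun ⟨a, ha⟩ => a.2 (ha ▸ hk)
    simp [comb, hk]
  · have e := (Subtype.val_injective : Function.Injective (fun k : {k // k ∉ J} => (k : Fin m))).extend_apply q.1 q.2 ⟨k, hk⟩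
    simp only at e
    simp only [Function.comp, comb, hk, dif_neg, not_false_eq_true]
    exact e.symm

theorem sum_comb {n m : ℕ} {M : Type*} [AddCommMonoid M] (J : Finset (Fin m))
    (G : (Fin m → Fin n) → M) :
    ∑ i, G i = ∑ i' : {k // k ∉ J} → Fin n, ∑ i'' : {k // k ∈ J} → Fin n, G (comb J i'' i') := by
  rw [Finset.sum_comm, ← Fintype.sum_prod_type' (fun (i'' : {k // k ∈ J} → Fin n)
    (i' : {k // k ∉ J} → Fin n) => G (comb J i'' i'))]
  exact (Equiv.sum_comp (Equiv.piEquivPiSubtypeProd (fun k => k ∈ J) (fun _ => Fin n)).symm G).symm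

theorem rpow_sum_le {ι : Type*} (s : Finset ι) (G : ι → ℝ≥0∞) {r : ℝ} (hr : 0 < r) (hr1 : r ≤ 1) :
    (∑ i ∈ s, G i) ^ r ≤ ∑ i ∈ s, G i ^ r := by
  classical
  induction s using Finset.induction_on with
  | empty => simp [hr]
  | insert a s ha ih =>
    rw [Finset.sum_insert ha, Finset.sum_insert ha]
    exact (ENNReal.rpow_add_le_add_rpow _ _ hr.le hr1).trans (by gcongr)

theorem comb_inj_left {m n : ℕ} {J : Finset (Fin m)} {i'' : {k // k ∈ J} → Fin n}
    {i' : {k // k ∉ J} → Fin n} (h : Function.Injective (comb J i'' i')) :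
    Function.Injective i' := by
  intro a b hab
  have : comb J i'' i' a = comb J i'' i' b := by rw [comb_notMem, comb_notMem, hab]
  exact Subtype.ext (h this)

theorem comb_inj_right {m n : ℕ} {J : Finset (Fin m)} {i'' : {k // k ∈ J} → Fin n}
    {i' : {k // k ∉ J} → Fin n} (h : Function.Injective (comb J i'' i')) :
    Function.Injective i'' := by
  intro a b hab
  have : comb J i'' i' a = comb J i'' i' b := by rw [comb_mem, comb_mem, hab]
  exact Subtype.ext (h this)

theorem extend_comb {m n : ℕ} {J : Finset (Fin m)} {i'' : {k // k ∈ J} → Fin n}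
    {i' : {k // k ∉ J} → Fin n} (h : Function.Injective (comb J i'' i'))
    (ξ' : {k // k ∉ J} → Ω) (y : Fin n → Ω) :
    (fun k => Function.extend i' ξ' y (comb J i'' i' k)) = comb J (fun k => y (i'' k)) ξ' := by
  funext k
  by_cases hk : k ∈ J
  · have e1 := comb_mem i'' i' ⟨k, hk⟩
    have e2 := comb_mem (fun k => y (i'' k)) ξ' ⟨k, hk⟩
    simp only at e1 e2
    rw [e1, e2, Function.extend_apply']
    rintro ⟨a, ha⟩
    rw [← comb_notMem i'' i' a, ← e1] at ha
    have := h ha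
    exact a.2 (this ▸ hk)
  · have e1 := comb_notMem i'' i' ⟨k, hk⟩
    have e2 := comb_notMem (fun k => y (i'' k)) ξ' ⟨k, hk⟩
    simp only at e1 e2
    rw [e1, e2, (comb_inj_left h).extend_apply]

theorem sqf_le_MN (μ : Measure Ω) [IsProbabilityMeasure μ] {r : ℝ} (hr : 0 < r) (hr1 : r ≤ 1)
    {n m : ℕ} (J : Finset (Fin m)) (F : (Fin m → Fin n) → (Fin m → Ω) → ℝ≥0∞)
    (hF : ∀ i, Measurable (F i)) (hF0 : ∀ i, ¬ StrictMono i → F i = 0) :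
    ∫⁻ x, (∑ i, F i fun k => x (i k)) ^ r ∂(Measure.pi fun _ : Fin n => μ) ≤ MN μ r J F := by
  have hFm : ∀ i : Fin m → Fin n, Measurable (fun x : Fin n → Ω => F i fun k => x (i k)) :=
    fun i => (hF i).comp (by fun_prop)
  calc _ ≤ ∫⁻ x, ∑ i' : {k // k ∉ J} → Fin n, (∑ i'' : {k // k ∈ J} → Fin n,
          F (comb J i'' i') fun k => x (comb J i'' i' k)) ^ r ∂(Measure.pi fun _ : Fin n => μ) := by
        refine lintegral_mono fun x => ?_
        simp only
        rw [sum_comb J]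
        exact rpow_sum_le _ _ hr hr1
    _ = ∑ i' : {k // k ∉ J} → Fin n, ∫⁻ x, (∑ i'' : {k // k ∈ J} → Fin n,
          F (comb J i'' i') fun k => x (comb J i'' i' k)) ^ r ∂(Measure.pi fun _ : Fin n => μ) :=
        lintegral_finsetSum _ fun i' _ =>
          (Finset.measurable_sum _ fun i'' _ => hFm _).pow_const _
    _ ≤ _ := by
        refine Finset.sum_le_sum fun i' _ => ?_
        by_cases hi' : Function.Injective i'
        swap
        · have : ∀ i'', F (comb J i'' i') = 0 := fun i'' =>
            hF0 _ fun hm => hi' (comb_inj_left hm.injective)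
          simp [this, hr]
        have hm1 : Measurable (fun x : Fin n → Ω => (∑ i'' : {k // k ∈ J} → Fin n,
          F (comb J i'' i') fun k => x (comb J i'' i' k)) ^ r) :=
          (Finset.measurable_sum _ fun i'' _ => hFm _).pow_const _
        have mp := mp_extend μ i' hi'
        rw [← mp.lintegral_comp hm1, lintegral_prod
          (fun a : ({k // k ∉ J} → Ω) × (Fin n → Ω) => (∑ i'' : {k // k ∈ J} → Fin n,
            F (comb J i'' i') fun k => Function.extend i' a.1 a.2 (comb J i'' i' k)) ^ r)
          (hm1.comp mp.measurable).aemeasurable]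
        refine lintegral_mono fun ξ' => ?_
        have hex : Measurable (fun y : Fin n → Ω => Function.extend i' ξ' y) :=
          mp.measurable.comp measurable_prodMk_left
        refine (jensen_concave (Measure.pi fun _ : Fin n => μ) hr hr1 ?_).trans ?_
        · apply Measurable.aemeasurable
          exact Finset.measurable_sum _ fun i'' _ => (hFm (comb J i'' i')).comp hex
        · refine ENNReal.rpow_le_rpow ?_ hr.le
          have hL := lintegral_finsetSum (μ := Measure.pi fun _ : Fin n => μ)
            (Finset.univ : Finset ({k // k ∈ J} → Fin n))
            fun i'' _ => (hFm (comb J i'' i')).comp hex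
          refine hL.le.trans ?_
          refine Finset.sum_le_sum fun i'' _ => ?_
          by_cases hs : StrictMono (comb J i'' i')
          · simp only [Function.comp_def, extend_comb hs.injective]
            have mp2 := mp_comp μ i'' (comb_inj_right hs.injective)
            refine le_of_eq (mp2.lintegral_comp (f := fun ξ'' => F (comb J i'' i') (comb J ξ'' ξ')) ?_)
            exact (hF _).comp ((comb_measurable J).comp measurable_prodMk_left)
          · simp [hF0 _ hs]

theorem HC_of_lp {μ : Measure Ω} [IsProbabilityMeasure μ] {n m : ℕ} {p : ℝ} (hp : 1 ≤ p)
    {f : (Fin m → Fin n) → (Fin m → Ω) → ℝ} (h1 : ∀ i, Measurable (f i))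
    (h2 : ∀ i, ¬ StrictMono i → f i = 0)
    (h3 : ∀ (i : Fin m → Fin n) (k : Fin m),
      ∀ᵐ y ∂(Measure.pi fun _ : Fin m => μ), ∫ z, f i (Function.update y k z) ∂μ = 0)
    (h4 : ∀ i, (∫⁻ y, ENNReal.ofReal (|f i y| ^ p) ∂Measure.pi fun _ : Fin m => μ) < ⊤) :
    HC μ f where
  meas := h1
  supp := h2
  mz := h3
  int i := by
    have hp0 : 0 < p := by linarith
    have : MemLp (f i) (ENNReal.ofReal p) (Measure.pi fun _ => μ) := by
      refine ⟨(h1 i).aestronglyMeasurable, ?_⟩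
      rw [eLpNorm_lt_top_iff_lintegral_rpow_enorm_lt_top (by simpa using hp0) (by simp),
        ENNReal.toReal_ofReal hp0.le]
      simp only [enorm_rpow _ hp0.le]
      exact h4 i
    exact this.integrable (by simpa using hp)

theorem ofReal_sq_rpow (y : ℝ) {p : ℝ} (hp : 0 < p) :
    ENNReal.ofReal (y ^ 2) ^ (p/2) = ENNReal.ofReal (|y| ^ p) := by
  rw [ENNReal.ofReal_rpow_of_nonneg (by positivity) (by positivity), ← sq_abs, ← Real.rpow_natCast,
    ← Real.rpow_mul (abs_nonneg _)]
  congr 2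
  push_cast
  ring

theorem lp_of_sqf {μ : Measure Ω} [IsProbabilityMeasure μ] {n m : ℕ} {p : ℝ} (hp : 1 ≤ p)
    {f : (Fin m → Fin n) → (Fin m → Ω) → ℝ} (h1 : ∀ i, Measurable (f i))
    (h2 : ∀ i, ¬ StrictMono i → f i = 0)
    (h : ∫⁻ x, sqf f x ^ (p/2) ∂(Measure.pi fun _ : Fin n => μ) < ⊤) (i : Fin m → Fin n) :
    (∫⁻ y, ENNReal.ofReal (|f i y| ^ p) ∂Measure.pi fun _ : Fin m => μ) < ⊤ := by
  have hp0 : 0 < p := by linarith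
  by_cases hi : StrictMono i
  · refine lt_of_le_of_lt ?_ h
    have hm : Measurable (fun y => ENNReal.ofReal (|f i y| ^ p)) := by
      have := h1 i
      fun_prop
    rw [← (mp_comp μ i hi.injective).lintegral_comp hm]
    refine lintegral_mono fun x => ?_
    simp only
    rw [← ofReal_sq_rpow _ hp0]
    refine ENNReal.rpow_le_rpow ?_ (by positivity)
    exact Finset.single_le_sum (f := fun i => ENNReal.ofReal ((f i fun k => x (i k)) ^ 2))
      (fun _ _ => zero_le) (Finset.mem_univ i)
  · rw [h2 i hi]
    simp [Real.zero_rpow hp0.ne']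

theorem upper_bound (m : ℕ) : ∃ K : ℝ, 1 ≤ K ∧ ∀ (Ω : Type u) [MeasurableSpace Ω] (μ : Measure Ω)
    [IsProbabilityMeasure μ] (n : ℕ) (p : ℝ), 1 ≤ p → p ≤ 2 →
    ∀ (f : (Fin m → Fin n) → (Fin m → Ω) → ℝ), ∀ s ∈ hoeffdingDecompVals μ p f,
      (∫⁻ x, ‖chaos f x‖ₑ ^ p ∂(Measure.pi fun _ : Fin n => μ)) ^ (1/p) ≤ ENNReal.ofReal K * s := by
  obtain ⟨K, hK, H⟩ := square_function.{u} m
  refine ⟨K, hK, ?_⟩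
  intro Ω _ μ _ n p hp hp2 f s ⟨a, a1, a2, a3, a4, hs⟩
  have hp0 : 0 < p := by linarith
  have hK0 : ENNReal.ofReal K ≠ 0 := by simp; linarith
  by_cases htop : s = ⊤
  · rw [htop, ENNReal.mul_top hK0]; exact le_top
  have hfin : ∀ J, mixedNormPL2 μ p J (a J) ≠ ⊤ := by
    intro J hJ
    apply htop
    rw [hs]
    exact ENNReal.sum_eq_top.2 ⟨J, Finset.mem_univ J, hJ⟩
  have key : ∀ J, (∫⁻ x, ‖chaos (a J) x‖ₑ ^ p ∂(Measure.pi fun _ : Fin n => μ)) ^ (1/p)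
      ≤ ENNReal.ofReal K * mixedNormPL2 μ p J (a J) := by
    intro J
    have h1 : ∫⁻ x, sqf (a J) x ^ (p/2) ∂(Measure.pi fun _ : Fin n => μ)
        ≤ MN μ (p/2) J fun i ξ => ENNReal.ofReal ((a J i ξ) ^ 2) := by
      refine sqf_le_MN μ (by positivity) (by linarith) J
        (fun i ξ => ENNReal.ofReal ((a J i ξ) ^ 2)) ?_ ?_
      · intro i; have := a1 J i; fun_prop
      · intro i hi; funext ξ; simp [a2 J i hi]
    have h2 : (MN μ (p/2) J fun i ξ => ENNReal.ofReal ((a J i ξ) ^ 2)) < ⊤ := by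
      have := hfin J
      rw [mixedNormPL2_eq] at this
      rw [lt_top_iff_ne_top]
      intro h
      rw [h] at this
      exact this (ENNReal.top_rpow_of_pos (by positivity))
    have hc : HC μ (a J) := HC_of_lp hp (a1 J) (a2 J) (a3 J)
      (lp_of_sqf hp (a1 J) (a2 J) (h1.trans_lt h2))
    have h3 := (H Ω μ n p hp hp2 (a J) hc).2
    rw [mixedNormPL2_eq]
    have hK1 : ENNReal.ofReal K ^ (1/p) ≤ ENNReal.ofReal K := by
      conv_rhs => rw [← ENNReal.rpow_one (ENNReal.ofReal K)]
      refine ENNReal.rpow_le_rpow_of_exponent_le (by simpa using hK) ?_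
      rw [div_le_one hp0]; exact hp
    calc _ ≤ (ENNReal.ofReal K * MN μ (p/2) J fun i ξ => ENNReal.ofReal ((a J i ξ) ^ 2)) ^ (1/p) :=
          ENNReal.rpow_le_rpow (h3.trans (by gcongr)) (by positivity)
      _ = ENNReal.ofReal K ^ (1/p) * (MN μ (p/2) J fun i ξ => ENNReal.ofReal ((a J i ξ) ^ 2)) ^ (1/p) :=
          ENNReal.mul_rpow_of_nonneg _ _ (by positivity)
      _ ≤ _ := by gcongr
  have hE : ∀ g : (Fin n → Ω) → ℝ, (∫⁻ x, ‖g x‖ₑ ^ p ∂(Measure.pi fun _ : Fin n => μ)) ^ (1/p)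
      = eLpNorm g (ENNReal.ofReal p) (Measure.pi fun _ : Fin n => μ) := by
    intro g
    rw [eLpNorm_eq_lintegral_rpow_enorm_toReal (by simpa using hp0) (by simp),
        ENNReal.toReal_ofReal hp0.le]
  have hsum : chaos f = ∑ J, chaos (a J) := by
    funext x
    rw [Finset.sum_apply]
    unfold chaos
    rw [Finset.sum_comm]
    exact Finset.sum_congr rfl fun i _ => a4 i _
  rw [hE, hsum, hs, Finset.mul_sum]
  refine (eLpNorm_sum_le (fun J _ => (chaos_measurable (a1 J)).aestronglyMeasurable)
    (by simpa using hp)).trans ?_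
  refine Finset.sum_le_sum fun J _ => ?_
  rw [← hE]
  exact key J

/-- The full sum of squares. -/
noncomputable def UU {n m : ℕ} (F : (Fin m → Fin n) → (Fin m → Ω) → ℝ≥0∞) (x : Fin n → Ω) : ℝ≥0∞ :=
  ∑ k, F k fun t => x (k t)

open Classical in
/-- The partial sum of squares over the tuples containing a given one. -/
noncomputable def WW {n m : ℕ} (F : (Fin m → Fin n) → (Fin m → Ω) → ℝ≥0∞) {ι : Type}
    (i : ι → Fin n) (x : Fin n → Ω) : ℝ≥0∞ :=
  ∑ k : Fin m → Fin n, if (∀ l, ∃ t, k t = i l) then F k (fun t => x (k t)) else 0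

theorem UU_measurable {n m : ℕ} {F : (Fin m → Fin n) → (Fin m → Ω) → ℝ≥0∞}
    (hF : ∀ i, Measurable (F i)) : Measurable (UU F) :=
  Finset.measurable_sum _ fun i _ => (hF i).comp (by fun_prop)

theorem WW_measurable {n m : ℕ} {F : (Fin m → Fin n) → (Fin m → Ω) → ℝ≥0∞}
    (hF : ∀ i, Measurable (F i)) {ι : Type} (i : ι → Fin n) : Measurable (WW F i) := by
  classical
  refine Finset.measurable_sum _ fun k _ => ?_
  split_ifs
  · exact (hF k).comp (by fun_prop)
  · exact measurable_const

theorem UU_ne_top {n m : ℕ} {F : (Fin m → Fin n) → (Fin m → Ω) → ℝ≥0∞}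
    (hF : ∀ i ξ, F i ξ ≠ ⊤) (x : Fin n → Ω) : UU F x ≠ ⊤ :=
  ENNReal.sum_ne_top.2 fun _ _ => hF _ _

theorem WW_ne_top {n m : ℕ} {F : (Fin m → Fin n) → (Fin m → Ω) → ℝ≥0∞}
    (hF : ∀ i ξ, F i ξ ≠ ⊤) {ι : Type} (i : ι → Fin n) (x : Fin n → Ω) : WW F i x ≠ ⊤ := by
  classical
  refine ENNReal.sum_ne_top.2 fun _ _ => ?_
  split_ifs
  · exact hF _ _
  · simp

theorem extend_prod_measurable {μ : Measure Ω} [IsProbabilityMeasure μ] {n : ℕ} {ι : Type}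
    [Fintype ι] {i : ι → Fin n} (hi : Function.Injective i) :
    Measurable (fun q : (Fin n → Ω) × (ι → Ω) => Function.extend i q.2 q.1) :=
  (mp_extend μ i hi).measurable.comp measurable_swap

theorem lintegral_extend (μ : Measure Ω) [IsProbabilityMeasure μ] {n : ℕ} {ι : Type} [Fintype ι]
    {i : ι → Fin n} (hi : Function.Injective i) {Φ : (Fin n → Ω) → ℝ≥0∞} (hΦ : Measurable Φ) :
    Measurable (fun y : Fin n → Ω => ∫⁻ ξ, Φ (Function.extend i ξ y) ∂(Measure.pi fun _ : ι => μ)) ∧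
    ∫⁻ y, ∫⁻ ξ, Φ (Function.extend i ξ y) ∂(Measure.pi fun _ : ι => μ)
      ∂(Measure.pi fun _ : Fin n => μ) = ∫⁻ x, Φ x ∂(Measure.pi fun _ : Fin n => μ) := by
  have hm : Measurable (fun q : (Fin n → Ω) × (ι → Ω) => Φ (Function.extend i q.2 q.1)) :=
    hΦ.comp (extend_prod_measurable (μ := μ) hi)
  refine ⟨hm.lintegral_prod_right', ?_⟩
  rw [← lintegral_prod (fun q : (Fin n → Ω) × (ι → Ω) => Φ (Function.extend i q.2 q.1))
    hm.aemeasurable]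
  have mp := (mp_extend μ i hi).comp (Measure.measurePreserving_swap
    (μ := Measure.pi fun _ : Fin n => μ) (ν := Measure.pi fun _ : ι => μ))
  exact mp.lintegral_comp hΦ

/-- Covering property. -/
theorem UU_le_sum_WW {n m : ℕ} (F : (Fin m → Fin n) → (Fin m → Ω) → ℝ≥0∞) {i : Fin m → Fin n}
    (hi : Function.Injective i) (ξ : Fin m → Ω) (y : Fin n → Ω) (J : Finset (Fin m)) :
    UU F (Function.extend (fun t : {t // t ∉ J} => i t) (fun t => ξ t) y) ≤
      ∑ K : Finset (Fin m), WW F (fun t : {t // t ∉ K} => i t)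
        (Function.extend (fun t : {t // t ∉ K} => i t) (fun t => ξ t) y) := by
  classical
  have hr : ∀ K : Finset (Fin m), Function.Injective (fun t : {t // t ∉ K} => i t) :=
    fun K => hi.comp Subtype.val_injective
  unfold UU WW
  rw [Finset.sum_comm]
  refine Finset.sum_le_sum fun k _ => ?_
  set T : Finset (Fin m) := J ∪ Finset.univ.filter (fun t => ∀ s, k s ≠ i t) with hT
  have hc : ∀ l : {t // t ∉ T}, ∃ s, k s = i l := by
    rintro ⟨l, hl⟩
    simp only [hT, Finset.mem_union, Finset.mem_filter, Finset.mem_univ, true_and, not_or] at hl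
    have := hl.2
    push Not at this
    exact this
  refine le_trans (le_of_eq ?_) (Finset.single_le_sum (fun _ _ => zero_le)
    (Finset.mem_univ T))
  simp only
  rw [if_pos hc]
  congr 1
  funext s
  by_cases h : ∃ t, t ∉ J ∧ i t = k s
  · obtain ⟨t, ht, hts⟩ := h
    have htT : t ∉ T := by
      simp only [hT, Finset.mem_union, Finset.mem_filter, Finset.mem_univ, true_and, not_or]
      exact ⟨ht, fun h => h s hts.symm⟩
    rw [← hts]
    rw [(hr J).extend_apply (fun t => ξ t) y ⟨t, ht⟩, (hr T).extend_apply (fun t => ξ t) y ⟨t, htT⟩]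
  · have h2 : ¬ ∃ a : {t // t ∉ T}, i a = k s := by
      rintro ⟨⟨a, ha⟩, hs⟩
      refine h ⟨a, fun hJ => ha ?_, hs⟩
      simp [hT, hJ]
    have h1 : ¬ ∃ a : {t // t ∉ J}, i a = k s := by
      rintro ⟨⟨a, ha⟩, hs⟩
      exact h ⟨a, ha, hs⟩
    rw [Function.extend_apply' _ _ _ h1, Function.extend_apply' _ _ _ h2]

theorem sum_WW_le {n m : ℕ} (F : (Fin m → Fin n) → (Fin m → Ω) → ℝ≥0∞) {ι : Type} [Fintype ι]
    [DecidableEq ι]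
    (x : Fin n → Ω) : ∑ i : ι → Fin n, WW F i x ≤ (m : ℝ≥0∞) ^ (Fintype.card ι) * UU F x := by
  classical
  unfold UU WW
  rw [Finset.sum_comm, Finset.mul_sum]
  refine Finset.sum_le_sum fun k _ => ?_
  have e := @Finset.sum_filter _ _ (Finset.univ : Finset (ι → Fin n))
    _ (fun i => ∀ l, ∃ t, k t = i l) (fun _ => Classical.propDecidable _)
    (fun _ => F k fun t => x (k t))
  rw [← e, Finset.sum_const, nsmul_eq_mul]
  gcongr
  have : (@Finset.filter _ (fun i : ι → Fin n => ∀ l, ∃ t, k t = i l)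
      (fun _ => Classical.propDecidable _) Finset.univ)
      ⊆ (Finset.univ : Finset (ι → Fin m)).image (fun g l => k (g l)) := by
    intro i hi
    simp only [Finset.mem_filter, Finset.mem_univ, true_and] at hi
    choose g hg using hi
    simp only [Finset.mem_image, Finset.mem_univ, true_and]
    exact ⟨g, funext hg⟩
  have h2 := (Finset.card_le_card this).trans Finset.card_image_le
  rw [Finset.card_univ, Fintype.card_fun, Fintype.card_fin] at h2
  exact_mod_cast h2

theorem rpow_anti_mul {c x z : ℝ≥0∞} (hc : 1 ≤ c) (hct : c ≠ ⊤) (h : x ≤ c * z) {r : ℝ}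
    (hr : 0 < r) (hr1 : r ≤ 1) : z ^ (r-1) ≤ c * x ^ (r-1) := by
  have hc0 : c ≠ 0 := fun h => by simp [h] at hc
  have h1 : c⁻¹ * x ≤ z := by
    rw [mul_comm, ← div_eq_mul_inv]
    exact ENNReal.div_le_of_le_mul' h
  have h2 := rpow_anti h1 (s := r-1) (by linarith)
  refine h2.trans ?_
  have h3 : (c⁻¹ * x) ^ (r-1) = c⁻¹ ^ (r-1) * x ^ (r-1) := by
    by_cases hx : x = ⊤
    · subst hx
      have hci : c⁻¹ ≠ 0 := by simpa using hct
      rw [ENNReal.mul_top hci]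
      rcases hr1.lt_or_eq with h | h
      · rw [ENNReal.top_rpow_of_neg (by linarith), mul_zero]
      · simp [h]
    · exact ENNReal.mul_rpow_of_ne_top (by simpa using hc0) hx _
  rw [h3]
  gcongr
  rw [ENNReal.inv_rpow, ← ENNReal.rpow_neg]
  conv_rhs => rw [← ENNReal.rpow_one c]
  exact ENNReal.rpow_le_rpow_of_exponent_le hc (by linarith)

open Classical in
/-- Averages of extended functions. -/
noncomputable def DD (μ : Measure Ω) {n : ℕ} {ι : Type} [Fintype ι] [DecidableEq ι]
    (Φ : (ι → Fin n) → (Fin n → Ω) → ℝ≥0∞) (y : Fin n → Ω) : ℝ≥0∞ :=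
  ∑ i : ι → Fin n, if Function.Injective i then
    ∫⁻ ξ, Φ i (Function.extend i ξ y) ∂(Measure.pi fun _ : ι => μ) else 0

theorem DD_spec (μ : Measure Ω) [IsProbabilityMeasure μ] {n : ℕ} {ι : Type} [Fintype ι] [DecidableEq ι]
    {Φ : (ι → Fin n) → (Fin n → Ω) → ℝ≥0∞} (hΦ : ∀ i, Measurable (Φ i)) :
    Measurable (DD μ Φ) ∧ ∫⁻ y, DD μ Φ y ∂(Measure.pi fun _ : Fin n => μ)
      ≤ ∫⁻ y, ∑ i, Φ i y ∂(Measure.pi fun _ : Fin n => μ) := by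
  classical
  have hm : ∀ i : ι → Fin n, Measurable (fun y => if Function.Injective i then
    ∫⁻ ξ, Φ i (Function.extend i ξ y) ∂(Measure.pi fun _ : ι => μ) else 0) := by
    intro i
    split_ifs with h
    · exact (lintegral_extend μ h (hΦ i)).1
    · exact measurable_const
  refine ⟨Finset.measurable_sum _ fun i _ => hm i, ?_⟩
  unfold DD
  rw [lintegral_finsetSum _ fun i _ => hm i, lintegral_finsetSum _ fun i _ => hΦ i]
  refine Finset.sum_le_sum fun i _ => ?_
  split_ifs with h
  · exact (lintegral_extend μ h (hΦ i)).2.le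
  · simp

theorem MN_one (μ : Measure Ω) [IsProbabilityMeasure μ] {n m : ℕ} (J : Finset (Fin m))
    {F : (Fin m → Fin n) → (Fin m → Ω) → ℝ≥0∞} (hF : ∀ i, Measurable (F i)) :
    ∑ i' : {k // k ∉ J} → Fin n, ∫⁻ ξ' : {k // k ∉ J} → Ω,
    ∑ i'' : {k // k ∈ J} → Fin n, ∫⁻ ξ'' : {k // k ∈ J} → Ω,
      F (comb J i'' i') (comb J ξ'' ξ') ∂(Measure.pi fun _ => μ) ∂(Measure.pi fun _ => μ)
    = ∑ i, ∫⁻ ξ, F i ξ ∂(Measure.pi fun _ => μ) := by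
  rw [sum_comb J]
  refine Finset.sum_congr rfl fun i' _ => ?_
  have hm : ∀ i'' : {k // k ∈ J} → Fin n, Measurable
      (fun q : ({k // k ∉ J} → Ω) × ({k // k ∈ J} → Ω) => F (comb J i'' i') (comb J q.2 q.1)) :=
    fun i'' => (hF _).comp (comb_measurable J)
  rw [lintegral_finsetSum _ fun i'' _ => (hm i'').lintegral_prod_right']
  refine Finset.sum_congr rfl fun i'' _ => ?_
  rw [← (comb_mp μ J).lintegral_comp (hF _), lintegral_prod
    (fun q : ({k // k ∉ J} → Ω) × ({k // k ∈ J} → Ω) => F (comb J i'' i') (comb J q.2 q.1))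
    (hm i'').aemeasurable]

/-- The sets on which the `J`-th piece is used. -/
def GG {n m : ℕ} (F : (Fin m → Fin n) → (Fin m → Ω) → ℝ≥0∞) (y : Fin n → Ω) (J : Finset (Fin m))
    (i : Fin m → Fin n) : Set (Fin m → Ω) :=
  {ξ | Function.Injective i →
    UU F (Function.extend i ξ y) ≤ 2 ^ m * WW F (fun t : {t // t ∉ J} => i t)
        (Function.extend (fun t : {t // t ∉ J} => i t) (fun t => ξ t) y) ∧
    UU F (Function.extend (fun t : {t // t ∉ J} => i t) (fun t => ξ t) y)
      ≤ 2 ^ m * WW F (fun t : {t // t ∉ J} => i t)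
        (Function.extend (fun t : {t // t ∉ J} => i t) (fun t => ξ t) y)}

theorem GG_measurable (μ : Measure Ω) [IsProbabilityMeasure μ] {n m : ℕ}
    {F : (Fin m → Fin n) → (Fin m → Ω) → ℝ≥0∞} (hF : ∀ i, Measurable (F i)) (y : Fin n → Ω)
    (J : Finset (Fin m)) (i : Fin m → Fin n) : MeasurableSet (GG F y J i) := by
  by_cases hi : Function.Injective i
  · have hr : Function.Injective (fun t : {t // t ∉ J} => i t) := hi.comp Subtype.val_injective
    have m1 : Measurable (fun ξ : Fin m → Ω => Function.extend i ξ y) :=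
      (extend_prod_measurable (μ := μ) hi).comp measurable_prodMk_left
    have m2 : Measurable (fun ξ : Fin m → Ω =>
        Function.extend (fun t : {t // t ∉ J} => i t) (fun t => ξ t) y) :=
      ((extend_prod_measurable (μ := μ) hr).comp measurable_prodMk_left).comp
        (g := fun ξ : {t // t ∉ J} → Ω => Function.extend (fun t : {t // t ∉ J} => i t) ξ y)
        (f := fun (ξ : Fin m → Ω) (t : {t // t ∉ J}) => ξ t) (by fun_prop)
    simp only [GG, hi, forall_const]
    refine MeasurableSet.inter (measurableSet_le ((UU_measurable hF).comp m1) ?_)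
      (measurableSet_le ((UU_measurable hF).comp m2) ?_)
    · exact ((WW_measurable hF _).comp m2).const_mul _
    · exact ((WW_measurable hF _).comp m2).const_mul _
  · simp [GG, hi]

theorem GG_cover {n m : ℕ} (F : (Fin m → Fin n) → (Fin m → Ω) → ℝ≥0∞) (y : Fin n → Ω)
    (i : Fin m → Fin n) (ξ : Fin m → Ω) : ∃ J, ξ ∈ GG F y J i := by
  by_cases hi : Function.Injective i
  · set Z : Finset (Fin m) → ℝ≥0∞ := fun K => WW F (fun t : {t // t ∉ K} => i t)
        (Function.extend (fun t : {t // t ∉ K} => i t) (fun t => ξ t) y) with hZ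
    obtain ⟨K, -, hK⟩ := Finset.exists_max_image (Finset.univ : Finset (Finset (Fin m))) Z
      ⟨∅, Finset.mem_univ _⟩
    have hs : ∑ J, Z J ≤ 2 ^ m * Z K := by
      refine (Finset.sum_le_card_nsmul _ _ _ hK).trans ?_
      rw [Finset.card_univ, Fintype.card_finset, Fintype.card_fin, nsmul_eq_mul]
      push_cast
      exact le_rfl
    refine ⟨K, fun _ => ⟨?_, (UU_le_sum_WW F hi ξ y K).trans hs⟩⟩
    have h0 := (UU_le_sum_WW F hi ξ y ∅).trans hs
    have e : Function.extend (fun t : {t // t ∉ (∅ : Finset (Fin m))} => i t) (fun t => ξ t) y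
        = Function.extend i ξ y := by
      funext j
      by_cases hj : ∃ t, i t = j
      · obtain ⟨t, rfl⟩ := hj
        rw [hi.extend_apply]
        exact (hi.comp Subtype.val_injective).extend_apply (fun t => ξ t) y
          (⟨t, by simp⟩ : {t // t ∉ (∅ : Finset (Fin m))})
      · rw [Function.extend_apply' _ _ _ hj, Function.extend_apply']
        rintro ⟨a, ha⟩
        exact hj ⟨a, ha⟩
    rwa [e] at h0
  · exact ⟨∅, fun h => absurd h hi⟩

theorem MN_GG_le (μ : Measure Ω) [IsProbabilityMeasure μ] {n m : ℕ} {r : ℝ} (hr : 0 < r)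
    (hr1 : r ≤ 1) {F : (Fin m → Fin n) → (Fin m → Ω) → ℝ≥0∞} (hF : ∀ i, Measurable (F i))
    (hFt : ∀ i ξ, F i ξ ≠ ⊤) (hF0 : ∀ i, ¬ StrictMono i → F i = 0) (y : Fin n → Ω)
    (J : Finset (Fin m)) :
    MN μ r J (fun i => (GG F y J i).indicator (F i)) ≤
      2 ^ m * DD μ (fun (i : {k // k ∉ J} → Fin n) x => WW F i x * UU F x ^ (r-1)) y
      + 2 ^ m * DD μ (fun (i : Fin m → Fin n) x => F i (fun t => x (i t)) * UU F x ^ (r-1)) y := by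
  classical
  have hc1 : (1 : ℝ≥0∞) ≤ 2 ^ m := one_le_pow₀ (by norm_num)
  have hct : (2 : ℝ≥0∞) ^ m ≠ ⊤ := ENNReal.pow_ne_top (by norm_num)
  set Ψ : (Fin m → Fin n) → (Fin m → Ω) → ℝ≥0∞ := fun i ξ =>
    if Function.Injective i then F i ξ * UU F (Function.extend i ξ y) ^ (r-1) else 0 with hΨ
  have hΨm : ∀ i, Measurable (Ψ i) := by
    intro i
    by_cases hi : Function.Injective i
    · simp only [hΨ, hi, if_true]
      have m1 : Measurable (fun ξ : Fin m → Ω => Function.extend i ξ y) :=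
        (extend_prod_measurable (μ := μ) hi).comp measurable_prodMk_left
      exact (hF i).mul (((UU_measurable hF).comp m1).pow_const _)
    · simp only [hΨ, hi, if_false]; exact measurable_const
  have hD1 : DD μ (fun (i : Fin m → Fin n) x => F i (fun t => x (i t)) * UU F x ^ (r-1)) y
      = ∑ i, ∫⁻ ξ, Ψ i ξ ∂(Measure.pi fun _ => μ) := by
    unfold DD
    refine Finset.sum_congr rfl fun i _ => ?_
    by_cases hi : Function.Injective i
    · simp only [hΨ, hi, if_true]
      refine lintegral_congr fun ξ => ?_
      congr 2
      funext t
      exact hi.extend_apply _ _ _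
    · simp [hΨ, hi]
  rw [hD1, ← MN_one μ J hΨm]
  unfold MN DD
  rw [Finset.mul_sum, Finset.mul_sum, ← Finset.sum_add_distrib]
  refine Finset.sum_le_sum fun i' _ => ?_
  have hind : ∀ i, Measurable ((GG F y J i).indicator (F i)) := fun i =>
    (hF i).indicator (GG_measurable μ hF y J i)
  by_cases hi' : Function.Injective i'
  swap
  · have : ∀ i'', F (comb J i'' i') = 0 := fun i'' =>
      hF0 _ fun hm => hi' (comb_inj_left hm.injective)
    simp [this, hr]
  rw [if_pos hi']
  have m2 : Measurable (fun ξ' : {k // k ∉ J} → Ω => Function.extend i' ξ' y) :=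
    (extend_prod_measurable (μ := μ) hi').comp measurable_prodMk_left
  have m3 : Measurable (fun ξ' : {k // k ∉ J} → Ω => WW F i' (Function.extend i' ξ' y)
      * UU F (Function.extend i' ξ' y) ^ (r-1)) :=
    ((WW_measurable hF i').comp m2).mul (((UU_measurable hF).comp m2).pow_const _)
  rw [← lintegral_const_mul' _ _ hct, ← lintegral_const_mul' _ _ hct,
    ← lintegral_add_left (m3.const_mul _)]
  refine lintegral_mono fun ξ' => ?_
  simp only
  set x := Function.extend i' ξ' y with hx
  set z : ℝ≥0∞ := if UU F x ≤ 2 ^ m * WW F i' x then WW F i' x else 0 with hz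
  refine (rpow_split _ z hr hr1).trans (add_le_add ?_ ?_)
  · simp only [hz]
    split_ifs with h
    · rw [← mul_rpow_sub_one (WW_ne_top hFt i' x) hr, mul_left_comm]
      gcongr
      exact rpow_anti_mul hc1 hct h hr hr1
    · rw [ENNReal.zero_rpow_of_pos hr]; exact zero_le
  · rw [Finset.sum_mul, Finset.mul_sum]
    refine Finset.sum_le_sum fun i'' _ => ?_
    have m4 : Measurable (fun ξ'' : {k // k ∈ J} → Ω => comb J ξ'' ξ') :=
      (comb_measurable J).comp measurable_prodMk_left
    have m5 : Measurable (fun ξ'' : {k // k ∈ J} → Ω =>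
        (GG F y J (comb J i'' i')).indicator (F (comb J i'' i')) (comb J ξ'' ξ')) :=
      (hind _).comp m4
    rw [← lintegral_mul_const _ m5, ← lintegral_const_mul' _ _ hct]
    refine lintegral_mono fun ξ'' => ?_
    simp only [Function.comp]
    by_cases hs : StrictMono (comb J i'' i')
    swap
    · simp [hF0 _ hs]
    by_cases hg : comb J ξ'' ξ' ∈ GG F y J (comb J i'' i')
    swap
    · simp [hg]
    have hg' := hg hs.injective
    have e1 : (fun t : {t // t ∉ J} => comb J i'' i' t) = i' := funext fun t => comb_notMem _ _ t
    have e2 : (fun t : {t // t ∉ J} => comb J ξ'' ξ' t) = ξ' := funext fun t => comb_notMem _ _ t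
    rw [e1, e2] at hg'
    rw [Set.indicator_of_mem hg]
    have hz' : z = WW F i' x := if_pos hg'.2
    simp only [hΨ]
    rw [if_pos hs.injective, hz', mul_left_comm]
    gcongr
    exact rpow_anti_mul hc1 hct hg'.1 hr hr1

theorem good_sets (μ : Measure Ω) [IsProbabilityMeasure μ] {n m : ℕ} {r : ℝ} (hr : 0 < r)
    (hr1 : r ≤ 1) {F : (Fin m → Fin n) → (Fin m → Ω) → ℝ≥0∞} (hF : ∀ i, Measurable (F i))
    (hFt : ∀ i ξ, F i ξ ≠ ⊤) (hF0 : ∀ i, ¬ StrictMono i → F i = 0) :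
    ∃ G : Finset (Fin m) → (Fin m → Fin n) → Set (Fin m → Ω),
      (∀ J i, MeasurableSet (G J i)) ∧ (∀ i ξ, ∃ J, ξ ∈ G J i) ∧
      ∀ J, MN μ r J (fun i => (G J i).indicator (F i)) ≤
        2 ^ m * (1 + 2 ^ m * (m+1) ^ m) * ∫⁻ x, UU F x ^ r ∂(Measure.pi fun _ : Fin n => μ) := by
  classical
  have hΦ1 : ∀ i : Fin m → Fin n, Measurable
      (fun x : Fin n → Ω => F i (fun t => x (i t)) * UU F x ^ (r-1)) := fun i =>
    ((hF i).comp (by fun_prop)).mul ((UU_measurable hF).pow_const _)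
  have hΦ2 : ∀ (J : Finset (Fin m)) (i : {k // k ∉ J} → Fin n), Measurable
      (fun x : Fin n → Ω => WW F i x * UU F x ^ (r-1)) := fun J i =>
    (WW_measurable hF i).mul ((UU_measurable hF).pow_const _)
  set D1 := DD μ (fun (i : Fin m → Fin n) x => F i (fun t => x (i t)) * UU F x ^ (r-1)) with hD1
  set D2 : Finset (Fin m) → (Fin n → Ω) → ℝ≥0∞ := fun J =>
    DD μ (fun (i : {k // k ∉ J} → Fin n) x => WW F i x * UU F x ^ (r-1)) with hD2
  set I := ∫⁻ x, UU F x ^ r ∂(Measure.pi fun _ : Fin n => μ) with hI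
  have s1 := DD_spec μ hΦ1
  have s2 := fun J => DD_spec μ (hΦ2 J)
  have b1 : ∫⁻ y, D1 y ∂(Measure.pi fun _ : Fin n => μ) ≤ I := by
    refine s1.2.trans (lintegral_mono fun x => ?_)
    rw [← Finset.sum_mul]
    exact (mul_rpow_sub_one (UU_ne_top hFt x) hr).le
  have b2 : ∀ J, ∫⁻ y, D2 J y ∂(Measure.pi fun _ : Fin n => μ) ≤ (m+1) ^ m * I := by
    intro J
    refine (s2 J).2.trans ?_
    rw [hI, ← lintegral_const_mul' _ _ (ENNReal.pow_ne_top (by simp))]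
    refine lintegral_mono fun x => ?_
    simp only
    rw [← Finset.sum_mul, ← mul_rpow_sub_one (UU_ne_top hFt x) hr, ← mul_assoc]
    gcongr
    refine (sum_WW_le (ι := {k // k ∉ J}) F x).trans ?_
    refine mul_le_mul_left ?_ _
    calc (m : ℝ≥0∞) ^ (Fintype.card {k // k ∉ J}) ≤ (m+1) ^ (Fintype.card {k // k ∉ J}) := by
          gcongr; exact le_self_add
      _ ≤ (m+1) ^ m := by
          refine pow_le_pow_right₀ (by simp) ?_
          exact (Fintype.card_subtype_le _).trans (by simp)
  have hDm : Measurable (fun y => D1 y + ∑ J, D2 J y) :=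
    s1.1.add (Finset.measurable_sum _ fun J _ => (s2 J).1)
  obtain ⟨y, hy⟩ := exists_le_lintegral (μ := Measure.pi fun _ : Fin n => μ) hDm.aemeasurable
  have htot : ∫⁻ y, (D1 y + ∑ J, D2 J y) ∂(Measure.pi fun _ : Fin n => μ)
      ≤ (1 + 2 ^ m * (m+1) ^ m) * I := by
    rw [lintegral_add_left s1.1, lintegral_finsetSum _ fun J _ => (s2 J).1, add_mul, one_mul]
    refine add_le_add b1 ?_
    refine (Finset.sum_le_card_nsmul _ _ _ fun J _ => b2 J).trans ?_
    rw [Finset.card_univ, Fintype.card_finset, Fintype.card_fin, nsmul_eq_mul, mul_assoc]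
    push_cast
    exact le_rfl
  refine ⟨GG F y, GG_measurable μ hF y, GG_cover F y, fun J => ?_⟩
  refine (MN_GG_le μ hr hr1 hF hFt hF0 y J).trans ?_
  rw [← mul_add, mul_assoc]
  gcongr
  refine le_trans ?_ (hy.trans htot)
  rw [add_comm]
  gcongr
  exact Finset.single_le_sum (f := fun J => D2 J y) (fun _ _ => zero_le) (Finset.mem_univ J)

theorem MN_mono (μ : Measure Ω) {r : ℝ} (hr : 0 < r) {n m : ℕ} (J : Finset (Fin m))
    {F G : (Fin m → Fin n) → (Fin m → Ω) → ℝ≥0∞} (h : ∀ i ξ, F i ξ ≤ G i ξ) :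
    MN μ r J F ≤ MN μ r J G := by
  unfold MN
  gcongr
  exact h _ _

theorem MN_congr_ae (μ : Measure Ω) [IsProbabilityMeasure μ] {r : ℝ} {n m : ℕ}
    (J : Finset (Fin m)) {F G : (Fin m → Fin n) → (Fin m → Ω) → ℝ≥0∞}
    (h : ∀ i, F i =ᵐ[Measure.pi fun _ => μ] G i) : MN μ r J F = MN μ r J G := by
  unfold MN
  refine Finset.sum_congr rfl fun i' _ => ?_
  have key : ∀ i'' : {k // k ∈ J} → Fin n, ∀ᵐ ξ' ∂(Measure.pi fun _ : {k // k ∉ J} => μ),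
      ∀ᵐ ξ'' ∂(Measure.pi fun _ : {k // k ∈ J} => μ),
        F (comb J i'' i') (comb J ξ'' ξ') = G (comb J i'' i') (comb J ξ'' ξ') := fun i'' =>
    Measure.ae_ae_of_ae_prod ((comb_mp μ J).quasiMeasurePreserving.ae (h (comb J i'' i')))
  refine lintegral_congr_ae ?_
  filter_upwards [ae_all_iff.2 key] with ξ' hξ
  congr 1
  exact Finset.sum_congr rfl fun i'' _ => lintegral_congr_ae (hξ i'')

theorem inner_measurable (μ : Measure Ω) [IsProbabilityMeasure μ] {n m : ℕ}
    (J : Finset (Fin m)) {F : (Fin m → Fin n) → (Fin m → Ω) → ℝ≥0∞} (hF : ∀ i, Measurable (F i))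
    (i' : {k // k ∉ J} → Fin n) : Measurable (fun ξ' : {k // k ∉ J} → Ω =>
      ∑ i'' : {k // k ∈ J} → Fin n, ∫⁻ ξ'' : {k // k ∈ J} → Ω,
      F (comb J i'' i') (comb J ξ'' ξ') ∂Measure.pi fun _ => μ) := by
  refine Finset.measurable_sum _ fun i'' _ => ?_
  have hm : Measurable
      (fun q : ({k // k ∉ J} → Ω) × ({k // k ∈ J} → Ω) => F (comb J i'' i') (comb J q.2 q.1)) :=
    (hF _).comp (comb_measurable J)
  exact hm.lintegral_prod_right'

theorem MN_add (μ : Measure Ω) [IsProbabilityMeasure μ] {r : ℝ} (hr : 0 < r) (hr1 : r ≤ 1)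
    {n m : ℕ} (J : Finset (Fin m)) {F G : (Fin m → Fin n) → (Fin m → Ω) → ℝ≥0∞}
    (hF : ∀ i, Measurable (F i)) :
    MN μ r J (fun i ξ => F i ξ + G i ξ) ≤ MN μ r J F + MN μ r J G := by
  unfold MN
  rw [← Finset.sum_add_distrib]
  refine Finset.sum_le_sum fun i' _ => ?_
  rw [← lintegral_add_left ((inner_measurable μ J hF i').pow_const r)]
  refine lintegral_mono fun ξ' => ?_
  refine le_trans (le_of_eq ?_) (ENNReal.rpow_add_le_add_rpow _ _ hr.le hr1)
  congr 1
  rw [← Finset.sum_add_distrib]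
  refine Finset.sum_congr rfl fun i'' _ => ?_
  exact lintegral_add_left ((hF _).comp ((comb_measurable J).comp measurable_prodMk_left)) _

theorem update_comb_mem {m : ℕ} {α : Type*} {J : Finset (Fin m)} (x'' : {k // k ∈ J} → α)
    (x' : {k // k ∉ J} → α) {k : Fin m} (hk : k ∈ J) (z : α) :
    Function.update (comb J x'' x') k z = comb J (Function.update x'' ⟨k, hk⟩ z) x' := by
  funext l
  by_cases h : l = k
  · subst h; simp [comb, hk]
  · by_cases hl : l ∈ J
    · simp [comb, hl, h]
    · simp [comb, hl, h]

theorem update_comb_notMem {m : ℕ} {α : Type*} {J : Finset (Fin m)} (x'' : {k // k ∈ J} → α)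
    (x' : {k // k ∉ J} → α) {k : Fin m} (hk : k ∉ J) (z : α) :
    Function.update (comb J x'' x') k z = comb J x'' (Function.update x' ⟨k, hk⟩ z) := by
  funext l
  by_cases h : l = k
  · subst h; simp [comb, hk]
  · by_cases hl : l ∈ J
    · simp [comb, hl, h]
    · simp [comb, hl, h]

theorem lintegral_update (μ : Measure Ω) [IsProbabilityMeasure μ] {κ : Type} [Fintype κ]
    [DecidableEq κ] (j : κ) {Φ : (κ → Ω) → ℝ≥0∞} (hΦ : Measurable Φ) :
    ∫⁻ y, ∫⁻ z, Φ (Function.update y j z) ∂μ ∂(Measure.pi fun _ : κ => μ)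
      = ∫⁻ y, Φ y ∂(Measure.pi fun _ : κ => μ) := by
  have mp := mp_update μ j
  rw [← mp.lintegral_comp hΦ, lintegral_prod (fun a : (κ → Ω) × Ω => Φ (Function.update a.1 j a.2))
    (hΦ.comp mp.measurable).aemeasurable]

theorem minkowski_sum (μ : Measure Ω) [IsProbabilityMeasure μ] {α : Type*} [MeasurableSpace α]
    (ν : Measure α) [IsProbabilityMeasure ν] {n : ℕ} {ι : Type} [Fintype ι] [DecidableEq ι]
    {h : (ι → Fin n) → α → Ω → ℝ≥0∞} (hh : ∀ i, Measurable (fun q : α × Ω => h i q.1 q.2)) :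
    ∑ i, ∫⁻ ξ, (∫⁻ z, h i ξ z ∂μ) ^ (2:ℝ) ∂ν
      ≤ (∫⁻ z, (∑ i, ∫⁻ ξ, h i ξ z ^ (2:ℝ) ∂ν) ^ (1/2:ℝ) ∂μ) ^ (2:ℝ) := by
  have hF : Measurable (fun q : ((ι → Fin n) × α) × Ω => h q.1.1 q.1.2 q.2) := by
    have : Measurable (fun q : (ι → Fin n) × (α × Ω) => h q.1 q.2.1 q.2.2) :=
      measurable_from_prod_countable_right hh
    exact this.comp (MeasurableEquiv.prodAssoc).measurable
  have key := minkowski_two ((Measure.count : Measure (ι → Fin n)).prod ν) μ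
    (F := fun (a : (ι → Fin n) × α) (z : Ω) => h a.1 a.2 z) hF
  have e1 : ∀ Φ : (ι → Fin n) × α → ℝ≥0∞, Measurable Φ →
      ∫⁻ a, Φ a ∂((Measure.count : Measure (ι → Fin n)).prod ν) = ∑ i, ∫⁻ ξ, Φ (i, ξ) ∂ν := by
    intro Φ hΦ
    rw [lintegral_prod _ hΦ.aemeasurable, lintegral_count, tsum_fintype]
  rw [e1 _ (by exact hF.lintegral_prod_right'.pow_const _)] at key
  refine key.trans (le_of_eq ?_)
  congr 1
  refine lintegral_congr fun z => ?_
  congr 1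
  exact e1 _ ((hF.comp measurable_prodMk_right).pow_const _)

theorem MN_avg (μ : Measure Ω) [IsProbabilityMeasure μ] {r : ℝ} (hr : 1/2 ≤ r)
    {n m : ℕ} (J : Finset (Fin m)) {h : (Fin m → Fin n) → (Fin m → Ω) → ℝ≥0∞}
    (hh : ∀ i, Measurable (h i)) (k : Fin m) :
    MN μ r J (fun i ξ => (∫⁻ z, h i (Function.update ξ k z) ∂μ) ^ (2:ℝ))
      ≤ MN μ r J (fun i ξ => h i ξ ^ (2:ℝ)) := by
  have hr0 : 0 < r := by linarith
  unfold MN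
  by_cases hk : k ∈ J
  · refine Finset.sum_le_sum fun i' _ => lintegral_mono fun ξ' => ?_
    refine ENNReal.rpow_le_rpow (Finset.sum_le_sum fun i'' _ => ?_) hr0.le
    have m4 : Measurable (fun ξ'' : {k // k ∈ J} → Ω => comb J ξ'' ξ') :=
      (comb_measurable J).comp measurable_prodMk_left
    rw [← lintegral_update μ (⟨k, hk⟩ : {k // k ∈ J})
      (Φ := fun ξ'' => h (comb J i'' i') (comb J ξ'' ξ') ^ (2:ℝ)) (((hh _).comp m4).pow_const _)]
    refine lintegral_mono fun ξ'' => ?_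
    simp only [update_comb_mem _ _ hk]
    refine jensen_convex μ (by norm_num) ?_
    exact ((hh _).comp (m4.comp (measurable_update ξ''))).aemeasurable
  · refine Finset.sum_le_sum fun i' _ => ?_
    set S : ({k // k ∉ J} → Ω) → ℝ≥0∞ := fun ξ' => ∑ i'' : {k // k ∈ J} → Fin n,
      ∫⁻ ξ'' : {k // k ∈ J} → Ω, h (comb J i'' i') (comb J ξ'' ξ') ^ (2:ℝ) ∂Measure.pi fun _ => μ
      with hS
    have hSm : Measurable S :=
      inner_measurable μ J (F := fun i ξ => h i ξ ^ (2:ℝ)) (fun i => (hh i).pow_const _) i'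
    rw [← lintegral_update μ (⟨k, hk⟩ : {k // k ∉ J}) (Φ := fun ξ' => S ξ' ^ r)
      (hSm.pow_const _)]
    refine lintegral_mono fun ξ' => ?_
    simp only [update_comb_notMem _ _ hk]
    have hmk := minkowski_sum μ (Measure.pi fun _ : {k // k ∈ J} => μ)
      (h := fun (i'' : {k // k ∈ J} → Fin n) ξ'' z =>
        h (comb J i'' i') (comb J ξ'' (Function.update ξ' ⟨k, hk⟩ z)))
      (fun i'' => (hh _).comp ((comb_measurable J).comp
        (((measurable_update ξ').comp measurable_snd).prodMk measurable_fst)))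
    refine (ENNReal.rpow_le_rpow hmk hr0.le).trans ?_
    rw [← ENNReal.rpow_mul]
    have hSu : Measurable (fun z => S (Function.update ξ' ⟨k, hk⟩ z)) :=
      hSm.comp (measurable_update ξ')
    refine (jensen_convex μ (by linarith) (hSu.pow_const (1/2:ℝ)).aemeasurable).trans ?_
    refine le_of_eq (lintegral_congr fun z => ?_)
    rw [← ENNReal.rpow_mul]
    congr 1
    ring

/-- Averaging in one coordinate. -/
noncomputable def avg (μ : Measure Ω) {m : ℕ} (k : Fin m) (a : (Fin m → Ω) → ℝ)
    (y : Fin m → Ω) : ℝ := ∫ z, a (Function.update y k z) ∂μ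

theorem avg_measurable (μ : Measure Ω) [IsProbabilityMeasure μ] {m : ℕ} (k : Fin m)
    {a : (Fin m → Ω) → ℝ} (ha : Measurable a) : Measurable (avg μ k a) := by
  have h : StronglyMeasurable (fun q : (Fin m → Ω) × Ω => a (Function.update q.1 k q.2)) :=
    (ha.comp (mp_update μ k).measurable).stronglyMeasurable
  exact h.integral_prod_right'.measurable

theorem avg_integrable (μ : Measure Ω) [IsProbabilityMeasure μ] {m : ℕ} (k : Fin m)
    {a : (Fin m → Ω) → ℝ} (ha : Integrable a (Measure.pi fun _ => μ)) :
    Integrable (avg μ k a) (Measure.pi fun _ => μ) :=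
  ((mp_update μ k).integrable_comp_of_integrable ha).integral_prod_left

theorem avg_congr_ae (μ : Measure Ω) [IsProbabilityMeasure μ] {m : ℕ} (k : Fin m)
    {a b : (Fin m → Ω) → ℝ} (h : a =ᵐ[Measure.pi fun _ => μ] b) :
    avg μ k a =ᵐ[Measure.pi fun _ => μ] avg μ k b := by
  have := Measure.ae_ae_of_ae_prod ((mp_update μ k).quasiMeasurePreserving.ae h)
  filter_upwards [this] with y hy
  exact integral_congr_ae hy

theorem avg_sub (μ : Measure Ω) [IsProbabilityMeasure μ] {m : ℕ} (k : Fin m)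
    {a b : (Fin m → Ω) → ℝ} (ha : Integrable a (Measure.pi fun _ => μ))
    (hb : Integrable b (Measure.pi fun _ => μ)) :
    avg μ k (fun y => a y - b y) =ᵐ[Measure.pi fun _ => μ] fun y => avg μ k a y - avg μ k b y := by
  filter_upwards [slice_integrable ha k, slice_integrable hb k] with y h1 h2
  exact integral_sub h1 h2

theorem avg_sum (μ : Measure Ω) [IsProbabilityMeasure μ] {m : ℕ} (k : Fin m) {ι : Type*}
    [Fintype ι] {a : ι → (Fin m → Ω) → ℝ} (ha : ∀ J, Integrable (a J) (Measure.pi fun _ => μ)) :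
    avg μ k (fun y => ∑ J, a J y) =ᵐ[Measure.pi fun _ => μ] fun y => ∑ J, avg μ k (a J) y := by
  filter_upwards [ae_all_iff.2 fun J => slice_integrable (ha J) k] with y h1
  exact integral_finsetSum _ fun J _ => h1 J

theorem avg_idem (μ : Measure Ω) [IsProbabilityMeasure μ] {m : ℕ} (k : Fin m)
    (a : (Fin m → Ω) → ℝ) : avg μ k (avg μ k a) = avg μ k a := by
  funext y
  simp [avg, Function.update_idem]

theorem avg_zero_of (μ : Measure Ω) [IsProbabilityMeasure μ] {m : ℕ} {k l : Fin m} (hkl : l ≠ k)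
    {a : (Fin m → Ω) → ℝ} (ha : Integrable a (Measure.pi fun _ => μ))
    (h : ∀ᵐ y ∂(Measure.pi fun _ : Fin m => μ), avg μ l a y = 0) :
    ∀ᵐ y ∂(Measure.pi fun _ : Fin m => μ), avg μ l (avg μ k a) y = 0 := by
  have h1 := Measure.ae_ae_of_ae_prod ((mp_update μ k).quasiMeasurePreserving.ae h)
  have mp : MeasurePreserving (fun q : (Fin m → Ω) × (Ω × Ω) =>
      Function.update (Function.update q.1 l q.2.1) k q.2.2)
      ((Measure.pi fun _ => μ).prod (μ.prod μ)) (Measure.pi fun _ => μ) := by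
    have e := (measurePreserving_prodAssoc (Measure.pi fun _ : Fin m => μ) μ μ).symm
    exact (mp_update μ k).comp (((mp_update μ l).prod (MeasurePreserving.id μ)).comp e)
  have h2 := (mp.integrable_comp_of_integrable ha).prod_right_ae
  filter_upwards [h1, h2] with y hy1 hy2
  unfold avg
  have := integral_integral_swap
    (f := fun w z => a (Function.update (Function.update y l w) k z)) (μ := μ) (ν := μ) hy2
  rw [this]
  rw [← integral_zero Ω ℝ (μ := μ)]
  refine integral_congr_ae ?_
  filter_upwards [hy1] with z hz
  rw [← hz]
  unfold avg
  refine integral_congr_ae (Filter.Eventually.of_forall fun w => ?_)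
  simp only
  rw [Function.update_comm hkl]

/-- The `p`-th power of the mixed norm of a real kernel. -/
noncomputable def MR (μ : Measure Ω) (r : ℝ) {n m : ℕ} (J : Finset (Fin m))
    (a : (Fin m → Fin n) → (Fin m → Ω) → ℝ) : ℝ≥0∞ :=
  MN μ r J fun i ξ => ENNReal.ofReal ((a i ξ) ^ 2)

theorem ofReal_sq_eq (y : ℝ) : ENNReal.ofReal (y ^ 2) = ‖y‖ₑ ^ (2:ℝ) := by
  rw [enorm_rpow _ (by norm_num)]
  congr 1
  rw [← sq_abs]
  norm_cast

theorem MR_avg (μ : Measure Ω) [IsProbabilityMeasure μ] {r : ℝ} (hr : 1/2 ≤ r)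
    {n m : ℕ} (J : Finset (Fin m)) {a : (Fin m → Fin n) → (Fin m → Ω) → ℝ}
    (ha : ∀ i, Measurable (a i)) (k : Fin m) :
    MR μ r J (fun i => avg μ k (a i)) ≤ MR μ r J a := by
  unfold MR
  simp only [ofReal_sq_eq]
  refine le_trans (MN_mono μ (by linarith) J fun i ξ => ?_)
    (MN_avg μ hr J (h := fun i ξ => ‖a i ξ‖ₑ) (fun i => (ha i).enorm) k)
  exact ENNReal.rpow_le_rpow (enorm_integral_le_lintegral_enorm _) (by norm_num)

theorem MR_sub (μ : Measure Ω) [IsProbabilityMeasure μ] {r : ℝ} (hr : 0 < r) (hr1 : r ≤ 1)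
    {n m : ℕ} (J : Finset (Fin m)) {a b : (Fin m → Fin n) → (Fin m → Ω) → ℝ}
    (ha : ∀ i, Measurable (a i)) (hb : ∀ i, Measurable (b i)) :
    MR μ r J (fun i ξ => a i ξ - b i ξ) ≤ 2 * MR μ r J a + 2 * MR μ r J b := by
  unfold MR
  set A : (Fin m → Fin n) → (Fin m → Ω) → ℝ≥0∞ := fun i ξ => ENNReal.ofReal ((a i ξ) ^ 2) with hA
  set B : (Fin m → Fin n) → (Fin m → Ω) → ℝ≥0∞ := fun i ξ => ENNReal.ofReal ((b i ξ) ^ 2) with hB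
  have hAm : ∀ i, Measurable (A i) := fun i => by have := ha i; simp only [hA]; fun_prop
  have hBm : ∀ i, Measurable (B i) := fun i => by have := hb i; simp only [hB]; fun_prop
  calc MN μ r J (fun i ξ => ENNReal.ofReal ((a i ξ - b i ξ) ^ 2))
      ≤ MN μ r J (fun i ξ => (A i ξ + A i ξ) + (B i ξ + B i ξ)) := by
        refine MN_mono μ hr J fun i ξ => ?_
        simp only [hA, hB]
        rw [← ENNReal.ofReal_add (by positivity) (by positivity),
          ← ENNReal.ofReal_add (by positivity) (by positivity),
          ← ENNReal.ofReal_add (by positivity) (by positivity)]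
        refine ENNReal.ofReal_le_ofReal ?_
        nlinarith [sq_nonneg (a i ξ + b i ξ)]
    _ ≤ MN μ r J (fun i ξ => A i ξ + A i ξ) + MN μ r J (fun i ξ => B i ξ + B i ξ) :=
        MN_add μ hr hr1 J (F := fun i ξ => A i ξ + A i ξ) fun i => (hAm i).add (hAm i)
    _ ≤ (MN μ r J A + MN μ r J A) + (MN μ r J B + MN μ r J B) :=
        add_le_add (MN_add μ hr hr1 J hAm) (MN_add μ hr hr1 J hBm)
    _ = _ := by rw [two_mul, two_mul]

theorem projection (μ : Measure Ω) [IsProbabilityMeasure μ] {r : ℝ} (hr : 1/2 ≤ r) (hr1 : r ≤ 1)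
    {n m : ℕ} {f : (Fin m → Fin n) → (Fin m → Ω) → ℝ} (hf : HC μ f)
    {a : Finset (Fin m) → (Fin m → Fin n) → (Fin m → Ω) → ℝ} {B : ℝ≥0∞}
    (h1 : ∀ J i, Measurable (a J i)) (h2 : ∀ J i, ¬ StrictMono i → a J i = 0)
    (h3 : ∀ J i, Integrable (a J i) (Measure.pi fun _ => μ))
    (h4 : ∀ i ξ, f i ξ = ∑ J, a J i ξ) (h5 : ∀ J, MR μ r J (a J) ≤ B) (s : Finset (Fin m)) :
    ∃ b : Finset (Fin m) → (Fin m → Fin n) → (Fin m → Ω) → ℝ,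
      (∀ J i, Measurable (b J i)) ∧ (∀ J i, ¬ StrictMono i → b J i = 0) ∧
      (∀ J i, Integrable (b J i) (Measure.pi fun _ => μ)) ∧
      (∀ i, f i =ᵐ[Measure.pi fun _ => μ] fun ξ => ∑ J, b J i ξ) ∧
      (∀ k ∈ s, ∀ J i, ∀ᵐ y ∂(Measure.pi fun _ : Fin m => μ), avg μ k (b J i) y = 0) ∧
      ∀ J, MR μ r J (b J) ≤ 4 ^ s.card * B := by
  classical
  induction s using Finset.induction_on with
  | empty =>
    exact ⟨a, h1, h2, h3, fun i => Filter.Eventually.of_forall fun ξ => h4 i ξ, by simp,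
      by simpa using h5⟩
  | insert k s hks ih =>
    obtain ⟨b, b1, b2, b3, b4, b5, b6⟩ := ih
    refine ⟨fun J i y => b J i y - avg μ k (b J i) y, fun J i => (b1 J i).sub
      (avg_measurable μ k (b1 J i)), ?_, fun J i => (b3 J i).sub (avg_integrable μ k (b3 J i)),
      ?_, ?_, ?_⟩
    · intro J i hi
      funext y
      simp [avg, b2 J i hi]
    · intro i
      filter_upwards [b4 i, hf.mz i k, avg_congr_ae μ k (b4 i), avg_sum μ k (fun J => b3 J i)]
        with y e1 e2 e3 e4
      have e2' : avg μ k (f i) y = 0 := e2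
      rw [Finset.sum_sub_distrib, ← e1, ← e4, ← e3, e2', sub_zero]
    · intro l hl J i
      have hs := avg_sub μ l (b3 J i) (avg_integrable μ k (b3 J i))
      by_cases hlk : l = k
      · subst hlk
        filter_upwards [hs] with y hy
        rw [hy, avg_idem, sub_self]
      · have hls : l ∈ s := Finset.mem_of_mem_insert_of_ne hl hlk
        filter_upwards [hs, b5 l hls J i, avg_zero_of μ hlk (b3 J i) (b5 l hls J i)]
          with y hy e1 e2
        rw [hy, e1, e2, sub_zero]
    · intro J
      refine (MR_sub μ (by linarith) hr1 J (b1 J) fun i => avg_measurable μ k (b1 J i)).trans ?_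
      calc _ ≤ 2 * MR μ r J (b J) + 2 * MR μ r J (b J) := by
            gcongr; exact MR_avg μ hr J (b1 J) k
        _ = 4 * MR μ r J (b J) := by ring
        _ ≤ 4 * (4 ^ s.card * B) := by gcongr; exact b6 J
        _ = _ := by rw [Finset.card_insert_of_notMem hks, pow_succ]; ring

theorem initial_decomposition (μ : Measure Ω) [IsProbabilityMeasure μ] {r : ℝ} (hr : 0 < r)
    (hr1 : r ≤ 1) {n m : ℕ} {f : (Fin m → Fin n) → (Fin m → Ω) → ℝ} (hf : HC μ f) :
    ∃ a : Finset (Fin m) → (Fin m → Fin n) → (Fin m → Ω) → ℝ,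
      (∀ J i, Measurable (a J i)) ∧ (∀ J i, ¬ StrictMono i → a J i = 0) ∧
      (∀ J i, Integrable (a J i) (Measure.pi fun _ => μ)) ∧
      (∀ i ξ, f i ξ = ∑ J, a J i ξ) ∧
      ∀ J, MR μ r J (a J) ≤ 2 ^ m * (1 + 2 ^ m * (m+1) ^ m) *
        ∫⁻ x, sqf f x ^ r ∂(Measure.pi fun _ : Fin n => μ) := by
  classical
  set F : (Fin m → Fin n) → (Fin m → Ω) → ℝ≥0∞ := fun i ξ => ENNReal.ofReal ((f i ξ) ^ 2) with hF
  obtain ⟨G, G1, G2, G3⟩ := good_sets μ hr hr1 (F := F)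
    (fun i => by have := hf.meas i; simp only [hF]; fun_prop) (fun i ξ => by simp [hF])
    (fun i hi => by funext ξ; simp [hF, hf.supp i hi])
  set w : Finset (Fin m) → (Fin m → Fin n) → (Fin m → Ω) → ℝ := fun J i =>
    (G J i).indicator (fun _ => 1) with hw
  set N : (Fin m → Fin n) → (Fin m → Ω) → ℝ := fun i ξ => ∑ K, w K i ξ with hN
  have hw0 : ∀ J i ξ, 0 ≤ w J i ξ := fun J i ξ => Set.indicator_nonneg (fun _ _ => zero_le_one) _
  have hwm : ∀ J i, Measurable (w J i) := fun J i => measurable_const.indicator (G1 J i)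
  have hNm : ∀ i, Measurable (N i) := fun i => Finset.measurable_sum _ fun K _ => hwm K i
  have hN1 : ∀ i ξ, 1 ≤ N i ξ := by
    intro i ξ
    obtain ⟨J, hJ⟩ := G2 i ξ
    have : w J i ξ = 1 := Set.indicator_of_mem hJ _
    rw [← this]
    exact Finset.single_le_sum (f := fun K => w K i ξ) (fun K _ => hw0 K i ξ) (Finset.mem_univ J)
  have hwN : ∀ J i ξ, |w J i ξ / N i ξ| ≤ w J i ξ := by
    intro J i ξ
    rw [abs_of_nonneg (div_nonneg (hw0 J i ξ) (by linarith [hN1 i ξ]))]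
    exact div_le_self (hw0 J i ξ) (hN1 i ξ)
  have hw1 : ∀ J i ξ, w J i ξ ≤ 1 := by
    intro J i ξ
    simp only [hw]
    exact Set.indicator_le_self' (fun _ _ => zero_le_one) ξ
  refine ⟨fun J i ξ => w J i ξ / N i ξ * f i ξ, fun J i => ((hwm J i).div (hNm i)).mul (hf.meas i),
    ?_, ?_, ?_, ?_⟩
  · intro J i hi
    funext ξ
    simp [hf.supp i hi]
  · intro J i
    refine (hf.int i).mono (((hwm J i).div (hNm i)).mul (hf.meas i)).aestronglyMeasurable ?_
    refine Filter.Eventually.of_forall fun ξ => ?_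
    rw [norm_mul]
    refine mul_le_of_le_one_left (norm_nonneg _) ?_
    exact (hwN J i ξ).trans (hw1 J i ξ)
  · intro i ξ
    rw [← Finset.sum_mul, ← Finset.sum_div, div_self (by linarith [hN1 i ξ]), one_mul]
  · intro J
    refine le_trans (MN_mono μ hr J fun i ξ => ?_) (G3 J)
    by_cases hξ : ξ ∈ G J i
    · rw [Set.indicator_of_mem hξ]
      refine ENNReal.ofReal_le_ofReal ?_
      rw [mul_pow]
      refine mul_le_of_le_one_left (sq_nonneg _) ?_
      rw [← sq_abs]
      exact pow_le_one₀ (abs_nonneg _) ((hwN J i ξ).trans (hw1 J i ξ))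
    · have : w J i ξ = 0 := Set.indicator_of_notMem hξ _
      simp [this]

theorem lower_bound (m : ℕ) : ∃ K : ℝ, 1 ≤ K ∧ ∀ (Ω : Type u) [MeasurableSpace Ω] (μ : Measure Ω)
    [IsProbabilityMeasure μ] (n : ℕ) (p : ℝ), 1 ≤ p → p ≤ 2 →
    ∀ (f : (Fin m → Fin n) → (Fin m → Ω) → ℝ), HC μ f → ∃ s ∈ hoeffdingDecompVals μ p f,
      s ≤ ENNReal.ofReal K *
        (∫⁻ x, ‖chaos f x‖ₑ ^ p ∂(Measure.pi fun _ : Fin n => μ)) ^ (1/p) := by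
  classical
  obtain ⟨K, hK, H⟩ := square_function.{u} m
  set C1 : ℝ := 4 ^ m * (2 ^ m * (1 + 2 ^ m * (m+1) ^ m) * K) with hC1
  have hC11 : 1 ≤ C1 := by
    have e4 : (1:ℝ) ≤ 4 ^ m := one_le_pow₀ (by norm_num)
    have e2 : (1:ℝ) ≤ 2 ^ m := one_le_pow₀ (by norm_num)
    have e1 : (1:ℝ) ≤ 1 + 2 ^ m * (m+1) ^ m := by
      have : (0:ℝ) ≤ 2 ^ m * (m+1) ^ m := by positivity
      linarith
    exact one_le_mul_of_one_le_of_one_le e4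
      (one_le_mul_of_one_le_of_one_le (one_le_mul_of_one_le_of_one_le e2 e1) hK)
  refine ⟨2 ^ m * C1, one_le_mul_of_one_le_of_one_le (one_le_pow₀ (by norm_num)) hC11, ?_⟩
  intro Ω _ μ _ n p hp hp2 f hf
  have hp0 : 0 < p := by linarith
  set I := ∫⁻ x, ‖chaos f x‖ₑ ^ p ∂(Measure.pi fun _ : Fin n => μ) with hI
  obtain ⟨a, a1, a2, a3, a4, a5⟩ := initial_decomposition μ (r := p/2) (by positivity)
    (by linarith) hf
  obtain ⟨b, b1, b2, b3, b4, b5, b6⟩ := projection μ (r := p/2) (by linarith) (by linarith) hf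
    a1 a2 a3 a4 a5 Finset.univ
  have hsq := (H Ω μ n p hp hp2 f hf).1
  have hMR : ∀ J, MR μ (p/2) J (b J) ≤ ENNReal.ofReal C1 * I := by
    intro J
    refine (b6 J).trans ?_
    have e : ENNReal.ofReal C1 * I
        = 4 ^ m * (2 ^ m * (1 + 2 ^ m * (m+1) ^ m) * (ENNReal.ofReal K * I)) := by
      have : ENNReal.ofReal C1
          = 4 ^ m * (2 ^ m * (1 + 2 ^ m * (m+1) ^ m) * ENNReal.ofReal K) := by
        rw [hC1, ENNReal.ofReal_mul (by positivity), ENNReal.ofReal_mul (by positivity),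
          ENNReal.ofReal_mul (by positivity), ENNReal.ofReal_add (by norm_num) (by positivity),
          ENNReal.ofReal_mul (by positivity), ENNReal.ofReal_pow (by positivity),
          ENNReal.ofReal_pow (by positivity), ENNReal.ofReal_pow (by positivity),
          ENNReal.ofReal_add (by positivity) (by positivity)]
        simp
      rw [this]; ring
    rw [e, Finset.card_univ, Fintype.card_fin]
    gcongr
  set b' : Finset (Fin m) → (Fin m → Fin n) → (Fin m → Ω) → ℝ := fun J i ξ =>
    if J = ∅ then f i ξ - ∑ L ∈ Finset.univ.erase ∅, b L i ξ else b J i ξ with hb'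
  have hae : ∀ J i, b' J i =ᵐ[Measure.pi fun _ => μ] b J i := by
    intro J i
    by_cases hJ : J = ∅
    · filter_upwards [b4 i] with ξ hξ
      simp only [hb', hJ, if_true]
      rw [hξ, ← Finset.add_sum_erase _ _ (Finset.mem_univ (∅ : Finset (Fin m)))]
      ring
    · refine Filter.Eventually.of_forall fun ξ => ?_
      simp [hb', hJ]
  refine ⟨_, ⟨b', ?_, ?_, ?_, ?_, rfl⟩, ?_⟩
  · intro J i
    by_cases hJ : J = ∅
    · simp only [hb', hJ, if_true]
      exact (hf.meas i).sub (Finset.measurable_sum _ fun L _ => b1 L i)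
    · simp only [hb', hJ, if_false]
      exact b1 J i
  · intro J i hi
    funext ξ
    simp [hb', hf.supp i hi, b2 _ i hi]
  · intro J i k
    filter_upwards [avg_congr_ae μ k (hae J i), b5 k (Finset.mem_univ k) J i] with y h1 h2
    exact h1.trans h2
  · intro i ξ
    rw [← Finset.add_sum_erase _ _ (Finset.mem_univ (∅ : Finset (Fin m)))]
    have : ∑ L ∈ Finset.univ.erase ∅, b' L i ξ = ∑ L ∈ Finset.univ.erase ∅, b L i ξ := by
      refine Finset.sum_congr rfl fun L hL => ?_
      simp [hb', Finset.ne_of_mem_erase hL]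
    rw [this]
    simp [hb']
  · have hterm : ∀ J, mixedNormPL2 μ p J (b' J) ≤ ENNReal.ofReal C1 * I ^ (1/p) := by
      intro J
      rw [mixedNormPL2_eq]
      have e : (MN μ (p/2) J fun i ξ => ENNReal.ofReal ((b' J i ξ) ^ 2)) = MR μ (p/2) J (b J) := by
        refine MN_congr_ae μ J fun i => ?_
        filter_upwards [hae J i] with ξ hξ
        rw [hξ]
      rw [e]
      refine (ENNReal.rpow_le_rpow (hMR J) (by positivity)).trans ?_
      rw [ENNReal.mul_rpow_of_nonneg _ _ (by positivity)]
      gcongr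
      conv_rhs => rw [← ENNReal.rpow_one (ENNReal.ofReal C1)]
      refine ENNReal.rpow_le_rpow_of_exponent_le (by simpa using hC11) ?_
      rw [div_le_one hp0]; exact hp
    refine (Finset.sum_le_card_nsmul _ _ _ fun J _ => hterm J).trans ?_
    rw [Finset.card_univ, Fintype.card_finset, Fintype.card_fin, nsmul_eq_mul,
      ENNReal.ofReal_mul (p := 2 ^ m) (q := C1) (by positivity),
      ENNReal.ofReal_pow (by norm_num), mul_assoc (ENNReal.ofReal 2 ^ m)]
    simp

/-- **Decomposition theorem for `V^p_m(Ω^n)`** (Corollary `2msummandmz` of the paper):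
for `1 ≤ p ≤ 2` and `f(x) = ∑_{i₁<⋯<i_m} f_i (x_{i₁},…,x_{i_m}) ∈ V^p_m(Ω^n)`,
`‖f‖_{L^p(Ω^n)}` is equivalent, with constants depending only on `m`, to
`inf ∑_{J ⊆ [1,m]} ‖⨿_i a^{(J)}_i‖_{L^p(Ω̄^{J'}, L²(Ω̄^J))}` over all decompositions
`f = ∑_J a^{(J)}` within `V^p_m(Ω^n)`. -/
theorem hoeffding_subspace_decomposition (m : ℕ) (hm : 1 ≤ m) :
    ∃ c C : ℝ, 0 < c ∧ 0 < C ∧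
      ∀ (Ω : Type u) [MeasurableSpace Ω] (μ : Measure Ω) [IsProbabilityMeasure μ]
        (n : ℕ) (p : ℝ), 1 ≤ p → p ≤ 2 →
      ∀ f : (Fin m → Fin n) → (Fin m → Ω) → ℝ,
        (∀ i, Measurable (f i)) →
        (∀ i, ¬ StrictMono i → f i = 0) →
        (∀ (i : Fin m → Fin n) (k : Fin m),
          ∀ᵐ y ∂(Measure.pi fun _ : Fin m => μ),
            ∫ z, f i (Function.update y k z) ∂μ = 0) →
        (∀ i, (∫⁻ y, ENNReal.ofReal (|f i y| ^ p) ∂Measure.pi fun _ : Fin m => μ) < ⊤) →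
        (ENNReal.ofReal c * sInf (hoeffdingDecompVals μ p f)
            ≤ (∫⁻ x : Fin n → Ω,
                ENNReal.ofReal (|∑ i : Fin m → Fin n, f i fun k => x (i k)| ^ p)
                ∂Measure.pi fun _ : Fin n => μ) ^ (1/p)) ∧
        ((∫⁻ x : Fin n → Ω,
              ENNReal.ofReal (|∑ i : Fin m → Fin n, f i fun k => x (i k)| ^ p)
              ∂Measure.pi fun _ : Fin n => μ) ^ (1/p)
            ≤ ENNReal.ofReal C * sInf (hoeffdingDecompVals μ p f)) := by
  obtain ⟨K1, hK1, H1⟩ := lower_bound.{u} m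
  obtain ⟨K2, hK2, H2⟩ := upper_bound.{u} m
  have hK10 : 0 < K1 := by linarith
  have hK20 : 0 < K2 := by linarith
  refine ⟨K1⁻¹, K2, inv_pos.2 hK10, hK20, ?_⟩
  intro Ω _ μ _ n p hp hp2 f h1 h2 h3 h4
  have hp0 : 0 ≤ p := by linarith
  have hf := HC_of_lp hp h1 h2 h3 h4
  have e : ∫⁻ x : Fin n → Ω, ENNReal.ofReal (|∑ i : Fin m → Fin n, f i fun k => x (i k)| ^ p)
      ∂(Measure.pi fun _ : Fin n => μ)
      = ∫⁻ x, ‖chaos f x‖ₑ ^ p ∂(Measure.pi fun _ : Fin n => μ) :=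
    lintegral_congr fun x => (enorm_rpow _ hp0).symm
  rw [e]
  constructor
  · obtain ⟨s, hs, hsl⟩ := H1 Ω μ n p hp hp2 f hf
    calc _ ≤ ENNReal.ofReal K1⁻¹ * (ENNReal.ofReal K1 * (∫⁻ x, ‖chaos f x‖ₑ ^ p
            ∂(Measure.pi fun _ : Fin n => μ)) ^ (1/p)) := by
          gcongr; exact (sInf_le hs).trans hsl
      _ = _ := by
          rw [← mul_assoc, ← ENNReal.ofReal_mul (by positivity), inv_mul_cancel₀ hK10.ne',
            ENNReal.ofReal_one, one_mul]
  · have hk0 : ENNReal.ofReal K2 ≠ 0 := by simpa using hK20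
    rw [mul_comm]
    refine ENNReal.div_le_iff_le_mul (Or.inl hk0) (Or.inl ENNReal.ofReal_ne_top) |>.1 ?_
    refine le_sInf fun s hs => ?_
    refine ENNReal.div_le_iff_le_mul (Or.inl hk0) (Or.inl ENNReal.ofReal_ne_top) |>.2 ?_
    rw [mul_comm]
    exact H2 Ω μ n p hp hp2 f s hs
end

section
/- Let (Ω, μ) be a probability space, B a Hilbert space, M ≥ 0, and f ∈ V^1_{≤M}(Ω^n, B), with B-valued Hoeffding components f_{i_1,…,i_m} (so that P_{i_1,…,i_m} f (x) = f_{i_1,…,i_m}(x_{i_1},…,x_{i_m})). Then ‖f‖_{L^1(Ω^n, B)} is equivalent, with constants depending only on M, to ∑_{0 ≤ m ≤ M} ∫_{Ω^{nm}} ( ∑_{1 ≤ i_1 < ⋯ < i_m ≤ n} ‖ f_{i_1,…,i_m}( x^{(1)}_{i_1},…,x^{(m)}_{i_m} ) ‖_B² )^{1/2} dx^{(1)} ⋯ dx^{(m)}. -/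
open MeasureTheory
open scoped ENNReal

universe u v

namespace HDS

section Chaos
variable {ι : Type*} [DecidableEq ι] {B : Type*} [NormedAddCommGroup B] [InnerProductSpace ℝ B]

/-- Walsh sum over subsets of `S`. -/
noncomputable def walsh (S : Finset ι) (v : Finset ι → B) (T : Finset ι) : B :=
  ∑ I ∈ S.powerset, ((-1 : ℝ) ^ (T ∩ I).card) • v I

lemma walsh_insert {S : Finset ι} {a : ι} (ha : a ∉ S) (v : Finset ι → B) {T : Finset ι}
    (hT : T ⊆ S) :
    walsh (insert a S) v T = walsh S v T + walsh S (fun I => v (insert a I)) T := by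
  unfold walsh
  rw [Finset.sum_powerset_insert ha]
  congr 1
  refine Finset.sum_congr rfl fun I _ => ?_
  rw [Finset.inter_insert_of_notMem (fun h => ha (hT h))]

lemma walsh_insert' {S : Finset ι} {a : ι} (ha : a ∉ S) (v : Finset ι → B) {T : Finset ι}
    (hT : T ⊆ S) :
    walsh (insert a S) v (insert a T) = walsh S v T - walsh S (fun I => v (insert a I)) T := by
  unfold walsh
  rw [Finset.sum_powerset_insert ha, sub_eq_add_neg, ← Finset.sum_neg_distrib]
  congr 1
  · refine Finset.sum_congr rfl fun I hI => ?_
    rw [Finset.insert_inter_of_notMem (fun h => ha (Finset.mem_powerset.1 hI h))]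
  · refine Finset.sum_congr rfl fun I hI => ?_
    rw [← Finset.insert_inter_distrib, Finset.card_insert_of_notMem, pow_succ]
    · simp
    · exact fun h => ha (hT (Finset.mem_inter.1 h).1)

lemma walsh_two (S : Finset ι) : ∀ (v : Finset ι → B),
    ∑ T ∈ S.powerset, ‖walsh S v T‖ ^ 2 = 2 ^ S.card * ∑ I ∈ S.powerset, ‖v I‖ ^ 2 := by
  induction S using Finset.induction_on with
  | empty => intro v; simp [walsh]
  | insert a S ha ih =>
    intro v
    rw [Finset.sum_powerset_insert ha, Finset.sum_powerset_insert ha, Finset.card_insert_of_notMem ha,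
      ← Finset.sum_add_distrib]
    have : ∀ T ∈ S.powerset, ‖walsh (insert a S) v T‖ ^ 2 + ‖walsh (insert a S) v (insert a T)‖ ^ 2
        = 2 * ‖walsh S v T‖ ^ 2 + 2 * ‖walsh S (fun I => v (insert a I)) T‖ ^ 2 := by
      intro T hT
      have hT := Finset.mem_powerset.1 hT
      rw [walsh_insert ha v hT, walsh_insert' ha v hT]
      have := parallelogram_law_with_norm ℝ (walsh S v T) (walsh S (fun I => v (insert a I)) T)
      nlinarith
    rw [Finset.sum_congr rfl this, Finset.sum_add_distrib, ← Finset.mul_sum, ← Finset.mul_sum, ih, ih]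
    ring

lemma four_ineq (e d : B) : ‖e + d‖ ^ 4 + ‖e - d‖ ^ 4 ≤
    2 * (‖e‖ ^ 4 + 6 * (‖e‖ ^ 2 * ‖d‖ ^ 2) + ‖d‖ ^ 4) := by
  have h1 := norm_add_sq_real e d
  have h2 := norm_sub_sq_real e d
  have h3 : (inner ℝ e d) ^ 2 ≤ ‖e‖ ^ 2 * ‖d‖ ^ 2 := by
    rw [← mul_pow, ← sq_abs]
    exact pow_le_pow_left₀ (abs_nonneg _) (abs_real_inner_le_norm e d) 2
  have e1 : ‖e + d‖ ^ 4 = (‖e + d‖ ^ 2) ^ 2 := by ring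
  have e2 : ‖e - d‖ ^ 4 = (‖e - d‖ ^ 2) ^ 2 := by ring
  rw [e1, e2, h1, h2]
  nlinarith

lemma walsh_four (S : Finset ι) : ∀ (v : Finset ι → B),
    ∑ T ∈ S.powerset, ‖walsh S v T‖ ^ 4 ≤
      2 ^ S.card * (∑ I ∈ S.powerset, 3 ^ I.card * ‖v I‖ ^ 2) ^ 2 := by
  induction S using Finset.induction_on with
  | empty => intro v; simp [walsh]; apply le_of_eq; ring
  | insert a S ha ih =>
    intro v
    rw [Finset.sum_powerset_insert ha, Finset.sum_powerset_insert ha, Finset.card_insert_of_notMem ha,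
      ← Finset.sum_add_distrib]
    set v' : Finset ι → B := fun I => v (insert a I) with hv'
    set α := ∑ I ∈ S.powerset, 3 ^ I.card * ‖v I‖ ^ 2 with hα
    set β := ∑ I ∈ S.powerset, 3 ^ I.card * ‖v' I‖ ^ 2 with hβ
    have hα0 : 0 ≤ α := Finset.sum_nonneg fun _ _ => by positivity
    have hβ0 : 0 ≤ β := Finset.sum_nonneg fun _ _ => by positivity
    have hs : ∑ I ∈ S.powerset, 3 ^ (insert a I).card * ‖v (insert a I)‖ ^ 2 = 3 * β := by
      rw [hβ, Finset.mul_sum]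
      refine Finset.sum_congr rfl fun I hI => ?_
      rw [Finset.card_insert_of_notMem (fun h => ha (Finset.mem_powerset.1 hI h))]
      ring
    rw [hs]
    have h1 : ∑ T ∈ S.powerset, (‖walsh (insert a S) v T‖ ^ 4 +
        ‖walsh (insert a S) v (insert a T)‖ ^ 4) ≤
        ∑ T ∈ S.powerset, 2 * (‖walsh S v T‖ ^ 4 + 6 * (‖walsh S v T‖ ^ 2 * ‖walsh S v' T‖ ^ 2)
          + ‖walsh S v' T‖ ^ 4) := by
      refine Finset.sum_le_sum fun T hT => ?_
      have hT := Finset.mem_powerset.1 hT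
      rw [walsh_insert ha v hT, walsh_insert' ha v hT]
      exact four_ineq _ _
    refine h1.trans ?_
    rw [← Finset.mul_sum, Finset.sum_add_distrib, Finset.sum_add_distrib, ← Finset.mul_sum]
    have i1 := ih v
    have i2 := ih v'
    have cs := Finset.sum_mul_sq_le_sq_mul_sq S.powerset (fun T => ‖walsh S v T‖ ^ 2)
      (fun T => ‖walsh S v' T‖ ^ 2)
    simp only [← pow_mul] at cs
    norm_num at cs
    have h2 : ∑ T ∈ S.powerset, ‖walsh S v T‖ ^ 2 * ‖walsh S v' T‖ ^ 2 ≤ 2 ^ S.card * (α * β) := by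
      refine abs_le_of_sq_le_sq' ?_ (by positivity) |>.2
      refine cs.trans ?_
      calc _ ≤ (2 ^ S.card * α ^ 2) * (2 ^ S.card * β ^ 2) :=
            mul_le_mul i1 i2 (Finset.sum_nonneg fun _ _ => by positivity) (by positivity)
        _ = _ := by ring
    calc _ ≤ 2 * (2 ^ S.card * α ^ 2 + 6 * (2 ^ S.card * (α * β)) + 2 ^ S.card * β ^ 2) := by
          gcongr
      _ = 2 ^ (S.card + 1) * (α ^ 2 + 6 * (α * β) + β ^ 2) := by ring
      _ ≤ _ := by
          gcongr
          nlinarith [sq_nonneg β]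

lemma khin_upper (S : Finset ι) (v : Finset ι → B) :
    ∑ T ∈ S.powerset, ‖walsh S v T‖ ≤ 2 ^ S.card * Real.sqrt (∑ I ∈ S.powerset, ‖v I‖ ^ 2) := by
  have cs := sq_sum_le_card_mul_sum_sq (s := S.powerset) (f := fun T => ‖walsh S v T‖)
  rw [walsh_two, Finset.card_powerset] at cs
  push_cast at cs
  have hA : 0 ≤ ∑ I ∈ S.powerset, ‖v I‖ ^ 2 := Finset.sum_nonneg fun _ _ => by positivity
  refine abs_le_of_sq_le_sq' ?_ (by positivity) |>.2
  rw [mul_pow, Real.sq_sqrt hA]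
  linarith

lemma khin_lower (M : ℕ) (S : Finset ι) (v : Finset ι → B) (hv : ∀ I, M < I.card → v I = 0) :
    2 ^ S.card * Real.sqrt (∑ I ∈ S.powerset, ‖v I‖ ^ 2) ≤
      3 * 3 ^ M * ∑ T ∈ S.powerset, ‖walsh S v T‖ := by
  set A := ∑ I ∈ S.powerset, ‖v I‖ ^ 2 with hAdef
  have hA : 0 ≤ A := Finset.sum_nonneg fun _ _ => by positivity
  have hX : 0 ≤ ∑ T ∈ S.powerset, ‖walsh S v T‖ := Finset.sum_nonneg fun _ _ => by positivity
  rcases hA.eq_or_lt with h0 | hpos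
  · rw [← h0]; simp; positivity
  have h3 : ∑ I ∈ S.powerset, 3 ^ I.card * ‖v I‖ ^ 2 ≤ 3 ^ M * A := by
    rw [hAdef, Finset.mul_sum]
    refine Finset.sum_le_sum fun I _ => ?_
    rcases lt_or_ge M I.card with h | h
    · simp [hv I h]
    · gcongr
      norm_num
  have h4 : ∑ T ∈ S.powerset, ‖walsh S v T‖ ^ 4 ≤ 2 ^ S.card * (3 ^ M * A) ^ 2 := by
    refine (walsh_four S v).trans ?_
    have : 0 ≤ ∑ I ∈ S.powerset, 3 ^ I.card * ‖v I‖ ^ 2 := Finset.sum_nonneg fun _ _ => by positivity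
    gcongr
  have h2 := walsh_two S v
  rw [← hAdef] at h2
  set r := Real.sqrt A with hr
  have hrpos : 0 < r := Real.sqrt_pos.2 hpos
  have hrA : r ^ 2 = A := Real.sq_sqrt hA
  set l : ℝ := 2 * 3 ^ M * r with hl
  have hlpos : 0 < l := by positivity
  have hpt : ∀ T ∈ S.powerset, ‖walsh S v T‖ ^ 2 ≤ l * ‖walsh S v T‖ + ‖walsh S v T‖ ^ 4 / l ^ 2 := by
    intro T _
    set x := ‖walsh S v T‖
    have hx : 0 ≤ x := norm_nonneg _
    rcases le_total x l with h | h
    · have : 0 ≤ x ^ 4 / l ^ 2 := by positivity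
      nlinarith
    · have : x ^ 2 ≤ x ^ 4 / l ^ 2 := by
        rw [le_div_iff₀ (by positivity)]
        have : l ^ 2 ≤ x ^ 2 := by gcongr
        nlinarith [sq_nonneg x]
      have : 0 ≤ l * x := by positivity
      linarith
  have hs := Finset.sum_le_sum hpt
  rw [Finset.sum_add_distrib, ← Finset.mul_sum, ← Finset.sum_div, h2] at hs
  have h5 : (∑ T ∈ S.powerset, ‖walsh S v T‖ ^ 4) / l ^ 2 ≤ 2 ^ S.card * A / 4 := by
    rw [div_le_iff₀ (by positivity)]
    refine h4.trans (le_of_eq ?_)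
    rw [hl, ← hrA]; ring
  have h6 : (2 ^ S.card * r) * r ≤ (3 * 3 ^ M * ∑ T ∈ S.powerset, ‖walsh S v T‖) * r := by
    rw [← hrA] at hs h5
    have : 0 ≤ 3 ^ M * r * ∑ T ∈ S.powerset, ‖walsh S v T‖ := by positivity
    rw [hl] at hs h5
    nlinarith
  exact le_of_mul_le_mul_right h6 hrpos

lemma sqrt_conv {κ : Type*} (s : Finset κ) (g : κ → B) :
    (∑ I ∈ s, ‖g I‖ₑ ^ 2) ^ ((1:ℝ)/2) = ENNReal.ofReal (Real.sqrt (∑ I ∈ s, ‖g I‖ ^ 2)) := by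
  have hA : 0 ≤ ∑ I ∈ s, ‖g I‖ ^ 2 := Finset.sum_nonneg fun _ _ => by positivity
  rw [Real.sqrt_eq_rpow, ← ENNReal.ofReal_rpow_of_nonneg hA (by norm_num),
    ENNReal.ofReal_sum_of_nonneg (fun _ _ => by positivity)]
  congr 1
  refine Finset.sum_congr rfl fun I _ => ?_
  rw [ENNReal.ofReal_pow (norm_nonneg _), ofReal_norm]

lemma sum_conv {κ : Type*} (s : Finset κ) (g : κ → B) :
    ∑ I ∈ s, ‖g I‖ₑ = ENNReal.ofReal (∑ I ∈ s, ‖g I‖) := by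
  rw [ENNReal.ofReal_sum_of_nonneg (fun _ _ => by positivity)]
  exact Finset.sum_congr rfl fun I _ => (ofReal_norm _).symm

lemma khin_upper_e (S : Finset ι) (v : Finset ι → B) :
    ∑ T ∈ S.powerset, ‖walsh S v T‖ₑ ≤ 2 ^ S.card * (∑ I ∈ S.powerset, ‖v I‖ₑ ^ 2) ^ ((1:ℝ)/2) := by
  rw [sqrt_conv, sum_conv]
  refine (ENNReal.ofReal_le_ofReal (khin_upper S v)).trans (le_of_eq ?_)
  rw [ENNReal.ofReal_mul (by positivity), ENNReal.ofReal_pow (by norm_num)]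
  simp

lemma khin_lower_e (M : ℕ) (S : Finset ι) (v : Finset ι → B) (hv : ∀ I, M < I.card → v I = 0) :
    2 ^ S.card * (∑ I ∈ S.powerset, ‖v I‖ₑ ^ 2) ^ ((1:ℝ)/2) ≤
      ENNReal.ofReal (3 * 3 ^ M) * ∑ T ∈ S.powerset, ‖walsh S v T‖ₑ := by
  rw [sqrt_conv, sum_conv, ← ENNReal.ofReal_mul (by positivity)]
  refine le_trans (le_of_eq ?_) (ENNReal.ofReal_le_ofReal (khin_lower M S v hv))
  rw [ENNReal.ofReal_mul (by positivity), ENNReal.ofReal_pow (by norm_num)]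
  simp

end Chaos

section Maps
variable {Ω : Type*} [MeasurableSpace Ω] (μ : Measure Ω) [IsProbabilityMeasure μ]

lemma mp_comp {m n : ℕ} (i : Fin m → Fin n) (hi : Function.Injective i) :
    MeasurePreserving (fun (x : Fin n → Ω) (k : Fin m) => x (i k))
      (Measure.pi fun _ => μ) (Measure.pi fun _ => μ) := by
  refine ⟨by fun_prop, ?_⟩
  symm
  refine Measure.pi_eq fun s hs => ?_
  rw [Measure.map_apply (by fun_prop) (MeasurableSet.univ_pi hs)]
  have : (fun (x : Fin n → Ω) (k : Fin m) => x (i k)) ⁻¹' (Set.univ.pi s) =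
      Set.univ.pi (Function.extend i s (fun _ => Set.univ)) := by
    ext x
    simp only [Set.mem_preimage, Set.mem_pi, Set.mem_univ, true_imp_iff]
    constructor
    · intro h j
      by_cases hj : ∃ k, i k = j
      · obtain ⟨k, rfl⟩ := hj
        rw [hi.extend_apply]; exact h k
      · rw [Function.extend_apply' _ _ _ hj]; trivial
    · intro h k
      have := h (i k)
      rwa [hi.extend_apply] at this
  rw [this, Measure.pi_pi]
  symm
  refine Fintype.prod_of_injective i hi _ _ ?_ ?_
  · intro j hj
    rw [Function.extend_apply' _ _ _ (by simpa using hj)]; simp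
  · intro k; rw [hi.extend_apply]

lemma mp_update {n : ℕ} (j : Fin n) :
    MeasurePreserving (fun p : (Fin n → Ω) × Ω => Function.update p.1 j p.2)
      ((Measure.pi fun _ => μ).prod μ) (Measure.pi fun _ => μ) := by
  have hm : Measurable (fun p : (Fin n → Ω) × Ω => Function.update p.1 j p.2) := by
    rw [measurable_pi_iff]
    intro k
    by_cases h : k = j
    · subst h; simpa using measurable_snd
    · simp only [Function.update_of_ne h]; fun_prop
  refine ⟨hm, ?_⟩
  symm
  refine Measure.pi_eq fun s hs => ?_
  rw [Measure.map_apply hm (MeasurableSet.univ_pi hs)]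
  have : (fun p : (Fin n → Ω) × Ω => Function.update p.1 j p.2) ⁻¹' (Set.univ.pi s) =
      (Set.univ.pi (Function.update s j Set.univ)) ×ˢ s j := by
    ext p
    simp only [Set.mem_preimage, Set.mem_pi, Set.mem_univ, true_imp_iff, Set.mem_prod]
    constructor
    · intro h
      refine ⟨fun k => ?_, by simpa using h j⟩
      by_cases hk : k = j
      · subst hk; simp
      · have := h k
        simpa [Function.update_of_ne hk] using this
    · rintro ⟨h1, h2⟩ k
      by_cases hk : k = j
      · subst hk; simpa using h2
      · have := h1 k
        simpa [Function.update_of_ne hk] using this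
  rw [this, Measure.prod_prod, Measure.pi_pi, ← Finset.mul_prod_erase Finset.univ (fun k => μ (s k)) (Finset.mem_univ j),
    ← Finset.mul_prod_erase Finset.univ _ (Finset.mem_univ j), mul_comm]
  simp only [Function.update_self, measure_univ, one_mul]
  congr 1
  refine Finset.prod_congr rfl fun k hk => ?_
  rw [Function.update_of_ne (Finset.ne_of_mem_erase hk)]

lemma mp_select {m n : ℕ} (δ : Fin n → Fin m) :
    MeasurePreserving (fun (x : Fin m → Fin n → Ω) (i : Fin n) => x (δ i) i)
      (Measure.pi fun _ => Measure.pi fun _ => μ) (Measure.pi fun _ => μ) := by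
  refine ⟨by fun_prop, ?_⟩
  symm
  refine Measure.pi_eq fun s hs => ?_
  rw [Measure.map_apply (by fun_prop) (MeasurableSet.univ_pi hs)]
  have : (fun (x : Fin m → Fin n → Ω) (i : Fin n) => x (δ i) i) ⁻¹' (Set.univ.pi s) =
      Set.univ.pi (fun k => Set.univ.pi fun i => if δ i = k then s i else Set.univ) := by
    ext x
    simp only [Set.mem_preimage, Set.mem_pi, Set.mem_univ, true_imp_iff]
    constructor
    · intro h k i
      split_ifs with hk
      · rw [← hk]; exact h i
      · trivial
    · intro h i
      have := h (δ i) i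
      simpa using this
  rw [this, Measure.pi_pi]
  simp_rw [Measure.pi_pi]
  rw [Finset.prod_comm]
  refine Finset.prod_congr rfl fun i _ => ?_
  rw [Finset.prod_eq_single (δ i)]
  · simp
  · intro k _ hk; simp [hk.symm]
  · simp

end Maps

end HDS

namespace HDS

section Coupled

lemma lagrange_exists (M : ℕ) : ∃ (s c : ℕ → ℝ), (∀ k ∈ Finset.range (M + 1), 0 ≤ s k ∧ s k ≤ 1) ∧
    ∀ d ≤ M, ∑ k ∈ Finset.range (M + 1), c k * s k ^ d = (-1) ^ d := by
  set s : ℕ → ℝ := fun k => (k : ℝ) / (M + 1) with hs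
  have hinj : Set.InjOn s (Finset.range (M + 1)) := by
    intro a _ b _ hab
    have hM : (M + 1 : ℝ) ≠ 0 := by positivity
    simp only [hs] at hab
    rw [div_left_inj' hM] at hab
    exact_mod_cast hab
  refine ⟨s, fun k => (Lagrange.basis (Finset.range (M + 1)) s k).eval (-1), ?_, ?_⟩
  · intro k hk
    have hk' : (k : ℝ) ≤ M := by exact_mod_cast Nat.lt_succ_iff.1 (Finset.mem_range.1 hk)
    refine ⟨by positivity, ?_⟩
    rw [hs]
    simp only
    rw [div_le_one (by positivity)]
    linarith
  · intro d hd
    have h := Lagrange.eq_interpolate (s := Finset.range (M + 1)) (v := s)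
      (f := (Polynomial.X ^ d : Polynomial ℝ)) hinj (by
        rw [Polynomial.degree_X_pow, Finset.card_range]
        exact_mod_cast Nat.lt_succ_of_le hd)
    have h2 := congrArg (Polynomial.eval (-1)) h
    rw [Lagrange.interpolate_apply, Polynomial.eval_finsetSum] at h2
    simp only [Polynomial.eval_mul, Polynomial.eval_pow, Polynomial.eval_X, Polynomial.eval_C] at h2
    rw [h2]
    exact Finset.sum_congr rfl fun k _ => mul_comm _ _

variable {Ω : Type*} [MeasurableSpace Ω] (μ : Measure Ω) [IsProbabilityMeasure μ]
  {B : Type*} [NormedAddCommGroup B] [InnerProductSpace ℝ B] [CompleteSpace B] {n : ℕ}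

/-- `L¹` norm of a weighted sum of the components. -/
noncomputable def wnorm (F : Finset (Fin n) → (Fin n → Ω) → B) (w : Finset (Fin n) → ℝ) : ℝ≥0∞ :=
  ∫⁻ x, ‖∑ I, w I • F I x‖ₑ ∂(Measure.pi fun _ => μ)

/-- Abstract Hoeffding components. -/
structure Hoeff (F : Finset (Fin n) → (Fin n → Ω) → B) : Prop where
  meas : ∀ I, StronglyMeasurable (F I)
  integ : ∀ I, Integrable (F I) (Measure.pi fun _ => μ)
  zero : ∀ I, ∀ j ∈ I, ∀ᵐ x ∂(Measure.pi fun _ : Fin n => μ), ∫ z, F I (Function.update x j z) ∂μ = 0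
  const : ∀ I, ∀ j ∉ I, ∀ x z, F I (Function.update x j z) = F I x

variable {μ} {F : Finset (Fin n) → (Fin n → Ω) → B}

lemma Hoeff.measSum (hF : Hoeff μ F) (w : Finset (Fin n) → ℝ) : StronglyMeasurable (fun x => ∑ I, w I • F I x) :=
  Finset.stronglyMeasurable_fun_sum _ fun I _ => (hF.meas I).const_smul (w I)

lemma wnorm_proj (hF : Hoeff μ F) (w : Finset (Fin n) → ℝ) (j : Fin n) :
    wnorm μ F (fun I => if j ∈ I then 0 else w I) ≤ wnorm μ F w := by
  have hint : ∀ I, ∀ᵐ x ∂(Measure.pi fun _ : Fin n => μ),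
      Integrable (fun z => F I (Function.update x j z)) μ := by
    intro I
    have := ((mp_update μ j).integrable_comp (hF.integ I).aestronglyMeasurable).2 (hF.integ I)
    exact this.prod_right_ae
  have hz : ∀ I, ∀ᵐ x ∂(Measure.pi fun _ : Fin n => μ), j ∈ I →
      ∫ z, F I (Function.update x j z) ∂μ = 0 := by
    intro I
    by_cases hj : j ∈ I
    · filter_upwards [hF.zero I j hj] with x hx _ using hx
    · exact Filter.Eventually.of_forall fun x h => absurd h hj
  have hkey : ∀ᵐ x ∂(Measure.pi fun _ : Fin n => μ),
      ‖∑ I, (if j ∈ I then 0 else w I) • F I x‖ₑ ≤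
        ∫⁻ z, ‖∑ I, w I • F I (Function.update x j z)‖ₑ ∂μ := by
    filter_upwards [ae_all_iff.2 hint, ae_all_iff.2 hz] with x h1 h2
    have : ∑ I, (if j ∈ I then 0 else w I) • F I x =
        ∫ z, ∑ I, w I • F I (Function.update x j z) ∂μ := by
      have hi : ∀ I ∈ (Finset.univ : Finset (Finset (Fin n))),
          Integrable (fun z => w I • F I (Function.update x j z)) μ := fun I _ => (h1 I).smul (w I)
      rw [integral_finsetSum _ hi]
      refine Finset.sum_congr rfl fun I _ => ?_
      rw [integral_smul]
      split_ifs with hj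
      · rw [h2 I hj]; simp
      · simp [hF.const I j hj]
    rw [this]
    exact enorm_integral_le_lintegral_enorm _
  unfold wnorm
  refine (lintegral_mono_ae hkey).trans (le_of_eq ?_)
  have hm : Measurable (fun x => ‖∑ I, w I • F I x‖ₑ) := (hF.measSum w).enorm
  rw [← (mp_update μ j).lintegral_comp hm]
  exact (lintegral_prod _ (hm.comp (mp_update μ j).measurable).aemeasurable).symm

lemma wnorm_add (hF : Hoeff μ F) (w w' : Finset (Fin n) → ℝ) :
    wnorm μ F (fun I => w I + w' I) ≤ wnorm μ F w + wnorm μ F w' := by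
  unfold wnorm
  rw [← lintegral_add_left (hF.measSum w).enorm]
  refine lintegral_mono fun x => ?_
  simp only [add_smul, Finset.sum_add_distrib]
  exact enorm_add_le _ _

lemma wnorm_smul (hF : Hoeff μ F) (w : Finset (Fin n) → ℝ) (t : ℝ) :
    wnorm μ F (fun I => t * w I) = ENNReal.ofReal |t| * wnorm μ F w := by
  unfold wnorm
  rw [← lintegral_const_mul _ (hF.measSum w).enorm]
  refine lintegral_congr fun x => ?_
  simp only [mul_smul, ← Finset.smul_sum]
  rw [enorm_smul, Real.enorm_eq_ofReal_abs]

lemma wnorm_sum (hF : Hoeff μ F) {κ : Type*} (s : Finset κ) (W : κ → Finset (Fin n) → ℝ) :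
    wnorm μ F (fun I => ∑ k ∈ s, W k I) ≤ ∑ k ∈ s, wnorm μ F (W k) := by
  classical
  induction s using Finset.induction_on with
  | empty => simp [wnorm]
  | insert a s ha ih =>
    simp only [Finset.sum_insert ha]
    exact (wnorm_add hF _ _).trans (by gcongr)

lemma wnorm_scale (hF : Hoeff μ F) (w : Finset (Fin n) → ℝ) (j : Fin n) {t : ℝ} (h0 : 0 ≤ t) (h1 : t ≤ 1) :
    wnorm μ F (fun I => (if j ∈ I then t else 1) * w I) ≤ wnorm μ F w := by
  have : (fun I : Finset (Fin n) => (if j ∈ I then t else 1) * w I) =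
      fun I => t * w I + (1 - t) * (if j ∈ I then 0 else w I) := by
    funext I; split_ifs <;> ring
  rw [this]
  refine (wnorm_add hF _ _).trans ?_
  rw [wnorm_smul hF, wnorm_smul hF]
  calc _ ≤ ENNReal.ofReal |t| * wnorm μ F w + ENNReal.ofReal |1 - t| * wnorm μ F w := by
        gcongr
        exact wnorm_proj hF w j
    _ = wnorm μ F w := by
        rw [← add_mul, abs_of_nonneg h0, abs_of_nonneg (by linarith : 0 ≤ 1 - t),
          ← ENNReal.ofReal_add h0 (by linarith)]
        simp

lemma wnorm_pow (hF : Hoeff μ F) (w : Finset (Fin n) → ℝ) (N : Finset (Fin n)) {t : ℝ} (h0 : 0 ≤ t) (h1 : t ≤ 1) :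
    wnorm μ F (fun I => t ^ (N ∩ I).card * w I) ≤ wnorm μ F w := by
  induction N using Finset.induction_on with
  | empty => simp
  | insert a N ha ih =>
    have : (fun I : Finset (Fin n) => t ^ (insert a N ∩ I).card * w I) =
        fun I => (if a ∈ I then t else 1) * (t ^ (N ∩ I).card * w I) := by
      funext I
      split_ifs with h
      · rw [Finset.insert_inter_of_mem h, Finset.card_insert_of_notMem (by simp [ha])]
        ring
      · rw [Finset.insert_inter_of_notMem h]; ring
    rw [this]
    exact (wnorm_scale hF _ a h0 h1).trans ih

lemma wnorm_sign (hF : Hoeff μ F) (M : ℕ) (s c : ℕ → ℝ) (hs : ∀ k ∈ Finset.range (M + 1), 0 ≤ s k ∧ s k ≤ 1)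
    (hc : ∀ d ≤ M, ∑ k ∈ Finset.range (M + 1), c k * s k ^ d = (-1) ^ d)
    (hM : ∀ I, M < I.card → F I = 0)
    (w : Finset (Fin n) → ℝ) (N : Finset (Fin n)) :
    wnorm μ F (fun I => (-1) ^ (N ∩ I).card * w I) ≤
      ENNReal.ofReal (∑ k ∈ Finset.range (M + 1), |c k|) * wnorm μ F w := by
  have : wnorm μ F (fun I => (-1) ^ (N ∩ I).card * w I) =
      wnorm μ F (fun I => ∑ k ∈ Finset.range (M + 1), c k * (s k ^ (N ∩ I).card * w I)) := by
    unfold wnorm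
    refine lintegral_congr fun x => ?_
    congr 1
    refine Finset.sum_congr rfl fun I _ => ?_
    rcases lt_or_ge M I.card with h | h
    · simp [hM I h]
    · beta_reduce
      rw [← hc (N ∩ I).card ((Finset.card_le_card Finset.inter_subset_right).trans h), Finset.sum_mul]
      simp only [mul_assoc]
  rw [this]
  refine (wnorm_sum hF _ _).trans ?_
  rw [ENNReal.ofReal_sum_of_nonneg (fun _ _ => abs_nonneg _), Finset.sum_mul]
  refine Finset.sum_le_sum fun k hk => ?_
  rw [wnorm_smul hF]
  gcongr
  exact wnorm_pow hF w N (hs k hk).1 (hs k hk).2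

lemma coupled (hF : Hoeff μ F) (M : ℕ) (s c : ℕ → ℝ) (hs : ∀ k ∈ Finset.range (M + 1), 0 ≤ s k ∧ s k ≤ 1)
    (hc : ∀ d ≤ M, ∑ k ∈ Finset.range (M + 1), c k * s k ^ d = (-1) ^ d)
    (hM : ∀ I, M < I.card → F I = 0) :
    (∫⁻ x, ‖∑ I, F I x‖ₑ ∂(Measure.pi fun _ => μ) ≤
      ENNReal.ofReal (∑ k ∈ Finset.range (M + 1), |c k|) *
        ∫⁻ x, (∑ I, ‖F I x‖ₑ ^ 2) ^ ((1:ℝ)/2) ∂(Measure.pi fun _ => μ)) ∧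
    (∫⁻ x, (∑ I, ‖F I x‖ₑ ^ 2) ^ ((1:ℝ)/2) ∂(Measure.pi fun _ => μ) ≤
      ENNReal.ofReal (3 * 3 ^ M) * (ENNReal.ofReal (∑ k ∈ Finset.range (M + 1), |c k|) *
        ∫⁻ x, ‖∑ I, F I x‖ₑ ∂(Measure.pi fun _ => μ))) := by
  set C := ENNReal.ofReal (∑ k ∈ Finset.range (M + 1), |c k|) with hC
  set L := ∫⁻ x, ‖∑ I, F I x‖ₑ ∂(Measure.pi fun _ => μ) with hL
  set Q := ∫⁻ x, (∑ I, ‖F I x‖ₑ ^ 2) ^ ((1:ℝ)/2) ∂(Measure.pi fun _ => μ) with hQ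
  have hL1 : L = wnorm μ F (fun _ => 1) := by simp [wnorm, hL]
  set E : Finset (Fin n) → ℝ≥0∞ := fun T => wnorm μ F (fun I => (-1) ^ (T ∩ I).card) with hE
  have h1 : ∀ T, L ≤ C * E T := by
    intro T
    have := wnorm_sign hF M s c hs hc hM (fun I => (-1) ^ (T ∩ I).card) T
    refine le_trans (le_of_eq ?_) this
    rw [hL1]
    congr 1
    funext I
    rw [← mul_pow]; simp
  have h2 : ∀ T, E T ≤ C * L := by
    intro T
    have := wnorm_sign hF M s c hs hc hM (fun I => 1) T
    rw [← hL1] at this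
    simpa using this
  have hEw : ∑ T, E T = ∫⁻ x, ∑ T, ‖walsh Finset.univ (fun I => F I x) T‖ₑ ∂(Measure.pi fun _ => μ) := by
    rw [lintegral_finsetSum]
    · simp [hE, wnorm, walsh]
    · intro T _
      have := (hF.measSum (fun I => (-1) ^ (T ∩ I).card)).enorm
      simpa [walsh] using this
  have hQm : Measurable (fun x => (∑ I, ‖F I x‖ₑ ^ 2) ^ ((1:ℝ)/2)) := by
    refine Measurable.pow_const ?_ _
    exact Finset.measurable_fun_sum _ fun I _ => (hF.meas I).enorm.pow_const 2
  have hup : ∑ T, E T ≤ 2 ^ n * Q := by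
    rw [hEw, hQ, ← lintegral_const_mul _ hQm]
    refine lintegral_mono fun x => ?_
    simpa using khin_upper_e Finset.univ (fun I => F I x)
  have hlow : 2 ^ n * Q ≤ ENNReal.ofReal (3 * 3 ^ M) * ∑ T, E T := by
    rw [hEw, hQ, ← lintegral_const_mul _ hQm, ← lintegral_const_mul' _ _ ENNReal.ofReal_ne_top]
    refine lintegral_mono fun x => ?_
    simpa using khin_lower_e M Finset.univ (fun I => F I x) (fun I hI => by rw [hM I hI]; rfl)
  have hn0 : (2 : ℝ≥0∞) ^ n ≠ 0 := by simp
  have hnt : (2 : ℝ≥0∞) ^ n ≠ ⊤ := by simp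
  have hcard : ∀ a : ℝ≥0∞, ∑ _T : Finset (Fin n), a = 2 ^ n * a := by intro a; simp
  constructor
  · rw [← ENNReal.mul_le_mul_iff_right hn0 hnt, ← hcard]
    calc _ ≤ ∑ T, C * E T := Finset.sum_le_sum fun T _ => h1 T
      _ = C * ∑ T, E T := by rw [Finset.mul_sum]
      _ ≤ C * (2 ^ n * Q) := by gcongr
      _ = _ := by ring
  · rw [← ENNReal.mul_le_mul_iff_right hn0 hnt]
    refine hlow.trans ?_
    calc _ ≤ ENNReal.ofReal (3 * 3 ^ M) * ∑ _T : Finset (Fin n), C * L := by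
          gcongr with T; exact h2 T
      _ = _ := by rw [hcard]; ring

end Coupled

section Decouple

lemma card_sel {m n : ℕ} (i : Fin m → Fin n) (hi : Function.Injective i) :
    m ^ n ≤ (Finset.univ.filter fun δ : Fin n → Fin m => ∀ k, δ (i k) = k).card * m ^ m := by
  have h := Finset.card_le_card_of_injOn (s := (Finset.univ : Finset (Fin n → Fin m)))
    (t := (Finset.univ.filter fun δ : Fin n → Fin m => ∀ k, δ (i k) = k) ×ˢ
      (Finset.univ : Finset (Fin m → Fin m)))
    (fun δ => (Function.extend i id δ, fun k => δ (i k))) ?_ ?_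
  · simpa [Finset.card_product] using h
  · intro δ _
    simp [hi.extend_apply]
  · intro δ _ δ' _ h
    simp only [Prod.mk.injEq] at h
    funext j
    by_cases hj : ∃ k, i k = j
    · obtain ⟨k, rfl⟩ := hj
      exact congrFun h.2 k
    · have := congrFun h.1 j
      rwa [Function.extend_apply' _ _ _ hj, Function.extend_apply' _ _ _ hj] at this

lemma sel_ineq {m n : ℕ} (a : (Fin m → Fin n) → ℝ≥0∞) (ha : ∀ i, ¬ Function.Injective i → a i = 0)
    (hfin : ∀ i, a i ≠ ⊤) :
    (m : ℝ≥0∞) ^ n * (∑ i, a i) ^ ((1:ℝ)/2) ≤ (m : ℝ≥0∞) ^ m *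
      ∑ δ : Fin n → Fin m, (∑ i, if (∀ k, δ (i k) = k) then a i else 0) ^ ((1:ℝ)/2) := by
  set W := ∑ i, a i with hW
  set V : (Fin n → Fin m) → ℝ≥0∞ := fun δ => ∑ i, if (∀ k, δ (i k) = k) then a i else 0 with hV
  have hsq : ∀ t : ℝ≥0∞, t ^ ((1:ℝ)/2) * t ^ ((1:ℝ)/2) = t := by
    intro t
    rw [← ENNReal.rpow_add_of_nonneg _ _ (by norm_num) (by norm_num)]
    norm_num
  have hWt : W ≠ ⊤ := ENNReal.sum_ne_top.2 fun i _ => hfin i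
  by_cases hW0 : W = 0
  · rw [hW0]; simp
  have hVW : ∀ δ, V δ ≤ W := by
    intro δ
    refine Finset.sum_le_sum fun i _ => ?_
    split_ifs <;> simp
  have hr0 : W ^ ((1:ℝ)/2) ≠ 0 := by simp [hW0]
  have hrt : W ^ ((1:ℝ)/2) ≠ ⊤ := ENNReal.rpow_ne_top_of_nonneg (by norm_num) hWt
  rw [← ENNReal.mul_le_mul_iff_right hr0 hrt]
  have h1 : (m : ℝ≥0∞) ^ n * W ≤ (m : ℝ≥0∞) ^ m * ∑ δ, V δ := by
    rw [hV, Finset.sum_comm, hW, Finset.mul_sum, Finset.mul_sum]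
    refine Finset.sum_le_sum fun i _ => ?_
    by_cases hi : Function.Injective i
    · rw [← Finset.sum_filter, Finset.sum_const, nsmul_eq_mul, ← mul_assoc]
      gcongr
      have := card_sel i hi
      rw [mul_comm] at this
      exact_mod_cast this
    · simp [ha i hi]
  calc W ^ ((1:ℝ)/2) * ((m : ℝ≥0∞) ^ n * W ^ ((1:ℝ)/2))
      = (m : ℝ≥0∞) ^ n * (W ^ ((1:ℝ)/2) * W ^ ((1:ℝ)/2)) := by ring
    _ ≤ (m : ℝ≥0∞) ^ m * ∑ δ, V δ := by rw [hsq]; exact h1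
    _ ≤ (m : ℝ≥0∞) ^ m * ∑ δ, W ^ ((1:ℝ)/2) * V δ ^ ((1:ℝ)/2) := by
        gcongr with δ
        calc V δ = V δ ^ ((1:ℝ)/2) * V δ ^ ((1:ℝ)/2) := (hsq _).symm
          _ ≤ _ := by
            gcongr
            exact hVW δ
    _ = _ := by rw [← Finset.mul_sum]; ring

variable {Ω : Type*} [MeasurableSpace Ω] (μ : Measure Ω) [IsProbabilityMeasure μ]

lemma decouple {m n : ℕ} (h : (Fin m → Fin n) → (Fin m → Ω) → ℝ≥0∞) (hm : ∀ i, Measurable (h i))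
    (h0 : ∀ i, ¬ Function.Injective i → h i = 0) (hfin : ∀ i y, h i y ≠ ⊤) :
    (∫⁻ x : Fin m → Fin n → Ω, (∑ i, h i fun k => x k (i k)) ^ ((1:ℝ)/2)
        ∂(Measure.pi fun _ => Measure.pi fun _ => μ) ≤
      (m : ℝ≥0∞) ^ m * ∫⁻ x : Fin n → Ω, (∑ i, h i fun k => x (i k)) ^ ((1:ℝ)/2)
        ∂(Measure.pi fun _ => μ)) ∧
    (∫⁻ x : Fin n → Ω, (∑ i, h i fun k => x (i k)) ^ ((1:ℝ)/2)
        ∂(Measure.pi fun _ => μ) ≤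
      (m : ℝ≥0∞) ^ m * ∫⁻ x : Fin m → Fin n → Ω, (∑ i, h i fun k => x k (i k)) ^ ((1:ℝ)/2)
        ∂(Measure.pi fun _ => Measure.pi fun _ => μ)) := by
  rcases Nat.eq_zero_or_pos m with rfl | hmpos
  · have e1 : ∀ x : Fin 0 → Fin n → Ω, (∑ i : Fin 0 → Fin n, h i fun k => x k (i k)) =
        ∑ i, h i Fin.elim0 := fun x => Finset.sum_congr rfl fun i _ => by
          congr 1; exact Subsingleton.elim _ _
    have e2 : ∀ x : Fin n → Ω, (∑ i : Fin 0 → Fin n, h i fun k => x (i k)) =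
        ∑ i, h i Fin.elim0 := fun x => Finset.sum_congr rfl fun i _ => by
          congr 1; exact Subsingleton.elim _ _
    simp only [e1, e2]
    simp
  set R : (Fin n → Fin m) → (Fin n → Ω) → ℝ≥0∞ := fun δ x =>
    (∑ i, if (∀ k, δ (i k) = k) then h i (fun k => x (i k)) else 0) ^ ((1:ℝ)/2) with hR
  have hRm : ∀ δ, Measurable (R δ) := by
    intro δ
    refine Measurable.pow_const ?_ _
    refine Finset.measurable_fun_sum _ fun i _ => ?_
    split_ifs
    · exact (hm i).comp (by fun_prop)
    · fun_prop
  have hRd : ∀ δ (x : Fin m → Fin n → Ω), R δ (fun i => x (δ i) i) =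
      (∑ i, if (∀ k, δ (i k) = k) then h i (fun k => x k (i k)) else 0) ^ ((1:ℝ)/2) := by
    intro δ x
    simp only [hR]
    congr 1
    refine Finset.sum_congr rfl fun i _ => ?_
    split_ifs with hk
    · simp only [hk]
    · rfl
  have hRi : ∀ δ, ∫⁻ x : Fin m → Fin n → Ω, R δ (fun i => x (δ i) i)
      ∂(Measure.pi fun _ => Measure.pi fun _ => μ) = ∫⁻ x, R δ x ∂(Measure.pi fun _ => μ) :=
    fun δ => (mp_select μ δ).lintegral_comp (hRm δ)
  have hn0 : (m : ℝ≥0∞) ^ n ≠ 0 := by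
    refine pow_ne_zero _ ?_
    exact_mod_cast hmpos.ne'
  have hnt : (m : ℝ≥0∞) ^ n ≠ ⊤ := by simp
  have hmt : (m : ℝ≥0∞) ^ m ≠ ⊤ := by simp
  have hcard : ∀ a : ℝ≥0∞, ∑ _δ : Fin n → Fin m, a = (m : ℝ≥0∞) ^ n * a := by intro a; simp
  constructor
  · rw [← ENNReal.mul_le_mul_iff_right hn0 hnt, ← lintegral_const_mul' _ _ hnt]
    calc _ ≤ ∫⁻ x : Fin m → Fin n → Ω, (m : ℝ≥0∞) ^ m * ∑ δ : Fin n → Fin m,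
            R δ (fun i => x (δ i) i) ∂(Measure.pi fun _ => Measure.pi fun _ => μ) := by
          refine lintegral_mono fun x => ?_
          simp only [hRd]
          exact sel_ineq (fun i => h i fun k => x k (i k)) (fun i hi => by simp [h0 i hi])
            (fun i => hfin _ _)
      _ = (m : ℝ≥0∞) ^ m * ∑ δ, ∫⁻ x, R δ x ∂(Measure.pi fun _ => μ) := by
          rw [lintegral_const_mul' _ _ hmt, lintegral_finsetSum]
          · simp only [hRi]
          · exact fun δ _ => (hRm δ).comp (mp_select μ δ).measurable
      _ ≤ (m : ℝ≥0∞) ^ m * ∑ _δ : Fin n → Fin m,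
            ∫⁻ x : Fin n → Ω, (∑ i, h i fun k => x (i k)) ^ ((1:ℝ)/2) ∂(Measure.pi fun _ => μ) := by
          simp only [hR]
          gcongr with δ _ x
          split_ifs <;> simp
      _ = _ := by rw [hcard]; ring
  · rw [← ENNReal.mul_le_mul_iff_right hn0 hnt, ← lintegral_const_mul' _ _ hnt]
    calc _ ≤ ∫⁻ x : Fin n → Ω, (m : ℝ≥0∞) ^ m * ∑ δ : Fin n → Fin m,
            R δ x ∂(Measure.pi fun _ => μ) := by
          refine lintegral_mono fun x => ?_
          exact sel_ineq (fun i => h i fun k => x (i k)) (fun i hi => by simp [h0 i hi])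
            (fun i => hfin _ _)
      _ = (m : ℝ≥0∞) ^ m * ∑ δ : Fin n → Fin m, ∫⁻ x : Fin m → Fin n → Ω,
            R δ (fun i => x (δ i) i) ∂(Measure.pi fun _ => Measure.pi fun _ => μ) := by
          rw [lintegral_const_mul' _ _ hmt, lintegral_finsetSum]
          · simp only [hRi]
          · exact fun δ _ => hRm δ
      _ ≤ (m : ℝ≥0∞) ^ m * ∑ _δ : Fin n → Fin m,
            ∫⁻ x : Fin m → Fin n → Ω, (∑ i, h i fun k => x k (i k)) ^ ((1:ℝ)/2)
              ∂(Measure.pi fun _ => Measure.pi fun _ => μ) := by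
          simp only [hRd]
          gcongr with δ _ x
          split_ifs <;> simp
      _ = _ := by rw [hcard]; ring

end Decouple

section Reindex

lemma sum_reindex {A : Type*} [AddCommMonoid A] {n : ℕ} (M : ℕ) (g : (m : ℕ) → (Fin m → Fin n) → A)
    (hg : ∀ m i, ¬ StrictMono i → g m i = 0) :
    ∑ m ∈ Finset.range (M + 1), ∑ i, g m i =
      ∑ I : Finset (Fin n), if I.card ≤ M then g I.card (I.orderEmbOfFin rfl) else 0 := by
  classical
  have key : ∀ m (i : Fin m → Fin n), StrictMono i → ∀ I : Finset (Fin n), Finset.univ.image i = I →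
      g m i = g I.card (I.orderEmbOfFin rfl) := by
    intro m i hi I hI
    have hc : I.card = m := by
      rw [← hI, Finset.card_image_of_injective _ hi.injective]; simp
    subst hc
    congr 1
    exact Finset.orderEmbOfFin_unique rfl (fun k => by
      have : i k ∈ Finset.univ.image i := Finset.mem_image_of_mem _ (Finset.mem_univ k)
      rwa [hI] at this) hi
  have h1 : ∀ m, ∑ i : Fin m → Fin n, g m i =
      ∑ I : Finset (Fin n), if I.card = m then g I.card (I.orderEmbOfFin rfl) else 0 := by
    intro m
    rw [← Finset.sum_filter, ← Finset.sum_filter_of_ne (s := Finset.univ)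
      (p := fun i : Fin m → Fin n => StrictMono i)
      (fun i _ hne => by by_contra h; exact hne (hg m i h))]
    refine Finset.sum_bij (fun i _ => Finset.univ.image i) ?_ ?_ ?_ ?_
    · intro i hi
      have hi := (Finset.mem_filter.1 hi).2
      simp [Finset.card_image_of_injective _ hi.injective]
    · intro i hi j hj hij
      have hi := (Finset.mem_filter.1 hi).2
      have hj := (Finset.mem_filter.1 hj).2
      refine (StrictMono.range_inj hi hj).1 ?_
      have := congrArg (fun s : Finset (Fin n) => (s : Set (Fin n))) hij
      simpa using this
    · intro I hI
      have hI := (Finset.mem_filter.1 hI).2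
      refine ⟨I.orderEmbOfFin hI, ?_, ?_⟩
      · simp [OrderEmbedding.strictMono]
      · simp
    · intro i hi
      exact key m i (Finset.mem_filter.1 hi).2 _ rfl
  simp only [h1]
  rw [Finset.sum_comm]
  refine Finset.sum_congr rfl fun I _ => ?_
  rw [Finset.sum_ite_eq]
  simp [Nat.lt_succ_iff]

end Reindex

section Build
variable {Ω : Type*} [MeasurableSpace Ω] (μ : Measure Ω) [IsProbabilityMeasure μ]
  {B : Type*} [NormedAddCommGroup B] [InnerProductSpace ℝ B] [CompleteSpace B] {n : ℕ}

/-- The component attached to a finite set of coordinates. -/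
noncomputable def comp (M : ℕ) (fm : (m : ℕ) → (Fin m → Fin n) → (Fin m → Ω) → B)
    (I : Finset (Fin n)) (x : Fin n → Ω) : B :=
  if I.card ≤ M then fm I.card (I.orderEmbOfFin rfl) (fun k => x (I.orderEmbOfFin rfl k)) else 0

lemma comp_hoeff (M : ℕ) (fm : (m : ℕ) → (Fin m → Fin n) → (Fin m → Ω) → B)
    (h1 : ∀ m i, StronglyMeasurable (fm m i))
    (h3 : ∀ m (i : Fin m → Fin n) (k : Fin m),
          ∀ᵐ y ∂(Measure.pi fun _ : Fin m => μ),
            ∫ z, fm m i (Function.update y k z) ∂μ = 0)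
    (h4 : ∀ m i, Integrable (fm m i) (Measure.pi fun _ : Fin m => μ)) :
    Hoeff μ (comp M fm) := by
  have hmp : ∀ I : Finset (Fin n), MeasurePreserving
      (fun (x : Fin n → Ω) (k : Fin I.card) => x (I.orderEmbOfFin rfl k))
      (Measure.pi fun _ => μ) (Measure.pi fun _ => μ) := fun I =>
    mp_comp μ _ (I.orderEmbOfFin rfl).injective
  refine ⟨fun I => ?_, fun I => ?_, fun I j hj => ?_, fun I j hj x z => ?_⟩
  · unfold comp
    split_ifs
    · exact (h1 _ _).comp_measurable (hmp I).measurable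
    · exact stronglyMeasurable_const
  · unfold comp
    split_ifs
    · exact ((hmp I).integrable_comp (h4 _ _).aestronglyMeasurable).2 (h4 _ _)
    · exact integrable_zero _ _ _
  · unfold comp
    split_ifs
    · obtain ⟨k, rfl⟩ : ∃ k, I.orderEmbOfFin rfl k = j := by
        have : j ∈ Set.range (I.orderEmbOfFin rfl) := by rw [Finset.range_orderEmbOfFin]; exact hj
        exact this
      have := (hmp I).quasiMeasurePreserving.ae (h3 I.card (I.orderEmbOfFin rfl) k)
      filter_upwards [this] with x hx
      rw [← hx]
      congr 1
      funext z
      congr 1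
      funext l
      by_cases hl : l = k
      · subst hl; simp
      · rw [Function.update_of_ne hl, Function.update_of_ne]
        exact fun h => hl ((I.orderEmbOfFin rfl).injective h)
    · simp
  · unfold comp
    split_ifs
    · congr 1
      funext k
      rw [Function.update_of_ne]
      rintro rfl
      exact hj (Finset.orderEmbOfFin_mem _ _ _)
    · rfl

end Build

end HDS

/-- **Hilbert-space-valued decoupled square function estimate**
(Corollary `decoupvectorval` of the paper): for a Hilbert space `B` and
`f ∈ V^1_{≤M}(Ω^n, B)` with `B`-valued Hoeffding components `fm m i`,
`‖f‖_{L¹(Ω^n,B)}` is equivalent, with constants depending only on `M`, to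
`∑_{m ≤ M} ∫_{Ω^{nm}} (∑_{i₁<⋯<i_m} ‖fm m i (x^{(1)}_{i 1},…,x^{(m)}_{i m})‖_B²)^{1/2}`. -/
theorem hilbert_valued_decoupled_square_function (M : ℕ) :
    ∃ c C : ℝ, 0 < c ∧ 0 < C ∧
      ∀ (Ω : Type u) [MeasurableSpace Ω] (μ : Measure Ω) [IsProbabilityMeasure μ]
        (B : Type v) [NormedAddCommGroup B] [InnerProductSpace ℝ B] [CompleteSpace B]
        (n : ℕ) (fm : (m : ℕ) → (Fin m → Fin n) → (Fin m → Ω) → B),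
        (∀ m i, StronglyMeasurable (fm m i)) →
        (∀ m i, ¬ StrictMono i → fm m i = 0) →
        (∀ m (i : Fin m → Fin n) (k : Fin m),
          ∀ᵐ y ∂(Measure.pi fun _ : Fin m => μ),
            ∫ z, fm m i (Function.update y k z) ∂μ = 0) →
        (∀ m i, Integrable (fm m i) (Measure.pi fun _ : Fin m => μ)) →
        (ENNReal.ofReal c *
            (∑ m ∈ Finset.range (M + 1),
              ∫⁻ x : Fin m → Fin n → Ω,
                (∑ i : Fin m → Fin n,
                  ENNReal.ofReal (‖fm m i fun k => x k (i k)‖ ^ 2)) ^ ((1:ℝ)/2)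
                ∂Measure.pi fun _ : Fin m => Measure.pi fun _ : Fin n => μ)
          ≤ ∫⁻ x : Fin n → Ω,
              ENNReal.ofReal ‖∑ m ∈ Finset.range (M + 1),
                ∑ i : Fin m → Fin n, fm m i fun k => x (i k)‖
              ∂Measure.pi fun _ : Fin n => μ) ∧
        ((∫⁻ x : Fin n → Ω,
              ENNReal.ofReal ‖∑ m ∈ Finset.range (M + 1),
                ∑ i : Fin m → Fin n, fm m i fun k => x (i k)‖
              ∂Measure.pi fun _ : Fin n => μ)
          ≤ ENNReal.ofReal C *
            ∑ m ∈ Finset.range (M + 1),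
              ∫⁻ x : Fin m → Fin n → Ω,
                (∑ i : Fin m → Fin n,
                  ENNReal.ofReal (‖fm m i fun k => x k (i k)‖ ^ 2)) ^ ((1:ℝ)/2)
                ∂Measure.pi fun _ : Fin m => Measure.pi fun _ : Fin n => μ) := by
  obtain ⟨s, c, hs, hc⟩ := HDS.lagrange_exists M
  set C₀ : ℝ := ∑ k ∈ Finset.range (M + 1), |c k| with hC₀
  have hC₀0 : 0 < C₀ := by
    have h := hc 0 (Nat.zero_le _)
    simp only [pow_zero, mul_one] at h
    have : |∑ k ∈ Finset.range (M + 1), c k| ≤ C₀ := Finset.abs_sum_le_sum_abs _ _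
    rw [h] at this
    simp at this
    linarith
  set D : ℝ := (M + 1) ^ (M + 1) with hD
  have hDpos : 0 < D := by positivity
  set K : ℝ := (M + 1) * D * (3 * 3 ^ M) * C₀ with hK
  have hKpos : 0 < K := by positivity
  refine ⟨K⁻¹, C₀ * D, by positivity, by positivity, ?_⟩
  intro Ω _ μ _ B _ _ _ n fm h1 h2 h3 h4
  have hF := HDS.comp_hoeff μ M fm h1 h3 h4
  obtain ⟨hA, hB⟩ := HDS.coupled hF M s c hs hc (fun I hI => by
    funext x; simp [HDS.comp, Nat.not_le.2 hI])
  rw [← hC₀] at hA hB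
  have hsum : ∀ x : Fin n → Ω, ∑ I, HDS.comp M fm I x =
      ∑ m ∈ Finset.range (M + 1), ∑ i : Fin m → Fin n, fm m i fun k => x (i k) := by
    intro x
    rw [HDS.sum_reindex M (fun m i => fm m i fun k => x (i k)) (fun m i hi => by simp [h2 m i hi])]
    rfl
  have hsq : ∀ x : Fin n → Ω, ∑ I, ‖HDS.comp M fm I x‖ₑ ^ 2 =
      ∑ m ∈ Finset.range (M + 1), ∑ i : Fin m → Fin n, ‖fm m i fun k => x (i k)‖ₑ ^ 2 := by
    intro x
    rw [HDS.sum_reindex M (fun m i => ‖fm m i fun k => x (i k)‖ₑ ^ 2)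
      (fun m i hi => by simp [h2 m i hi])]
    refine Finset.sum_congr rfl fun I _ => ?_
    unfold HDS.comp
    split_ifs <;> simp
  simp only [hsum, hsq] at hA hB
  simp only [ENNReal.ofReal_pow (norm_nonneg _), ofReal_norm]
  set L := ∫⁻ x : Fin n → Ω, ‖∑ m ∈ Finset.range (M + 1),
    ∑ i : Fin m → Fin n, fm m i fun k => x (i k)‖ₑ ∂Measure.pi fun _ : Fin n => μ with hL
  set Q := ∫⁻ x : Fin n → Ω, (∑ m ∈ Finset.range (M + 1),
    ∑ i : Fin m → Fin n, ‖fm m i fun k => x (i k)‖ₑ ^ 2) ^ ((1:ℝ)/2)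
    ∂Measure.pi fun _ : Fin n => μ with hQ
  set cp : ℕ → ℝ≥0∞ := fun m => ∫⁻ x : Fin n → Ω,
    (∑ i : Fin m → Fin n, ‖fm m i fun k => x (i k)‖ₑ ^ 2) ^ ((1:ℝ)/2)
    ∂Measure.pi fun _ : Fin n => μ with hcp
  set dc : ℕ → ℝ≥0∞ := fun m => ∫⁻ x : Fin m → Fin n → Ω,
    (∑ i : Fin m → Fin n, ‖fm m i fun k => x k (i k)‖ₑ ^ 2) ^ ((1:ℝ)/2)
    ∂Measure.pi fun _ : Fin m => Measure.pi fun _ : Fin n => μ with hdc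
  have hdec : ∀ m, dc m ≤ (m : ℝ≥0∞) ^ m * cp m ∧ cp m ≤ (m : ℝ≥0∞) ^ m * dc m := fun m =>
    HDS.decouple μ (fun i y => ‖fm m i y‖ₑ ^ 2) (fun i => (h1 m i).enorm.pow_const 2)
      (fun i hi => by
        have : ¬ StrictMono i := fun h => hi h.injective
        funext y; simp [h2 m i this]) (fun i y => by simp)
  have hmD : ∀ m ∈ Finset.range (M + 1), (m : ℝ≥0∞) ^ m ≤ ENNReal.ofReal D := by
    intro m hm
    have hm' : m ≤ M + 1 := (Finset.mem_range.1 hm).le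
    have h : m ^ m ≤ (M + 1) ^ (M + 1) :=
      (Nat.pow_le_pow_left hm' m).trans (Nat.pow_le_pow_right (Nat.succ_pos _) hm')
    have e : ENNReal.ofReal D = (((M + 1) ^ (M + 1) : ℕ) : ℝ≥0∞) := by
      rw [← ENNReal.ofReal_natCast, hD]; push_cast; rfl
    rw [e]
    exact_mod_cast h
  have hcpQ : ∀ m ∈ Finset.range (M + 1), cp m ≤ Q := by
    intro m hm
    refine lintegral_mono fun x => ?_
    refine ENNReal.rpow_le_rpow ?_ (by norm_num)
    exact Finset.single_le_sum (f := fun m => ∑ i : Fin m → Fin n, ‖fm m i fun k => x (i k)‖ₑ ^ 2)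
      (fun _ _ => zero_le) hm
  have hQcp : Q ≤ ∑ m ∈ Finset.range (M + 1), cp m := by
    rw [hcp, ← lintegral_finsetSum]
    · refine lintegral_mono fun x => ?_
      refine Finset.le_sum_of_subadditive (fun t : ℝ≥0∞ => t ^ ((1:ℝ)/2)) (by simp)
        (fun a b => ENNReal.rpow_add_le_add_rpow a b (by norm_num) (by norm_num)) _ _
    · intro m _
      refine Measurable.pow_const ?_ _
      refine Finset.measurable_fun_sum _ fun i _ => ?_
      exact Measurable.pow_const (((h1 m i).enorm).comp (by fun_prop)) 2
  constructor
  · have hstep : ∑ m ∈ Finset.range (M + 1), dc m ≤ ENNReal.ofReal K * L := by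
      calc _ ≤ ∑ _m ∈ Finset.range (M + 1), ENNReal.ofReal D * Q := by
            refine Finset.sum_le_sum fun m hm => (hdec m).1.trans ?_
            exact mul_le_mul' (hmD m hm) (hcpQ m hm)
        _ = ENNReal.ofReal ((M + 1) * D) * Q := by
            rw [Finset.sum_const, Finset.card_range, nsmul_eq_mul, ENNReal.ofReal_mul (by positivity),
              mul_assoc]
            congr 1
            rw [← ENNReal.ofReal_natCast]; push_cast; rfl
        _ ≤ ENNReal.ofReal ((M + 1) * D) * (ENNReal.ofReal (3 * 3 ^ M) * (ENNReal.ofReal C₀ * L)) := by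
            gcongr
        _ = _ := by
            rw [hK, ENNReal.ofReal_mul (p := (M + 1) * D * (3 * 3 ^ M)) (by positivity),
              ENNReal.ofReal_mul (p := (M + 1) * D) (by positivity)]
            ring
    calc _ ≤ ENNReal.ofReal K⁻¹ * (ENNReal.ofReal K * L) := by gcongr
      _ = L := by
          rw [← mul_assoc, ← ENNReal.ofReal_mul (by positivity), inv_mul_cancel₀ hKpos.ne']
          simp
  · calc L ≤ ENNReal.ofReal C₀ * Q := hA
      _ ≤ ENNReal.ofReal C₀ * ∑ m ∈ Finset.range (M + 1), ENNReal.ofReal D * dc m := by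
          gcongr
          refine hQcp.trans (Finset.sum_le_sum fun m hm => (hdec m).2.trans ?_)
          gcongr
          exact hmD m hm
      _ = _ := by
          rw [← Finset.mul_sum, ENNReal.ofReal_mul hC₀0.le, mul_assoc]
end
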